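/- Let B be the open unit ball in ℝ^n, α ∈ (0,1), 0 < λ < Λ, and M, M' > 0. There exists C > 0, depending only on n, α, λ, Λ, M and M', with the following property. Suppose a_{ij} : ℝ^n → ℝ (1 ≤ i,j ≤ n, forming a symmetric matrix-valued function) and b : ℝ^n → ℝ are C^{1,α} functions with C^{1,α} norm at most M', b ≥ 0, and λ·Id < (a_{ij}(p)) < Λ·Id for all p ∈ ℝ^n. If h : B → ℝ is a smooth convex function with ‖h‖_{C^1(B)} ≤ M satisfying Σ_{i,j} a_{ij}(∇h(x))·∂_i∂_j h(x) + b(∇h(x))·det(D²h(x)) = 1 on B, then ‖h‖_{C^{2,α}(B_{1/2})} ≤ C, where B_{1/2} is the concentric ball of radius 1/2. -/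

import Mathlib

/-- The Hessian matrix `D²f(x)` of `f : ℝⁿ → ℝ` at `x`, with entries `∂_i ∂_j f(x)`. -/
noncomputable def Hess (n : ℕ) (f : EuclideanSpace ℝ (Fin n) → ℝ)
    (x : EuclideanSpace ℝ (Fin n)) : Matrix (Fin n) (Fin n) ℝ :=
  Matrix.of fun i j =>
    iteratedFDeriv ℝ 2 f x ![EuclideanSpace.single i 1, EuclideanSpace.single j 1]

section PartA1
open Matrix

/-! ### Part 1: matrix algebra -/

/-- squared Frobenius norm -/
noncomputable def fsq {n : ℕ} (M : Matrix (Fin n) (Fin n) ℝ) : ℝ := ∑ i, ∑ j, (M i j) ^ 2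

lemma fsq_nonneg {n : ℕ} (M : Matrix (Fin n) (Fin n) ℝ) : 0 ≤ fsq M :=
  Finset.sum_nonneg fun _ _ => Finset.sum_nonneg fun _ _ => sq_nonneg _

lemma fsq_eq_trace {n : ℕ} (M : Matrix (Fin n) (Fin n) ℝ) : fsq M = (M * Mᵀ).trace := by
  simp [fsq, Matrix.trace, Matrix.mul_apply, sq]

lemma fsq_mul_le {n : ℕ} (M N : Matrix (Fin n) (Fin n) ℝ) : fsq (M * N) ≤ fsq M * fsq N := by
  have h1 : ∀ i j, ((M * N) i j) ^ 2 ≤ (∑ k, (M i k) ^ 2) * (∑ k, (N k j) ^ 2) := by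
    intro i j
    rw [Matrix.mul_apply]
    exact Finset.sum_mul_sq_le_sq_mul_sq _ _ _
  calc fsq (M * N) ≤ ∑ i, ∑ j, (∑ k, (M i k) ^ 2) * (∑ k, (N k j) ^ 2) :=
        Finset.sum_le_sum fun i _ => Finset.sum_le_sum fun j _ => h1 i j
    _ = (∑ i, ∑ k, (M i k) ^ 2) * (∑ j, ∑ k, (N k j) ^ 2) := by
        simp_rw [← Finset.mul_sum]; rw [← Finset.sum_mul]
    _ = fsq M * fsq N := by
        unfold fsq; congr 1; rw [Finset.sum_comm]

open scoped MatrixOrder in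
lemma psd_factor {n : ℕ} {A : Matrix (Fin n) (Fin n) ℝ} (h : A.PosSemidef) :
    ∃ R : Matrix (Fin n) (Fin n) ℝ, A = Rᵀ * R := by
  obtain ⟨B, hB⟩ := CStarAlgebra.nonneg_iff_eq_star_mul_self.mp h.nonneg
  exact ⟨B, by rw [hB]; simp [Matrix.star_eq_conjTranspose, Matrix.conjTranspose_eq_transpose_of_trivial]⟩

lemma psd_quad {n : ℕ} {A : Matrix (Fin n) (Fin n) ℝ} (h : A.PosSemidef) (v : Fin n → ℝ) :
    0 ≤ v ⬝ᵥ (A *ᵥ v) := by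
  simpa using h.dotProduct_mulVec_nonneg v

lemma psd_symm {n : ℕ} {A : Matrix (Fin n) (Fin n) ℝ} (h : A.PosSemidef) : Aᵀ = A := by
  have := h.1
  rwa [Matrix.IsHermitian, Matrix.conjTranspose_eq_transpose_of_trivial] at this

lemma pd_symm {n : ℕ} {A : Matrix (Fin n) (Fin n) ℝ} (h : A.PosDef) : Aᵀ = A :=
  psd_symm h.posSemidef

lemma psd_entry_le_trace {n : ℕ} {A : Matrix (Fin n) (Fin n) ℝ} (h : A.PosSemidef) (i j : Fin n) :
    |A i j| ≤ A.trace := by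
  obtain ⟨R, rfl⟩ := psd_factor h
  have hd : ∀ i, (Rᵀ * R) i i ≤ (Rᵀ * R).trace := fun i =>
    Finset.single_le_sum (f := fun i => (Rᵀ * R) i i) (fun k _ => h.diag_nonneg) (Finset.mem_univ i)
  have e : ∀ i j, (Rᵀ * R) i j = ∑ k, R k i * R k j := by
    intro i j; simp [Matrix.mul_apply]
  have key : |(Rᵀ * R) i j| ≤ ((Rᵀ * R) i i + (Rᵀ * R) j j) / 2 := by
    rw [e, e, e, abs_le, ← Finset.sum_add_distrib]
    constructor
    · rw [neg_le, ← Finset.sum_neg_distrib, Finset.sum_div]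
      exact Finset.sum_le_sum fun k _ => by nlinarith [sq_nonneg (R k i + R k j)]
    · rw [Finset.sum_div]
      exact Finset.sum_le_sum fun k _ => by nlinarith [sq_nonneg (R k i - R k j)]
  linarith [hd i, hd j]

/-- `a ≥ lam` as quadratic form implies `tr (a X) ≥ lam tr X` for `X ≥ 0`. -/
lemma trace_mul_ge {n : ℕ} {a X : Matrix (Fin n) (Fin n) ℝ} {lam : ℝ}
    (ha : ∀ v : Fin n → ℝ, lam * (v ⬝ᵥ v) ≤ v ⬝ᵥ (a *ᵥ v)) (hX : X.PosSemidef) :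
    lam * X.trace ≤ (a * X).trace := by
  obtain ⟨R, rfl⟩ := psd_factor hX
  have h1 : (a * (Rᵀ * R)).trace = ∑ k, (R k) ⬝ᵥ (a *ᵥ (R k)) := by
    rw [← Matrix.mul_assoc, Matrix.trace_mul_comm]
    simp only [Matrix.trace, Matrix.diag_apply, Matrix.mul_apply, dotProduct, Matrix.mulVec,
      Matrix.transpose_apply]
  have h2 : (Rᵀ * R).trace = ∑ k, (R k) ⬝ᵥ (R k) := by
    rw [Matrix.trace_mul_comm]
    simp only [Matrix.trace, Matrix.diag_apply, Matrix.mul_apply, dotProduct, Matrix.transpose_apply]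
  rw [h1, h2, Finset.mul_sum]
  exact Finset.sum_le_sum fun k _ => ha _

lemma abs_trace_mul_le {n : ℕ} (M : Matrix (Fin n) (Fin n) ℝ) {X : Matrix (Fin n) (Fin n) ℝ} {m : ℝ}
    (hM : ∀ i j, |M i j| ≤ m) (hX : X.PosSemidef) :
    |(M * X).trace| ≤ n ^ 2 * m * X.trace := by
  have hX' := fun i j => psd_entry_le_trace hX i j
  have ht := hX.trace_nonneg
  calc |(M * X).trace| ≤ ∑ i, ∑ j, |M i j * X j i| := by
        simp only [Matrix.trace, Matrix.diag_apply, Matrix.mul_apply]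
        exact (Finset.abs_sum_le_sum_abs _ _).trans
          (Finset.sum_le_sum fun i _ => Finset.abs_sum_le_sum_abs _ _)
    _ ≤ ∑ i : Fin n, ∑ j : Fin n, m * X.trace := by
        refine Finset.sum_le_sum fun i _ => Finset.sum_le_sum fun j _ => ?_
        rw [abs_mul]
        exact mul_le_mul (hM i j) (hX' j i) (abs_nonneg _) ((abs_nonneg _).trans (hM i j))
    _ = n ^ 2 * m * X.trace := by simp; ring

lemma det_ineq {n : ℕ} {P P1 : Matrix (Fin n) (Fin n) ℝ} (hP : P.PosDef) (hP1 : P1.PosDef) :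
    P1.det * (1 + n - (P1 * P⁻¹).trace) ≤ P.det := by
  obtain ⟨R, hR⟩ := psd_factor hP.inv.posSemidef
  have hRu : IsUnit R.det := by
    have : IsUnit (P⁻¹).det := (Matrix.isUnit_iff_isUnit_det _).1 hP.inv.isUnit
    rw [hR, Matrix.det_mul] at this
    exact isUnit_of_mul_isUnit_right this
  have hY : (R * P1 * Rᵀ).PosDef := by
    have := hP1.mul_mul_conjTranspose_same (B := R) ?_
    · simpa [Matrix.conjTranspose_eq_transpose_of_trivial] using this
    · exact Matrix.vecMul_injective_of_isUnit ((Matrix.isUnit_iff_isUnit_det _).2 hRu)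
  have htr : (R * P1 * Rᵀ).trace = (P1 * P⁻¹).trace := by
    rw [hR, Matrix.trace_mul_comm, ← Matrix.mul_assoc, Matrix.trace_mul_comm]
  have hPd := hP.det_pos
  have hP1d := hP1.det_pos
  have hdet : (R * P1 * Rᵀ).det * P.det = P1.det := by
    have : (P⁻¹).det * P.det = 1 := by
      rw [← Matrix.det_mul, Matrix.nonsing_inv_mul _ ((Matrix.isUnit_iff_isUnit_det _).1 hP.isUnit)]
      simp
    rw [hR, Matrix.det_mul] at this
    rw [Matrix.det_mul, Matrix.det_mul]
    linear_combination P1.det * this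
  set Y := R * P1 * Rᵀ with hYdef
  have hH := hY.1
  have hpos := hY.eigenvalues_pos
  have e1 : Y.det = ∏ i, hH.eigenvalues i := by
    simpa using hH.det_eq_prod_eigenvalues
  have e2 : Y.trace = ∑ i, hH.eigenvalues i := by
    simpa using hH.trace_eq_sum_eigenvalues
  -- log inequality
  have hlog : Real.log Y.det ≤ Y.trace - n := by
    rw [e1, e2, Real.log_prod (fun i _ => (hpos i).ne')]
    calc ∑ i, Real.log (hH.eigenvalues i) ≤ ∑ i, (hH.eigenvalues i - 1) :=
          Finset.sum_le_sum fun i _ => Real.log_le_sub_one_of_pos (hpos i)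
      _ = _ := by simp
  have hYd := hY.det_pos
  have h3 : 1 - Real.log Y.det ≤ (Y.det)⁻¹ := by
    have := Real.add_one_le_exp (-Real.log Y.det)
    rw [Real.exp_neg, Real.exp_log hYd] at this
    linarith
  have h4 : 1 + n - (P1 * P⁻¹).trace ≤ (Y.det)⁻¹ := by rw [← htr]; linarith
  calc P1.det * (1 + n - (P1 * P⁻¹).trace) ≤ P1.det * (Y.det)⁻¹ :=
        mul_le_mul_of_nonneg_left h4 hP1d.le
    _ = P.det := by rw [← hdet]; field_simp

lemma fsq_le_trace {n : ℕ} {P D : Matrix (Fin n) (Fin n) ℝ} (hP : P.PosDef) (hD : Dᵀ = D) :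
    fsq D ≤ P.trace * (D * P⁻¹ * D).trace := by
  obtain ⟨S, hS⟩ := psd_factor hP.inv.posSemidef
  have hu := (Matrix.isUnit_iff_isUnit_det _).1 hP.isUnit
  have h1 : D = (P * Sᵀ) * (S * D) := by
    calc D = (P * P⁻¹) * D := by rw [Matrix.mul_nonsing_inv _ hu, Matrix.one_mul]
      _ = _ := by rw [hS]; simp only [Matrix.mul_assoc]
  have h2 : fsq (P * Sᵀ) = P.trace := by
    rw [fsq_eq_trace, Matrix.transpose_mul, Matrix.transpose_transpose, pd_symm hP]
    have : P * Sᵀ * (S * P) = P * P⁻¹ * P := by rw [hS]; simp only [Matrix.mul_assoc]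
    rw [this, Matrix.mul_nonsing_inv _ hu, Matrix.one_mul]
  have h3 : fsq (S * D) = (D * P⁻¹ * D).trace := by
    rw [fsq_eq_trace, Matrix.transpose_mul, hD, Matrix.trace_mul_comm, hS]
    simp only [Matrix.mul_assoc]
  calc fsq D = fsq ((P * Sᵀ) * (S * D)) := by rw [← h1]
    _ ≤ fsq (P * Sᵀ) * fsq (S * D) := fsq_mul_le _ _
    _ = _ := by rw [h2, h3]
end PartA1

section PartA2
open Matrix

/-! ### Part 2: derivatives of determinants -/

section detcalc
attribute [local instance] Matrix.normedAddCommGroup Matrix.normedSpace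

/-- the determinant as a continuous multilinear map of the rows -/
noncomputable def detCM (n : ℕ) : ContinuousMultilinearMap ℝ (fun _ : Fin n => (Fin n → ℝ)) ℝ :=
  { (Matrix.detRowAlternating (R := ℝ) (n := Fin n)).toMultilinearMap with
    cont := by
      change Continuous (fun M : Fin n → Fin n → ℝ => Matrix.det (Matrix.of M))
      exact Continuous.matrix_det (A := fun M : Fin n → Fin n → ℝ => Matrix.of M) continuous_id }

lemma detCM_apply (n : ℕ) (M : Fin n → Fin n → ℝ) : detCM n M = Matrix.det (Matrix.of M) := rfl

lemma det_updateRow_eq {n : ℕ} (A : Matrix (Fin n) (Fin n) ℝ) (r : Fin n) (Y : Fin n → ℝ) :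
    (A.updateRow r Y).det = ∑ s, A.adjugate s r * Y s := by
  rw [Matrix.det_eq_sum_mul_adjugate_row _ r]
  refine Finset.sum_congr rfl fun s _ => ?_
  rw [Matrix.adjugate_apply, Matrix.adjugate_apply, Matrix.updateRow_self]
  rw [mul_comm]; congr 2
  ext i j; by_cases h : i = r
  · subst h; simp
  · simp [Matrix.updateRow_ne h]

variable {E : Type*} [NormedAddCommGroup E] [NormedSpace ℝ E]

lemma det_hasFDerivAt {n : ℕ} {M : E → Matrix (Fin n) (Fin n) ℝ}
    {M' : Fin n → Fin n → (E →L[ℝ] ℝ)} {x : E}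
    (h : ∀ i j, HasFDerivAt (fun y => M y i j) (M' i j) x) :
    HasFDerivAt (fun y => (M y).det) (∑ r, ∑ s, (M x).adjugate s r • M' r s) x := by
  have h1 : HasFDerivAt (fun y => (M y : Fin n → Fin n → ℝ))
      (ContinuousLinearMap.pi fun i => ContinuousLinearMap.pi fun j => M' i j) x :=
    hasFDerivAt_pi.2 fun i => hasFDerivAt_pi.2 fun j => h i j
  have h2 := ((detCM n).hasFDerivAt (M x)).comp x h1
  refine h2.congr_fderiv ?_
  ext v
  rw [ContinuousLinearMap.comp_apply]
  refine ((detCM n).linearDeriv_apply _ _).trans ?_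
  simp only [_root_.sum_apply, _root_.smul_apply, smul_eq_mul]
  refine Finset.sum_congr rfl fun r _ => ?_
  exact det_updateRow_eq (M x) r _

/-- second cofactor: derivative of `adj i j` in the entry `(r,s)` -/
noncomputable def cof2 {n : ℕ} (A : Matrix (Fin n) (Fin n) ℝ) (i j s r : Fin n) : ℝ :=
  if r = j then 0 else (A.updateRow j (Pi.single i 1)).adjugate s r

lemma adj_hasFDerivAt {n : ℕ} {M : E → Matrix (Fin n) (Fin n) ℝ}
    {M' : Fin n → Fin n → (E →L[ℝ] ℝ)} {x : E}
    (h : ∀ i j, HasFDerivAt (fun y => M y i j) (M' i j) x) (i j : Fin n) :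
    HasFDerivAt (fun y => (M y).adjugate i j) (∑ r, ∑ s, cof2 (M x) i j s r • M' r s) x := by
  have h1 : ∀ r s, HasFDerivAt (fun y => ((M y).updateRow j (Pi.single i 1)) r s)
      (if r = j then 0 else M' r s) x := by
    intro r s
    by_cases hr : r = j
    · subst hr; simp only [Matrix.updateRow_self, if_true]; exact hasFDerivAt_const _ _
    · simp only [Matrix.updateRow_ne hr, if_neg hr]; exact h r s
  have h2 := det_hasFDerivAt h1
  simp_rw [Matrix.adjugate_apply]
  refine h2.congr_fderiv ?_
  refine Finset.sum_congr rfl fun r _ => Finset.sum_congr rfl fun s _ => ?_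
  unfold cof2
  by_cases hr : r = j <;> simp [hr]

lemma cof2_antisymm {n : ℕ} (A : Matrix (Fin n) (Fin n) ℝ) (i j s r : Fin n) :
    cof2 A i j s r = - cof2 A s j i r := by
  unfold cof2
  by_cases hr : r = j
  · simp [hr]
  · simp only [if_neg hr, Matrix.adjugate_apply]
    have hjr : j ≠ r := fun h => hr h.symm
    have := Matrix.det_permute (Equiv.swap j r)
      ((A.updateRow j (Pi.single s 1)).updateRow r (Pi.single i 1))
    rw [Equiv.Perm.sign_swap hjr] at this
    have e : ((A.updateRow j (Pi.single s 1)).updateRow r (Pi.single i 1)).submatrix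
        (Equiv.swap j r) id = (A.updateRow j (Pi.single i 1)).updateRow r (Pi.single s 1) := by
      ext p q
      simp only [Matrix.submatrix_apply, id]
      by_cases hp : p = j
      · subst hp; simp [Matrix.updateRow_ne hjr]
      · by_cases hp2 : p = r
        · subst hp2; simp [Matrix.updateRow_ne hjr]
        · rw [Equiv.swap_apply_of_ne_of_ne hp hp2]
          simp [Matrix.updateRow_ne hp, Matrix.updateRow_ne hp2]
    rw [e] at this
    rw [this]; simp

lemma piola_alg {n : ℕ} (A : Matrix (Fin n) (Fin n) ℝ) (T : Fin n → Fin n → Fin n → ℝ)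
    (hT : ∀ i r s, T i r s = T s r i) (j : Fin n) :
    ∑ i, ∑ r, ∑ s, cof2 A i j s r * T i r s = 0 := by
  have h1 : ∑ i, ∑ r, ∑ s, cof2 A i j s r * T i r s
      = ∑ i, ∑ r, ∑ s, cof2 A s j i r * T s r i := by
    rw [Finset.sum_comm]
    conv_rhs => rw [Finset.sum_comm]
    refine Finset.sum_congr rfl fun r _ => ?_
    rw [Finset.sum_comm]
  have h2 : ∑ i, ∑ r, ∑ s, cof2 A s j i r * T s r i
      = - ∑ i, ∑ r, ∑ s, cof2 A i j s r * T i r s := by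
    simp_rw [← Finset.sum_neg_distrib]
    refine Finset.sum_congr rfl fun i _ => Finset.sum_congr rfl fun r _ =>
      Finset.sum_congr rfl fun s _ => ?_
    rw [cof2_antisymm A s j i r, hT s r i]; ring
  linarith

lemma contDiff_entry {n : ℕ} (i j : Fin n) :
    ContDiff ℝ 1 (fun A : Matrix (Fin n) (Fin n) ℝ => A i j) :=
  contDiff_apply_apply (𝕜 := ℝ) (n := 1) ℝ i j

lemma contDiff_det' {n : ℕ} {M : E → Matrix (Fin n) (Fin n) ℝ} {m : WithTop ℕ∞}
    (h : ∀ i j, ContDiff ℝ m (fun x => M x i j)) : ContDiff ℝ m (fun x => (M x).det) := by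
  simp_rw [Matrix.det_apply']
  fun_prop

lemma contDiff_adj {n : ℕ} {M : E → Matrix (Fin n) (Fin n) ℝ} {m : WithTop ℕ∞}
    (h : ∀ i j, ContDiff ℝ m (fun x => M x i j)) (i j : Fin n) :
    ContDiff ℝ m (fun x => (M x).adjugate i j) := by
  simp_rw [Matrix.adjugate_apply]
  refine contDiff_det' fun r s => ?_
  by_cases hr : r = j
  · subst hr; simp only [Matrix.updateRow_self]; fun_prop
  · simp only [Matrix.updateRow_ne hr]; exact h r s

lemma contDiff_cof2 {n : ℕ} {M : E → Matrix (Fin n) (Fin n) ℝ} {m : WithTop ℕ∞}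
    (h : ∀ i j, ContDiff ℝ m (fun x => M x i j)) (i j s r : Fin n) :
    ContDiff ℝ m (fun x => cof2 (M x) i j s r) := by
  unfold cof2
  by_cases hr : r = j
  · simp [hr, contDiff_const]
  · simp only [if_neg hr]
    refine contDiff_adj (fun p q => ?_) _ _
    by_cases hp : p = j
    · subst hp; simp only [Matrix.updateRow_self]; fun_prop
    · simp only [Matrix.updateRow_ne hp]; exact h p q

/-- `C¹` functions of matrices are bounded and Lipschitz on bounded sets (entrywise). -/
lemma cd_lip {n : ℕ} (f : Matrix (Fin n) (Fin n) ℝ → ℝ) (hf : ContDiff ℝ 1 f) (K : ℝ) (hK : 0 ≤ K) :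
    ∃ C, 0 ≤ C ∧ ∀ A A' : Matrix (Fin n) (Fin n) ℝ, (∀ i j, |A i j| ≤ K) → (∀ i j, |A' i j| ≤ K) →
      |f A| ≤ C ∧ ∀ d, 0 ≤ d → (∀ i j, |A i j - A' i j| ≤ d) → |f A - f A'| ≤ C * d := by
  have hcpt : IsCompact (Metric.closedBall (0 : Matrix (Fin n) (Fin n) ℝ) K) :=
    isCompact_closedBall _ _
  obtain ⟨C1, hC1⟩ := hcpt.exists_bound_of_continuousOn hf.continuous.continuousOn
  obtain ⟨C2, hC2⟩ := hcpt.exists_bound_of_continuousOn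
    (hf.continuous_fderiv one_ne_zero).continuousOn
  refine ⟨max (max C1 C2) 0, le_max_right _ _, fun A A' hA hA' => ?_⟩
  have hm : ∀ A : Matrix (Fin n) (Fin n) ℝ, (∀ i j, |A i j| ≤ K) →
      A ∈ Metric.closedBall (0 : Matrix (Fin n) (Fin n) ℝ) K := by
    intro A hA
    rw [mem_closedBall_zero_iff, Matrix.norm_le_iff hK]
    exact hA
  refine ⟨?_, fun d hd hAA => ?_⟩
  · exact (hC1 A (hm A hA)).trans ((le_max_left _ _).trans (le_max_left _ _))
  · have := (convex_closedBall (0 : Matrix (Fin n) (Fin n) ℝ) K).norm_image_sub_le_of_norm_fderiv_le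
      (f := f) (C := max (max C1 C2) 0) (𝕜 := ℝ)
      (fun x _ => (hf.differentiable one_ne_zero x))
      (fun x hx => (hC2 x hx).trans ((le_max_right _ _).trans (le_max_left _ _))) (hm A' hA') (hm A hA)
    rw [Real.norm_eq_abs] at this
    refine this.trans ?_
    gcongr
    rw [Matrix.norm_le_iff hd]
    exact hAA

end detcalc
end PartA2

section PartA3
open Matrix

/-! ### Part 3: the key algebraic inequality -/

/-- second derivative of the determinant in direction `X` -/
noncomputable def q2 {n : ℕ} (A X : Matrix (Fin n) (Fin n) ℝ) : ℝ :=
  ∑ j, ∑ i, (∑ r, ∑ s, cof2 A i j s r * X r s) * X j i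

lemma line_entry_hasFDerivAt {n : ℕ} (A X : Matrix (Fin n) (Fin n) ℝ) (t : ℝ) (i j : Fin n) :
    HasFDerivAt (fun t : ℝ => (A + t • X) i j)
      ((X i j) • ContinuousLinearMap.id ℝ ℝ) t := by
  simp only [Matrix.add_apply, Matrix.smul_apply, smul_eq_mul]
  have h := ((hasFDerivAt_id (𝕜 := ℝ) t).mul_const (X i j)).const_add (A i j)
  exact h

lemma det_line_hasDerivAt {n : ℕ} (A X : Matrix (Fin n) (Fin n) ℝ) (t : ℝ) :
    HasDerivAt (fun t : ℝ => (A + t • X).det)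
      (∑ r, ∑ s, (A + t • X).adjugate s r * X r s) t := by
  have h := (det_hasFDerivAt (fun i j => line_entry_hasFDerivAt A X t i j)).hasDerivAt
  convert h using 1
  simp

lemma adj_line_hasDerivAt {n : ℕ} (A X : Matrix (Fin n) (Fin n) ℝ) (t : ℝ) (i j : Fin n) :
    HasDerivAt (fun t : ℝ => (A + t • X).adjugate i j)
      (∑ r, ∑ s, cof2 (A + t • X) i j s r * X r s) t := by
  have h := (adj_hasFDerivAt (fun i j => line_entry_hasFDerivAt A X t i j) i j).hasDerivAt
  convert h using 1
  simp

lemma det_line_hasDerivAt2 {n : ℕ} (A X : Matrix (Fin n) (Fin n) ℝ) (t : ℝ) :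
    HasDerivAt (fun t : ℝ => ∑ r, ∑ s, (A + t • X).adjugate s r * X r s)
      (q2 (A + t • X) X) t := by
  unfold q2
  refine HasDerivAt.fun_sum fun r _ => HasDerivAt.fun_sum fun s _ => ?_
  exact (adj_line_hasDerivAt A X t s r).mul_const _

lemma abs_entry_le_sqrt_fsq {n : ℕ} (X : Matrix (Fin n) (Fin n) ℝ) (i j : Fin n) :
    |X i j| ≤ Real.sqrt (fsq X) := by
  apply Real.abs_le_sqrt
  unfold fsq
  calc (X i j)^2 ≤ ∑ j, (X i j)^2 :=
        Finset.single_le_sum (f := fun j => (X i j)^2) (fun _ _ => sq_nonneg _) (Finset.mem_univ j)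
    _ ≤ _ := Finset.single_le_sum (f := fun i => ∑ j, (X i j)^2)
        (fun _ _ => Finset.sum_nonneg fun _ _ => sq_nonneg _) (Finset.mem_univ i)

section
attribute [local instance] Matrix.normedAddCommGroup Matrix.normedSpace

lemma cof2_lip (n : ℕ) (K : ℝ) (hK : 0 ≤ K) : ∃ C, 0 ≤ C ∧ ∀ A A' : Matrix (Fin n) (Fin n) ℝ,
    (∀ i j, |A i j| ≤ K) → (∀ i j, |A' i j| ≤ K) → ∀ i j s r, |cof2 A i j s r| ≤ C ∧
      ∀ d, 0 ≤ d → (∀ i j, |A i j - A' i j| ≤ d) → |cof2 A i j s r - cof2 A' i j s r| ≤ C * d := by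
  have h : ∀ (p : Fin n × Fin n × Fin n × Fin n), _ := fun p =>
    cd_lip (fun A : Matrix (Fin n) (Fin n) ℝ => cof2 A p.1 p.2.1 p.2.2.1 p.2.2.2)
      (contDiff_cof2 (fun i j => contDiff_entry i j) _ _ _ _) K hK
  choose C hC0 hC using h
  refine ⟨∑ p, C p, Finset.sum_nonneg fun p _ => hC0 p, fun A A' hA hA' i j s r => ?_⟩
  have hle : C (i, j, s, r) ≤ ∑ p, C p :=
    Finset.single_le_sum (fun p _ => hC0 p) (Finset.mem_univ _)
  obtain ⟨h1, h2⟩ := hC (i, j, s, r) A A' hA hA'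
  exact ⟨h1.trans hle, fun d hd h => (h2 d hd h).trans (by gcongr)⟩

lemma adj_lip (n : ℕ) (K : ℝ) (hK : 0 ≤ K) : ∃ C, 0 ≤ C ∧ ∀ A A' : Matrix (Fin n) (Fin n) ℝ,
    (∀ i j, |A i j| ≤ K) → (∀ i j, |A' i j| ≤ K) → ∀ i j, |A.adjugate i j| ≤ C ∧
      ∀ d, 0 ≤ d → (∀ i j, |A i j - A' i j| ≤ d) → |A.adjugate i j - A'.adjugate i j| ≤ C * d := by
  have h : ∀ (p : Fin n × Fin n), _ := fun p =>
    cd_lip (fun A : Matrix (Fin n) (Fin n) ℝ => A.adjugate p.1 p.2)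
      (contDiff_adj (fun i j => contDiff_entry i j) _ _) K hK
  choose C hC0 hC using h
  refine ⟨∑ p, C p, Finset.sum_nonneg fun p _ => hC0 p, fun A A' hA hA' i j => ?_⟩
  have hle : C (i, j) ≤ ∑ p, C p :=
    Finset.single_le_sum (fun p _ => hC0 p) (Finset.mem_univ _)
  obtain ⟨h1, h2⟩ := hC (i, j) A A' hA hA'
  exact ⟨h1.trans hle, fun d hd h => (h2 d hd h).trans (by gcongr)⟩

lemma det_lip (n : ℕ) (K : ℝ) (hK : 0 ≤ K) : ∃ C, 0 ≤ C ∧ ∀ A A' : Matrix (Fin n) (Fin n) ℝ,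
    (∀ i j, |A i j| ≤ K) → (∀ i j, |A' i j| ≤ K) → |A.det| ≤ C ∧
      ∀ d, 0 ≤ d → (∀ i j, |A i j - A' i j| ≤ d) → |A.det - A'.det| ≤ C * d :=
  cd_lip (fun A : Matrix (Fin n) (Fin n) ℝ => A.det)
      (contDiff_det' (fun i j => contDiff_entry i j)) K hK
end

lemma q2_lip (n : ℕ) (K : ℝ) (hK : 0 ≤ K) : ∃ C, 0 ≤ C ∧ ∀ A A' X : Matrix (Fin n) (Fin n) ℝ,
    (∀ i j, |A i j| ≤ K) → (∀ i j, |A' i j| ≤ K) → ∀ d, 0 ≤ d → (∀ i j, |A i j - A' i j| ≤ d) →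
      |q2 A X - q2 A' X| ≤ C * d * fsq X := by
  obtain ⟨C, hC0, hC⟩ := cof2_lip n K hK
  refine ⟨n^4 * C, by positivity, fun A A' X hA hA' d hd h => ?_⟩
  have hX := abs_entry_le_sqrt_fsq X
  have e : q2 A X - q2 A' X =
      ∑ j, ∑ i, (∑ r, ∑ s, (cof2 A i j s r - cof2 A' i j s r) * X r s) * X j i := by
    unfold q2
    simp only [sub_mul, Finset.sum_sub_distrib]
  have hs : Real.sqrt (fsq X) * Real.sqrt (fsq X) = fsq X := Real.mul_self_sqrt (fsq_nonneg X)
  set f := Real.sqrt (fsq X) with hf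
  have hf0 : 0 ≤ f := Real.sqrt_nonneg _
  have h1 : ∀ i j, |∑ r, ∑ s, (cof2 A i j s r - cof2 A' i j s r) * X r s| ≤ n^2 * (C * d * f) := by
    intro i j
    calc _ ≤ ∑ r : Fin n, ∑ s : Fin n, C * d * f := by
          refine (Finset.abs_sum_le_sum_abs _ _).trans (Finset.sum_le_sum fun r _ => ?_)
          refine (Finset.abs_sum_le_sum_abs _ _).trans (Finset.sum_le_sum fun s _ => ?_)
          rw [abs_mul]
          exact mul_le_mul ((hC A A' hA hA' i j s r).2 d hd h) (hX r s) (abs_nonneg _) (by positivity)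
      _ = _ := by simp; ring
  rw [e]
  calc _ ≤ ∑ j : Fin n, ∑ i : Fin n, (n^2 * (C * d * f)) * f := by
        refine (Finset.abs_sum_le_sum_abs _ _).trans (Finset.sum_le_sum fun r _ => ?_)
        refine (Finset.abs_sum_le_sum_abs _ _).trans (Finset.sum_le_sum fun s _ => ?_)
        rw [abs_mul]
        exact mul_le_mul (h1 _ _) (hX _ _) (abs_nonneg _) (by positivity)
    _ = _ := by
        rw [← hs]; simp; ring

lemma trace_adj_mul {n : ℕ} (A X : Matrix (Fin n) (Fin n) ℝ) :
    (A.adjugate * X).trace = ∑ r, ∑ s, A.adjugate s r * X r s := by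
  simp only [Matrix.trace, Matrix.diag_apply, Matrix.mul_apply]
  rw [Finset.sum_comm]

/-- quadratic Taylor remainder bound on `[0,1]` -/
lemma taylor_bound {f f' f'' : ℝ → ℝ} {C : ℝ} (h1 : ∀ t, HasDerivAt f (f' t) t)
    (h2 : ∀ t, HasDerivAt f' (f'' t) t) (hC : ∀ t ∈ Set.Icc (0:ℝ) 1, |f'' t| ≤ C) :
    |f 1 - f 0 - f' 0| ≤ C := by
  have hC0 : 0 ≤ C := (abs_nonneg _).trans (hC 0 (by simp))
  have h3 : ∀ t ∈ Set.Icc (0:ℝ) 1, |f' t - f' 0| ≤ C := by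
    intro t ht
    have := (convex_Icc (0:ℝ) 1).norm_image_sub_le_of_norm_hasDerivWithin_le
      (f := f') (f' := f'') (C := C) (fun x _ => (h2 x).hasDerivWithinAt) (fun x hx => hC x hx)
      (x := 0) (y := t) (by simp) ht
    rw [Real.norm_eq_abs, Real.norm_eq_abs, sub_zero, abs_of_nonneg ht.1] at this
    nlinarith [ht.2]
  have := (convex_Icc (0:ℝ) 1).norm_image_sub_le_of_norm_hasDerivWithin_le
      (f := fun t => f t - t * f' 0) (f' := fun t => f' t - f' 0) (C := C)
      (fun x _ => by
        have := (h1 x).sub ((hasDerivAt_id x).mul_const (f' 0))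
        simp only [one_mul] at this
        exact this.hasDerivWithinAt) (fun x hx => h3 x hx)
      (x := 0) (y := 1) (by simp) (by simp)
  simp only [Real.norm_eq_abs, one_mul, zero_mul, sub_zero, abs_one, mul_one] at this
  rwa [sub_right_comm] at this

lemma taylor_diff (n : ℕ) (K : ℝ) (hK : 0 ≤ K) : ∃ C, 0 ≤ C ∧ ∀ A D P : Matrix (Fin n) (Fin n) ℝ,
    ∀ c, 0 ≤ c → (∀ i j, |A i j| ≤ K) → (∀ i j, |(A + D) i j| ≤ K) →
    (∀ i j, |P i j| ≤ K) → (∀ i j, |(P + D) i j| ≤ K) → (∀ i j, |P i j - A i j| ≤ c) →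
    |((P + D).det - P.det - (P.adjugate * D).trace) - ((A + D).det - A.det - (A.adjugate * D).trace)|
      ≤ C * c * fsq D := by
  obtain ⟨C, hC0, hC⟩ := q2_lip n K hK
  refine ⟨C, hC0, fun A D P c hc hA hAD hP hPD hPA => ?_⟩
  have hseg : ∀ A : Matrix (Fin n) (Fin n) ℝ, (∀ i j, |A i j| ≤ K) → (∀ i j, |(A + D) i j| ≤ K) →
      ∀ t ∈ Set.Icc (0:ℝ) 1, ∀ i j, |(A + t • D) i j| ≤ K := by
    intro A hA hAD t ht i j
    have e : (A + t • D) i j = (1 - t) * A i j + t * (A + D) i j := by simp; ring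
    rw [e]
    have a1 := abs_le.1 (hA i j)
    have a2 := abs_le.1 (hAD i j)
    rw [abs_le]
    constructor <;> nlinarith [ht.1, ht.2]
  have := taylor_bound (f := fun t => (P + t • D).det - (A + t • D).det)
    (C := C * c * fsq D)
    (fun t => (det_line_hasDerivAt P D t).sub (det_line_hasDerivAt A D t))
    (fun t => (det_line_hasDerivAt2 P D t).sub (det_line_hasDerivAt2 A D t))
    (fun t ht => hC _ _ D (hseg P hP hPD t ht) (hseg A hA hAD t ht) c hc
      (fun i j => by simpa using hPA i j))
  simp only [one_smul, zero_smul, add_zero] at this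
  rw [trace_adj_mul, trace_adj_mul]
  convert this using 2
  ring

lemma key_id {n : ℕ} {P P1 D : Matrix (Fin n) (Fin n) ℝ} (hP : IsUnit P.det) (hP1 : IsUnit P1.det)
    (hD : P = P1 + D) : P1 * (P⁻¹ - P1⁻¹) * P1 = D * P⁻¹ * D - D := by
  have e : P1 = P - D := by rw [hD]; abel
  have h1 : P1 * P1⁻¹ = 1 := Matrix.mul_nonsing_inv _ hP1
  have h2 : P * P⁻¹ = 1 := Matrix.mul_nonsing_inv _ hP
  have h3 : P⁻¹ * P = 1 := Matrix.nonsing_inv_mul _ hP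
  rw [Matrix.mul_sub, h1, Matrix.sub_mul, Matrix.one_mul]
  rw [e, Matrix.sub_mul, h2, Matrix.sub_mul, Matrix.mul_sub, Matrix.one_mul, Matrix.mul_assoc D,
    Matrix.mul_sub P⁻¹, h3, Matrix.mul_sub, Matrix.mul_one, Matrix.one_mul, ← Matrix.mul_assoc]
  abel

lemma det_key {n : ℕ} {P P1 D : Matrix (Fin n) (Fin n) ℝ} (hP : P.PosDef) (hP1 : P1.PosDef)
    (hD : P = P1 + D) :
    0 ≤ P.det - P1.det - (P1.adjugate * D).trace + (P1.adjugate * (D * P⁻¹ * D)).trace := by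
  have hPu := (Matrix.isUnit_iff_isUnit_det _).1 hP.isUnit
  have hPu1 := (Matrix.isUnit_iff_isUnit_det _).1 hP1.isUnit
  have h1 := key_id hPu hPu1 hD
  have h2 : D * P⁻¹ * D = P1 * (P⁻¹ - P1⁻¹) * P1 + D := by rw [h1]; abel
  have h3 : (P1.adjugate * (P1 * (P⁻¹ - P1⁻¹) * P1)).trace
      = P1.det * ((P1 * P⁻¹).trace - n) := by
    rw [Matrix.mul_assoc, ← Matrix.mul_assoc, Matrix.adjugate_mul, Matrix.smul_mul, Matrix.one_mul,
      Matrix.trace_smul, Matrix.trace_mul_comm, Matrix.mul_sub, Matrix.trace_sub,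
      Matrix.mul_nonsing_inv _ hPu1, Matrix.trace_one]
    simp
  rw [h2, Matrix.mul_add, Matrix.trace_add, h3]
  have := det_ineq hP hP1
  linarith

lemma DBD_psd {n : ℕ} {P D : Matrix (Fin n) (Fin n) ℝ} (hP : P.PosDef) (hD : Dᵀ = D) :
    (D * P⁻¹ * D).PosSemidef := by
  have := hP.inv.posSemidef.conjTranspose_mul_mul_same D
  rwa [Matrix.conjTranspose_eq_transpose_of_trivial, hD] at this

/-- The main algebraic inequality. -/
lemma key_ineq (n : ℕ) (lam M' K : ℝ) (hlam : 0 < lam) (hM' : 0 < M') (hK : 0 ≤ K) :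
    ∃ c c0 : ℝ, 0 < c ∧ c ≤ 1 ∧ 0 < c0 ∧ ∀ (a A A1 : Matrix (Fin n) (Fin n) ℝ) (b : ℝ),
      (A + c • (1 : Matrix (Fin n) (Fin n) ℝ)).PosDef →
      (A1 + c • (1 : Matrix (Fin n) (Fin n) ℝ)).PosDef →
      (∀ i j, |A i j| ≤ K) → (∀ i j, |A1 i j| ≤ K) →
      (∀ v : Fin n → ℝ, lam * (v ⬝ᵥ v) ≤ v ⬝ᵥ (a *ᵥ v)) → 0 ≤ b → b ≤ M' →
      c0 * fsq (A - A1) ≤ b * (A.det - A1.det - (A1.adjugate * (A - A1)).trace)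
        + ((a + b • A1.adjugate) * ((A - A1) * (A + c • (1 : Matrix (Fin n) (Fin n) ℝ))⁻¹ * (A - A1))).trace := by
  obtain ⟨C1, hC10, hC1⟩ := taylor_diff n (K + 1) (by linarith)
  obtain ⟨C2, hC20, hC2⟩ := adj_lip n (K + 1) (by linarith)
  set Q : ℝ := n * (K + 1) + 1 with hQ
  have hQ0 : 0 < Q := by positivity
  set G : ℝ := M' * (C1 * Q + n^2 * C2) with hG
  have hG0 : 0 ≤ G := by positivity
  refine ⟨min 1 (lam / (2 * (G + 1))), lam / (2 * Q), lt_min one_pos (by positivity),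
    min_le_left _ _, by positivity, ?_⟩
  set c := min 1 (lam / (2 * (G + 1))) with hc
  have hc0 : 0 < c := lt_min one_pos (by positivity)
  have hc1 : c ≤ 1 := min_le_left _ _
  have hcG : c * G ≤ lam / 2 := by
    have : c ≤ lam / (2 * (G + 1)) := min_le_right _ _
    rw [le_div_iff₀ (by positivity)] at this
    nlinarith
  intro a A A1 b hP hP1 hA hA1 ha hb0 hb
  set P := A + c • (1 : Matrix (Fin n) (Fin n) ℝ) with hPdef
  set P1 := A1 + c • (1 : Matrix (Fin n) (Fin n) ℝ) with hP1def
  have hone : ∀ i j, |(c • (1 : Matrix (Fin n) (Fin n) ℝ)) i j| ≤ c := by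
    intro i j
    by_cases h : i = j <;> simp [h, abs_of_pos hc0, hc0.le]
  have hPK : ∀ A : Matrix (Fin n) (Fin n) ℝ, (∀ i j, |A i j| ≤ K) →
      ∀ i j, |(A + c • (1 : Matrix (Fin n) (Fin n) ℝ)) i j| ≤ K + 1 := by
    intro A hA i j
    rw [Matrix.add_apply]
    exact (abs_add_le _ _).trans (add_le_add (hA i j) ((hone i j).trans hc1))
  have hK1 : ∀ A : Matrix (Fin n) (Fin n) ℝ, (∀ i j, |A i j| ≤ K) → ∀ i j, |A i j| ≤ K + 1 :=
    fun A h i j => (h i j).trans (by linarith)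
  set D := A - A1 with hDdef
  have hPD : P = P1 + D := by rw [hPdef, hP1def, hDdef]; abel
  have hAD : A1 + D = A := by rw [hDdef]; abel
  have hDs : Dᵀ = D := by
    have e : D = P - P1 := by rw [hPD]; abel
    rw [e, Matrix.transpose_sub, pd_symm hP, pd_symm hP1]
  have hX := DBD_psd hP hDs
  set X := D * P⁻¹ * D with hXdef
  have hdiff1 : ∀ i j, |P1 i j - A1 i j| ≤ c := by
    intro i j; have := hone i j; rw [hP1def, Matrix.add_apply]; simpa using this
  have e1 := hC1 A1 D P1 c hc0.le (hK1 _ hA1) (by rw [hAD]; exact hK1 _ hA) (hPK _ hA1)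
    (by rw [← hPD]; exact hPK _ hA) hdiff1
  rw [hAD, ← hPD] at e1
  have e2 := abs_trace_mul_le (P1.adjugate - A1.adjugate) (m := C2 * c) (fun i j => by
    simpa using (hC2 P1 A1 (hPK _ hA1) (hK1 _ hA1) i j).2 c hc0.le hdiff1) hX
  have e3 := det_key hP hP1 hPD
  have e4 := fsq_le_trace hP hDs
  rw [← hXdef] at e3 e4
  have hT0 : 0 ≤ X.trace := hX.trace_nonneg
  have htr : P.trace ≤ Q := by
    have : P.trace ≤ ∑ i : Fin n, (K + 1) :=
      Finset.sum_le_sum fun i _ => (le_abs_self _).trans (hPK _ hA i i)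
    simp at this; linarith
  have e5 : fsq D ≤ Q * X.trace := e4.trans (by gcongr)
  have e6 := trace_mul_ge ha hX
  rw [Matrix.sub_mul, Matrix.trace_sub] at e2
  rw [Matrix.add_mul, Matrix.trace_add, Matrix.smul_mul, Matrix.trace_smul, smul_eq_mul]
  have e7 := (abs_le.1 e1).2
  have e8 := (abs_le.1 e2).2
  have hCc : 0 ≤ C1 * c := by positivity
  have e9 : C1 * c * fsq D ≤ C1 * c * (Q * X.trace) := by gcongr
  have e10 : -(c * (C1 * Q + n^2 * C2) * X.trace) ≤
      (A.det - A1.det - (A1.adjugate * D).trace) + (A1.adjugate * X).trace := by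
    nlinarith
  have e11 : b * -(c * (C1 * Q + n^2 * C2) * X.trace) ≤
      b * ((A.det - A1.det - (A1.adjugate * D).trace) + (A1.adjugate * X).trace) :=
    mul_le_mul_of_nonneg_left e10 hb0
  have e12 : b * (c * (C1 * Q + n^2 * C2) * X.trace) ≤ M' * (c * (C1 * Q + n^2 * C2) * X.trace) :=
    mul_le_mul_of_nonneg_right hb (by positivity)
  have e13 : M' * (c * (C1 * Q + n^2 * C2) * X.trace) ≤ lam / 2 * X.trace := by
    have : M' * (c * (C1 * Q + n^2 * C2) * X.trace) = (c * G) * X.trace := by rw [hG]; ring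
    rw [this]; gcongr
  have e14 : lam / (2 * Q) * fsq D ≤ lam / 2 * X.trace := by
    calc lam / (2 * Q) * fsq D ≤ lam / (2 * Q) * (Q * X.trace) := by gcongr
      _ = _ := by field_simp
  nlinarith
end PartA3

section PartA4
open Matrix Filter Topology

/-! ### Part 4: the infinitesimal inequality -/

lemma q2_smul {n : ℕ} (A X : Matrix (Fin n) (Fin n) ℝ) (t : ℝ) :
    q2 A (t • X) = t ^ 2 * q2 A X := by
  unfold q2
  simp only [Matrix.smul_apply, smul_eq_mul, Finset.mul_sum, Finset.sum_mul]
  refine Finset.sum_congr rfl fun j _ => Finset.sum_congr rfl fun i _ =>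
    Finset.sum_congr rfl fun r _ => Finset.sum_congr rfl fun s _ => ?_
  ring

lemma fsq_smul {n : ℕ} (X : Matrix (Fin n) (Fin n) ℝ) (t : ℝ) :
    fsq (t • X) = t ^ 2 * fsq X := by
  unfold fsq
  simp only [Matrix.smul_apply, smul_eq_mul, Finset.mul_sum]
  refine Finset.sum_congr rfl fun j _ => Finset.sum_congr rfl fun i _ => ?_
  ring

lemma quad_abs_le {n : ℕ} (X : Matrix (Fin n) (Fin n) ℝ) {m : ℝ} (hX : ∀ i j, |X i j| ≤ m)
    (v : Fin n → ℝ) : |v ⬝ᵥ (X *ᵥ v)| ≤ n * m * (v ⬝ᵥ v) := by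
  have e : v ⬝ᵥ (X *ᵥ v) = ∑ i, ∑ j, v i * (X i j * v j) := by
    simp [dotProduct, Matrix.mulVec, Finset.mul_sum]
  have e2 : n * m * (v ⬝ᵥ v) = ∑ i : Fin n, ∑ j : Fin n, m * ((v i)^2 + (v j)^2) / 2 := by
    have : ∀ i j : Fin n, m * ((v i)^2 + (v j)^2) / 2 = m/2 * (v i)^2 + m/2 * (v j)^2 := by
      intros; ring
    simp only [this, Finset.sum_add_distrib, Finset.sum_const, Finset.card_univ, Fintype.card_fin,
      nsmul_eq_mul, ← Finset.mul_sum, dotProduct, ← sq]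
    ring
  rw [e, e2]
  refine (Finset.abs_sum_le_sum_abs _ _).trans (Finset.sum_le_sum fun i _ => ?_)
  refine (Finset.abs_sum_le_sum_abs _ _).trans (Finset.sum_le_sum fun j _ => ?_)
  rw [abs_mul, abs_mul]
  have h0 := abs_nonneg (v i); have h1 := abs_nonneg (v j); have h2 := abs_nonneg (X i j)
  have h3 : |v i| * |v j| ≤ ((v i)^2 + (v j)^2)/2 := by
    rw [← sq_abs (v i), ← sq_abs (v j)]; nlinarith [sq_nonneg (|v i| - |v j|)]
  calc |v i| * (|X i j| * |v j|) = |X i j| * (|v i| * |v j|) := by ring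
    _ ≤ m * (((v i)^2 + (v j)^2)/2) := mul_le_mul (hX i j) h3 (by positivity) (h2.trans (hX i j))
    _ = _ := by ring

lemma dot_self_nonneg {n : ℕ} (v : Fin n → ℝ) : 0 ≤ v ⬝ᵥ v :=
  Finset.sum_nonneg fun _ _ => mul_self_nonneg _

lemma posDef_of_quad {n : ℕ} {A : Matrix (Fin n) (Fin n) ℝ} (hs : Aᵀ = A) {c : ℝ} (hc : 0 < c)
    (h : ∀ v : Fin n → ℝ, c * (v ⬝ᵥ v) ≤ v ⬝ᵥ (A *ᵥ v)) : A.PosDef := by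
  refine Matrix.PosDef.of_dotProduct_mulVec_pos ?_ ?_
  · rw [Matrix.IsHermitian, Matrix.conjTranspose_eq_transpose_of_trivial, hs]
  · intro v hv
    have h1 : 0 < v ⬝ᵥ v := by
      rcases (lt_or_eq_of_le (dot_self_nonneg v)) with h | h
      · exact h
      · exact absurd (dotProduct_self_eq_zero.1 h.symm) hv
    simp only [star_trivial]
    nlinarith [h v]

lemma pd_add_smul_one {n : ℕ} {A : Matrix (Fin n) (Fin n) ℝ} (hA : A.PosSemidef) {c : ℝ} (hc : 0 < c) :
    (A + c • (1 : Matrix (Fin n) (Fin n) ℝ)).PosDef := by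
  refine posDef_of_quad (c := c) ?_ hc ?_
  · rw [Matrix.transpose_add, psd_symm hA, Matrix.transpose_smul, Matrix.transpose_one]
  · intro v
    rw [Matrix.add_mulVec, dotProduct_add, Matrix.smul_mulVec, Matrix.one_mulVec, dotProduct_smul,
      smul_eq_mul]
    linarith [psd_quad hA v]

lemma inv_entry {n : ℕ} (P : Matrix (Fin n) (Fin n) ℝ) (i j : Fin n) :
    P⁻¹ i j = (P.det)⁻¹ * P.adjugate i j := by
  rw [Matrix.inv_def, Ring.inverse_eq_inv', Matrix.smul_apply, smul_eq_mul]

lemma key_inf (n : ℕ) (lam M' K : ℝ) (c c0 : ℝ) (hc : 0 < c) (hK : 0 ≤ K)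
    (hkey : ∀ (a A A1 : Matrix (Fin n) (Fin n) ℝ) (b : ℝ),
      (A + c • (1 : Matrix (Fin n) (Fin n) ℝ)).PosDef →
      (A1 + c • (1 : Matrix (Fin n) (Fin n) ℝ)).PosDef →
      (∀ i j, |A i j| ≤ K + 1) → (∀ i j, |A1 i j| ≤ K + 1) →
      (∀ v : Fin n → ℝ, lam * (v ⬝ᵥ v) ≤ v ⬝ᵥ (a *ᵥ v)) → 0 ≤ b → b ≤ M' →
      c0 * fsq (A - A1) ≤ b * (A.det - A1.det - (A1.adjugate * (A - A1)).trace)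
        + ((a + b • A1.adjugate) * ((A - A1) * (A + c • (1 : Matrix (Fin n) (Fin n) ℝ))⁻¹ * (A - A1))).trace)
    (a A X : Matrix (Fin n) (Fin n) ℝ) (b : ℝ) (hA : A.PosSemidef) (hX : Xᵀ = X)
    (hAK : ∀ i j, |A i j| ≤ K) (ha : ∀ v : Fin n → ℝ, lam * (v ⬝ᵥ v) ≤ v ⬝ᵥ (a *ᵥ v))
    (hb0 : 0 ≤ b) (hb : b ≤ M') :
    c0 * fsq X ≤ b / 2 * q2 A X
      + ((a + b • A.adjugate) * (X * (A + c • (1 : Matrix (Fin n) (Fin n) ℝ))⁻¹ * X)).trace := by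
  set m : ℝ := ∑ i, ∑ j, |X i j| with hm
  have hXm : ∀ i j, |X i j| ≤ m := fun i j =>
    (Finset.single_le_sum (f := fun j => |X i j|) (fun _ _ => abs_nonneg _) (Finset.mem_univ j)).trans
    (Finset.single_le_sum (f := fun i => ∑ j, |X i j|)
      (fun _ _ => Finset.sum_nonneg fun _ _ => abs_nonneg _) (Finset.mem_univ i))
  have hm0 : 0 ≤ m := Finset.sum_nonneg fun _ _ => Finset.sum_nonneg fun _ _ => abs_nonneg _
  obtain ⟨C, hC0, hC⟩ := q2_lip n (K + 1) (by linarith)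
  -- inequality for small t
  have hlim : Tendsto (fun t : ℝ => b / 2 * q2 A X + b * (C * (t * m) * fsq X)
      + ((a + b • A.adjugate) * (X * ((A + t • X) + c • (1 : Matrix (Fin n) (Fin n) ℝ))⁻¹ * X)).trace)
      (𝓝[>] 0) (𝓝 (b / 2 * q2 A X + b * (C * (0 * m) * fsq X)
      + ((a + b • A.adjugate) * (X * ((A + (0:ℝ) • X) + c • (1 : Matrix (Fin n) (Fin n) ℝ))⁻¹ * X)).trace)) := by
    refine Tendsto.mono_left ?_ nhdsWithin_le_nhds
    change ContinuousAt _ (0:ℝ)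
    have hdet : ContinuousAt (fun t : ℝ => ((A + t • X) + c • (1 : Matrix (Fin n) (Fin n) ℝ))⁻¹) 0 := by
      have h1 : Continuous (fun t : ℝ => (A + t • X) + c • (1 : Matrix (Fin n) (Fin n) ℝ)) := by
        fun_prop
      refine continuousAt_pi.2 fun i => continuousAt_pi.2 fun j => ?_
      simp_rw [inv_entry]
      refine ContinuousAt.mul ?_ ?_
      · refine ContinuousAt.inv₀ (h1.matrix_det).continuousAt ?_
        rw [zero_smul, add_zero]
        exact (pd_add_smul_one hA hc).det_pos.ne'
      · exact ((h1.matrix_adjugate).matrix_elem i j).continuousAt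
    refine ContinuousAt.add ?_ ?_
    · fun_prop
    · have hcont : Continuous (fun Y : Matrix (Fin n) (Fin n) ℝ =>
          ((a + b • A.adjugate) * (X * Y * X)).trace) := by fun_prop
      exact hcont.continuousAt.comp hdet
  simp only [zero_smul, add_zero, zero_mul, mul_zero] at hlim
  refine ge_of_tendsto hlim ?_
  have hδ : 0 < min (c / (2 * (n * m + 1))) (1 / (m + 1)) := by positivity
  filter_upwards [Ioo_mem_nhdsGT hδ] with t ht
  have ht0 : 0 < t := ht.1
  have ht1 : t * (n * m) ≤ c / 2 := by
    have := ht.2.le.trans (min_le_left _ _)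
    rw [le_div_iff₀ (by positivity)] at this
    nlinarith
  have ht2 : t * m ≤ 1 := by
    have := ht.2.le.trans (min_le_right _ _)
    rw [le_div_iff₀ (by positivity)] at this
    nlinarith
  have hPd : ((A + t • X) + c • (1 : Matrix (Fin n) (Fin n) ℝ)).PosDef := by
    refine posDef_of_quad (c := c / 2) ?_ (by positivity) ?_
    · rw [Matrix.transpose_add, Matrix.transpose_add, psd_symm hA, Matrix.transpose_smul,
        Matrix.transpose_smul, Matrix.transpose_one, hX]
    · intro v
      rw [Matrix.add_mulVec, Matrix.add_mulVec, dotProduct_add, dotProduct_add, Matrix.smul_mulVec,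
        Matrix.smul_mulVec, Matrix.one_mulVec, dotProduct_smul, dotProduct_smul,
        smul_eq_mul, smul_eq_mul]
      have h1 := psd_quad hA v
      have h2 := (abs_le.1 (quad_abs_le X hXm v)).1
      have h3 := dot_self_nonneg v
      have h4 : t * (v ⬝ᵥ (X *ᵥ v)) ≥ - (c/2 * (v ⬝ᵥ v)) := by
        have := mul_le_mul_of_nonneg_left h2 ht0.le
        nlinarith
      nlinarith
  have hAt : ∀ s ∈ Set.Icc (0:ℝ) 1, ∀ i j, |(A + s • (t • X)) i j| ≤ K + 1 := by
    intro s hs i j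
    simp only [Matrix.add_apply, Matrix.smul_apply, smul_eq_mul]
    refine (abs_add_le _ _).trans (add_le_add (hAK i j) ?_)
    rw [abs_mul, abs_mul, abs_of_nonneg hs.1, abs_of_pos ht0]
    have : t * |X i j| ≤ t * m := by gcongr; exact hXm i j
    have h0 : 0 ≤ t * |X i j| := by positivity
    nlinarith [hs.2]
  have h1 := hkey a (A + t • X) A b hPd (pd_add_smul_one hA hc)
    (by simpa using hAt 1 (by simp)) (fun i j => (hAK i j).trans (by linarith)) ha hb0 hb
  have e1 : A + t • X - A = t • X := by abel
  rw [e1, fsq_smul] at h1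
  -- Taylor
  have hder2 : ∀ s : ℝ, HasDerivAt (fun s : ℝ => s^2/2 * q2 A (t • X)) (s * q2 A (t • X)) s := by
    intro s
    have := ((hasDerivAt_pow 2 s).div_const 2).mul_const (q2 A (t • X))
    exact this.congr_deriv (by norm_num)
  have hder3 : ∀ s : ℝ, HasDerivAt (fun s : ℝ => s * q2 A (t • X)) (q2 A (t • X)) s := by
    intro s
    simpa using (hasDerivAt_id s).mul_const (q2 A (t • X))
  have h2 := taylor_bound (C := C * (t * m) * fsq (t • X))
    (fun s => (det_line_hasDerivAt A (t • X) s).sub (hder2 s))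
    (fun s => (det_line_hasDerivAt2 A (t • X) s).sub (hder3 s))
    (fun s hs => hC _ _ (t • X) (hAt s hs) (fun i j => (hAK i j).trans (by linarith)) (t * m)
      (by positivity) (fun i j => by
        simp only [Matrix.add_apply, Matrix.smul_apply, smul_eq_mul, add_sub_cancel_left]
        rw [abs_mul, abs_mul, abs_of_nonneg hs.1, abs_of_pos ht0]
        have : t * |X i j| ≤ t * m := by gcongr; exact hXm i j
        have h0 : 0 ≤ t * |X i j| := by positivity
        nlinarith [hs.2]))
  simp only [Pi.sub_apply, one_smul, zero_smul, add_zero] at h2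
  rw [← trace_adj_mul, q2_smul, fsq_smul] at h2
  have h3 := (abs_le.1 h2).2
  have h4 : (A + t • X).det - A.det - (A.adjugate * t • X).trace ≤
      t^2 * (q2 A X / 2 + C * (t * m) * fsq X) := by nlinarith
  have h5 := mul_le_mul_of_nonneg_left h4 hb0
  have e2 : (t • X) * ((A + t • X) + c • (1 : Matrix (Fin n) (Fin n) ℝ))⁻¹ * (t • X)
      = t^2 • (X * ((A + t • X) + c • (1 : Matrix (Fin n) (Fin n) ℝ))⁻¹ * X) := by
    rw [Matrix.smul_mul, Matrix.smul_mul, Matrix.mul_smul, smul_smul, sq]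
  rw [e2, Matrix.mul_smul (a + b • A.adjugate), Matrix.trace_smul, smul_eq_mul] at h1
  have ht2' : 0 < t^2 := by positivity
  refine le_of_mul_le_mul_left ?_ ht2'
  nlinarith
end PartA4

section PartB1
open Filter Topology MeasureTheory

/-! ### Part 5: abstract De Giorgi theory, basics -/

/-- partial derivative -/
noncomputable def pd {n : ℕ} (i : Fin n) (f : EuclideanSpace ℝ (Fin n) → ℝ)
    (x : EuclideanSpace ℝ (Fin n)) : ℝ := fderiv ℝ f x (EuclideanSpace.single i 1)

/-- structure conditions for the De Giorgi argument -/
structure DG (n : ℕ) (x0 : EuclideanSpace ℝ (Fin n)) (r lam Lam κ : ℝ)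
    (w : EuclideanSpace ℝ (Fin n) → ℝ) (V : Fin n → EuclideanSpace ℝ (Fin n) → ℝ) : Prop where
  hw : ContDiffOn ℝ 1 w (Metric.ball x0 r)
  hV : ∀ k, ContDiffOn ℝ 1 (V k) (Metric.ball x0 r)
  s1 : ∀ x ∈ Metric.ball x0 r, lam * ∑ k, (pd k w x) ^ 2 ≤ (∑ k, V k x * pd k w x) + κ ^ 2
  s2 : ∀ x ∈ Metric.ball x0 r, ∑ k, (V k x) ^ 2 ≤ Lam * ((∑ k, (pd k w x) ^ 2) + κ ^ 2)
  s3 : ∀ x ∈ Metric.ball x0 r, - κ ≤ ∑ k, pd k (V k) x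

section
variable {n : ℕ}
local notation "E" => EuclideanSpace ℝ (Fin n)

lemma pd_eq_of_hasFDerivAt {f : E → ℝ} {f' : E →L[ℝ] ℝ} {x : E} (h : HasFDerivAt f f' x) (i : Fin n) :
    pd i f x = f' (EuclideanSpace.single i 1) := by rw [pd, h.fderiv]

lemma continuous_pd {f : E → ℝ} (hf : ContDiff ℝ 1 f) (i : Fin n) : Continuous (pd i f) :=
  (hf.continuous_fderiv one_ne_zero).clm_apply continuous_const

lemma continuousOn_pd {f : E → ℝ} {U : Set E} (hU : IsOpen U) (hf : ContDiffOn ℝ 1 f U) (i : Fin n) :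
    ContinuousOn (pd i f) U :=
  (hf.continuousOn_fderiv_of_isOpen hU le_rfl).clm_apply continuousOn_const

lemma integrable_mul_of_tsupport {f φ : E → ℝ} {U : Set E} (hU : IsOpen U) (hf : ContinuousOn f U)
    (hφ : Continuous φ) (hc : HasCompactSupport φ) (hs : tsupport φ ⊆ U) :
    Integrable (fun x => f x * φ x) := by
  refine Continuous.integrable_of_hasCompactSupport ?_ (hc.mul_left)
  refine continuous_of_tsupport fun x hx => ?_
  have hx' : x ∈ tsupport φ := (tsupport_mul_subset_right (f := f) (g := φ)) hx
  exact (hf.continuousAt (hU.mem_nhds (hs hx'))).mul hφ.continuousAt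

lemma tsupport_pd_subset (φ : E → ℝ) (k : Fin n) : tsupport (pd k φ) ⊆ tsupport φ := by
  refine closure_minimal ?_ (isClosed_tsupport _)
  intro x hx
  by_contra h
  apply hx
  have : fderiv ℝ φ x = 0 := by
    by_contra h2
    exact h (support_fderiv_subset ℝ h2)
  simp [pd, this]

lemma weak_form {x0 : E} {r lam Lam κ : ℝ} {w : E → ℝ} {V : Fin n → E → ℝ}
    (h : DG n x0 r lam Lam κ w V) {φ : E → ℝ} (hφ : ContDiff ℝ 1 φ) (hc : HasCompactSupport φ)
    (hs : tsupport φ ⊆ Metric.ball x0 r) (h0 : ∀ x, 0 ≤ φ x) :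
    ∫ x, ∑ k, V k x * pd k φ x ≤ κ * ∫ x, φ x := by
  have hU : IsOpen (Metric.ball x0 r) := Metric.isOpen_ball
  have i1 : ∀ k, Integrable (fun x => V k x * pd k φ x) := fun k =>
    integrable_mul_of_tsupport hU (h.hV k).continuousOn (continuous_pd hφ k)
      (hc.mono' ((subset_tsupport _).trans (tsupport_pd_subset φ k))) ((tsupport_pd_subset φ k).trans hs)
  have i2 : ∀ k, Integrable (fun x => pd k (V k) x * φ x) := fun k =>
    integrable_mul_of_tsupport hU (continuousOn_pd hU (h.hV k) k) hφ.continuous hc hs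
  have i3 : ∀ k, Integrable (fun x => V k x * φ x) := fun k =>
    integrable_mul_of_tsupport hU (h.hV k).continuousOn hφ.continuous hc hs
  have e : ∀ k, ∫ x, V k x * pd k φ x = - ∫ x, pd k (V k) x * φ x := fun k =>
    integral_mul_fderiv_eq_neg_fderiv_mul_of_integrable (i2 k) (i1 k) (i3 k)
      (fun x hx => ((h.hV k).differentiableOn one_ne_zero).differentiableAt (hU.mem_nhds (hs hx)))
      (fun x _ => hφ.differentiable one_ne_zero x)
  rw [integral_finsetSum _ (fun k _ => i1 k)]
  simp_rw [e]
  rw [Finset.sum_neg_distrib, ← integral_finsetSum _ (fun k _ => i2 k), ← integral_neg,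
    ← integral_const_mul]
  refine integral_mono (integrable_finsetSum _ (fun k _ => i2 k)).neg
    ((hφ.continuous.integrable_of_hasCompactSupport hc).const_mul _) fun x => ?_
  change - ∑ k, pd k (V k) x * φ x ≤ κ * φ x
  rw [← Finset.sum_mul]
  by_cases hx : x ∈ Metric.ball x0 r
  · nlinarith [h.s3 x hx, h0 x]
  · have : φ x = 0 := image_eq_zero_of_notMem_tsupport (fun h' => hx (hs h'))
    simp [this]

open Classical in
/-- extension by zero of a function on an open set -/
noncomputable def ext0 (U : Set E) (f : E → ℝ) (x : E) : ℝ := if x ∈ U then f x else 0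

lemma ext0_of_mem {U : Set E} {f : E → ℝ} {x : E} (hx : x ∈ U) : ext0 U f x = f x := if_pos hx
lemma ext0_of_notMem {U : Set E} {f : E → ℝ} {x : E} (hx : x ∉ U) : ext0 U f x = 0 := if_neg hx

lemma ext0_spec {U K : Set E} (hU : IsOpen U) (hK : IsCompact K) (hKU : K ⊆ U) {f : E → ℝ}
    (hf : ContDiffOn ℝ 1 f U) (h0 : ∀ x ∈ U, x ∉ K → f x = 0) :
    ContDiff ℝ 1 (ext0 U f) ∧ HasCompactSupport (ext0 U f) ∧ tsupport (ext0 U f) ⊆ K := by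
  have hz : ∀ x, x ∉ K → ext0 U f x = 0 := by
    intro x hx
    by_cases hxU : x ∈ U
    · rw [ext0_of_mem hxU]; exact h0 x hxU hx
    · exact ext0_of_notMem hxU
  have hts : tsupport (ext0 U f) ⊆ K := closure_minimal (fun x hx => by
    by_contra h; exact hx (hz x h)) hK.isClosed
  refine ⟨?_, HasCompactSupport.intro hK hz, hts⟩
  refine contDiff_iff_contDiffAt.2 fun x => ?_
  by_cases hx : x ∈ tsupport (ext0 U f)
  swap
  · exact (contDiffAt_const (c := (0:ℝ))).congr_of_eventuallyEq
      (notMem_tsupport_iff_eventuallyEq.1 hx)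
  have hxU := hU.mem_nhds (hKU (hts hx))
  refine (hf.contDiffAt hxU).congr_of_eventuallyEq ?_
  filter_upwards [hxU] with y hy using ext0_of_mem hy

lemma pd_ext0 {U : Set E} (hU : IsOpen U) {f : E → ℝ} {x : E} (hx : x ∈ U) (k : Fin n) :
    pd k (ext0 U f) x = pd k f x := by
  have : ext0 U f =ᶠ[𝓝 x] f := by
    filter_upwards [hU.mem_nhds hx] with y hy using ext0_of_mem hy
  rw [pd, pd, this.fderiv_eq]

end

/-! positive part powers -/

lemma hasDerivAt_pp (m : ℕ) (t : ℝ) :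
    HasDerivAt (fun t : ℝ => (max t 0) ^ (m + 2)) ((m + 2) * (max t 0) ^ (m + 1)) t := by
  rcases lt_trichotomy t 0 with h | h | h
  · have h1 : HasDerivAt (fun _ : ℝ => (0:ℝ)) 0 t := hasDerivAt_const _ _
    have e : (fun t : ℝ => (max t 0) ^ (m + 2)) =ᶠ[𝓝 t] fun _ => 0 := by
      filter_upwards [gt_mem_nhds h] with y hy
      rw [max_eq_right hy.le]; simp
    rw [max_eq_right h.le]
    simpa using h1.congr_of_eventuallyEq e
  · subst h
    simp only [max_self, ne_eq, Nat.add_eq_zero_iff, one_ne_zero, and_false, not_false_eq_true,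
      zero_pow, mul_zero]
    rw [hasDerivAt_iff_isLittleO]
    simp only [max_self, ne_eq, Nat.add_eq_zero_iff, OfNat.ofNat_ne_zero, and_false,
      not_false_eq_true, zero_pow, sub_zero, smul_zero]
    have h1 : (fun t : ℝ => (max t 0) ^ (m + 2)) =O[𝓝 0] fun t : ℝ => t ^ (m + 2) := by
      refine Asymptotics.IsBigO.of_bound 1 (Eventually.of_forall fun t => ?_)
      rw [one_mul, norm_pow, norm_pow]
      gcongr
      rw [Real.norm_eq_abs, Real.norm_eq_abs, abs_of_nonneg (le_max_right _ _)]
      exact max_le (le_abs_self _) (abs_nonneg _)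
    refine h1.trans_isLittleO ?_
    have := Asymptotics.isLittleO_pow_pow (𝕜 := ℝ) (show 1 < m + 2 by omega)
    simpa using this
  · have h1 := hasDerivAt_pow (m + 2) t
    have e : (fun t : ℝ => (max t 0) ^ (m + 2)) =ᶠ[𝓝 t] fun t => t ^ (m + 2) := by
      filter_upwards [lt_mem_nhds h] with y hy
      rw [max_eq_left hy.le]
    rw [max_eq_left h.le]
    have := h1.congr_of_eventuallyEq e
    simpa using this

lemma contDiff_pp (m : ℕ) : ContDiff ℝ 1 (fun t : ℝ => (max t 0) ^ (m + 2)) := by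
  rw [contDiff_one_iff_deriv]
  refine ⟨fun t => (hasDerivAt_pp m t).differentiableAt, ?_⟩
  have : deriv (fun t : ℝ => (max t 0) ^ (m + 2)) = fun t : ℝ => ((m : ℝ) + 2) * (max t 0) ^ (m + 1) :=
    funext fun t => (hasDerivAt_pp m t).deriv
  rw [this]; fun_prop
end PartB1

section PartB2
open Filter Topology MeasureTheory

/-! ### Part 6: first De Giorgi lemma -/

lemma iter_lemma (C q : ℝ) (hC : 0 < C) (hq : 1 < q) : ∃ θ : ℝ, 0 < θ ∧ ∀ m : ℝ → ℝ,
    (∀ l, 0 ≤ m l) → Antitone m →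
    (∀ l l', 0 ≤ l → l < l' → l' ≤ 1/2 → m l' ≤ (C / (l' - l) ^ 3 * m l) ^ q) →
    m 0 ≤ θ → m (1/2) = 0 := by
  have hq1 : 0 < q - 1 := by linarith
  set σ : ℝ := (8:ℝ) ^ (-(q / (q - 1))) with hσ
  have hσ0 : 0 < σ := by positivity
  have hσ1 : σ < 1 := Real.rpow_lt_one_of_one_lt_of_neg (by norm_num)
    (by rw [neg_lt_zero]; positivity)
  have hσ2 : (8:ℝ)^q * σ^(q-1) = 1 := by
    rw [hσ, ← Real.rpow_mul (by norm_num), neg_mul, div_mul_cancel₀ _ hq1.ne',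
      ← Real.rpow_add (by norm_num)]
    simp
  set θ : ℝ := (σ / (64 * C) ^ q) ^ (1 / (q - 1)) with hθ
  have hb : 0 < σ / (64 * C) ^ q := by positivity
  have hθ0 : 0 < θ := by positivity
  have hθ2 : (64 * C) ^ q * θ ^ (q - 1) = σ := by
    rw [hθ, ← Real.rpow_mul hb.le, one_div, inv_mul_cancel₀ hq1.ne', Real.rpow_one]
    field_simp
  refine ⟨θ, hθ0, fun m hm0 hanti hm hmθ => ?_⟩
  have hind : ∀ k : ℕ, m (1/2 * (1 - (1/2)^k)) ≤ θ * σ^k := by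
    intro k
    induction k with
    | zero => simpa using hmθ
    | succ k ih =>
      have hp : (0:ℝ) < (1/2)^k := by positivity
      have hp1 : ((1:ℝ)/2)^k ≤ 1 := pow_le_one₀ (by norm_num) (by norm_num)
      have h1 := hm (1/2 * (1 - (1/2)^k)) (1/2 * (1 - (1/2)^(k+1))) (by nlinarith)
        (by rw [pow_succ]; nlinarith) (by rw [pow_succ]; nlinarith)
      have e : (1/2 * (1 - (1/2:ℝ)^(k+1)) - 1/2 * (1 - (1/2)^k)) = (1/2)^k / 4 := by
        rw [pow_succ]; ring
      rw [e] at h1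
      have e2 : C / ((1/2)^k / 4) ^ 3 = 64 * C * 8^k := by
        rw [div_pow, ← pow_mul, mul_comm k 3, pow_mul]
        norm_num
        rw [div_pow]; field_simp; simp
      rw [e2] at h1
      refine h1.trans ?_
      calc (64 * C * 8^k * m _) ^ q ≤ (64 * C * 8^k * (θ * σ^k)) ^ q := by
            apply Real.rpow_le_rpow (mul_nonneg (by positivity) (hm0 _)) _ (by linarith)
            gcongr
        _ = ((64 * C)^q * θ^(q-1)) * θ * (((8:ℝ)^q * σ^(q-1)) * σ)^k := by
            have e3 : 64 * C * 8^k * (θ * σ^k) = (64 * C) * θ * ((8 * σ)^k) := by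
              rw [mul_pow]; ring
            rw [e3, Real.mul_rpow (by positivity) (by positivity),
              Real.mul_rpow (by positivity) (by positivity)]
            have e4 : ((8 * σ)^k)^q = ((8*σ)^q)^k := by
              rw [← Real.rpow_natCast, ← Real.rpow_natCast, ← Real.rpow_mul (by positivity),
                ← Real.rpow_mul (by positivity), mul_comm q]
            rw [e4, Real.mul_rpow (x := 8) (by norm_num) hσ0.le]
            have e5 : ∀ t : ℝ, 0 < t → t^q = t^(q-1) * t := by
              intro t ht
              conv_rhs => rw [← Real.rpow_one t]
              rw [← Real.rpow_mul ht.le, one_mul, ← Real.rpow_add ht]; congr 1; ring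
            rw [e5 θ hθ0, e5 σ hσ0]; ring
        _ = θ * σ^(k+1) := by rw [hσ2, hθ2, pow_succ]; ring
  have hlim : Tendsto (fun k : ℕ => θ * σ^k) atTop (𝓝 (θ * 0)) :=
    (tendsto_pow_atTop_nhds_zero_of_lt_one hσ0.le hσ1).const_mul _
  rw [mul_zero] at hlim
  refine le_antisymm (ge_of_tendsto hlim (Eventually.of_forall fun k => ?_)) (hm0 _)
  refine (hanti ?_).trans (hind k)
  have hp : (0:ℝ) < (1/2)^k := by positivity
  nlinarith

section
variable {n : ℕ}
local notation "E" => EuclideanSpace ℝ (Fin n)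

lemma clm_apply_eq_sum (L : E →L[ℝ] ℝ) (v : E) :
    L v = ∑ k, v k * L (EuclideanSpace.single k 1) := by
  have h := (EuclideanSpace.basisFun (Fin n) ℝ).sum_repr v
  conv_lhs => rw [← h]
  simp [map_sum]

lemma clm_norm_le (L : E →L[ℝ] ℝ) :
    ‖L‖ ≤ Real.sqrt (∑ k, (L (EuclideanSpace.single k 1)) ^ 2) := by
  refine L.opNorm_le_bound (Real.sqrt_nonneg _) fun v => ?_
  rw [clm_apply_eq_sum L v, Real.norm_eq_abs, EuclideanSpace.norm_eq, ← Real.sqrt_mul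
    (Finset.sum_nonneg fun _ _ => sq_nonneg _)]
  apply Real.abs_le_sqrt
  have := Finset.sum_mul_sq_le_sq_mul_sq Finset.univ (fun k => v k)
    (fun k => L (EuclideanSpace.single k 1))
  simp only [Real.norm_eq_abs, sq_abs]
  linarith

lemma norm_fderiv_le_sqrt (f : E → ℝ) (x : E) : ‖fderiv ℝ f x‖ ≤ Real.sqrt (∑ k, (pd k f x)^2) :=
  clm_norm_le _

lemma abs_pd_le (f : E → ℝ) (x : E) (k : Fin n) : |pd k f x| ≤ ‖fderiv ℝ f x‖ := by
  have := (fderiv ℝ f x).le_opNorm (EuclideanSpace.single k (1:ℝ))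
  simpa [pd] using this

end

lemma sob_lemma (n : ℕ) (hn : 2 ≤ n) : ∃ C q : ℝ, 0 < C ∧ 1 < q ∧
    ∀ u : EuclideanSpace ℝ (Fin n) → ℝ, ContDiff ℝ 1 u → HasCompactSupport u →
    ∀ I s : ℝ, 0 ≤ I → 0 < s → ∫ x, ‖fderiv ℝ u x‖ ≤ I →
      (volume {x | s ≤ |u x|}) ≤ ENNReal.ofReal ((C * I / s) ^ q) := by
  set q : ℝ := Real.conjExponent n with hqd
  have hn' : (1:ℝ) < n := by exact_mod_cast hn
  have hpq : Real.HolderConjugate (n:ℝ) q := Real.HolderConjugate.conjExponent hn'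
  have hq1 : 1 < q := hpq.symm.lt
  set c := lintegralPowLePowLIntegralFDerivConst
    (volume : Measure (EuclideanSpace ℝ (Fin n))) q with hc
  refine ⟨((c:ℝ) + 1) ^ (1/q), q, by positivity, hq1, fun u hu hcs I s hI hs hintg => ?_⟩
  have hq0 : 0 < q := by linarith
  have h1 := lintegral_pow_le_pow_lintegral_fderiv (μ := (volume : Measure (EuclideanSpace ℝ (Fin n))))
    hu hcs (p := q) (by simpa using hpq)
  have hcf : Continuous (fun x => ‖fderiv ℝ u x‖) := (hu.continuous_fderiv one_ne_zero).norm
  have hcsf : HasCompactSupport (fun x => ‖fderiv ℝ u x‖) := (hcs.fderiv ℝ).norm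
  have h2 : ∫⁻ x, ‖fderiv ℝ u x‖ₑ ≤ ENNReal.ofReal I := by
    rw [show (∫⁻ x, ‖fderiv ℝ u x‖ₑ) = ENNReal.ofReal (∫ x, ‖fderiv ℝ u x‖) by
      rw [ofReal_integral_norm_eq_lintegral_enorm]
      exact (hu.continuous_fderiv one_ne_zero).integrable_of_hasCompactSupport (hcs.fderiv ℝ)]
    exact ENNReal.ofReal_le_ofReal hintg
  have h3 : ∫⁻ x, ‖u x‖ₑ ^ q ≤ ENNReal.ofReal (((c:ℝ) + 1) * I ^ q) := by
    refine h1.trans ?_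
    rw [ENNReal.ofReal_mul (by positivity), ← ENNReal.ofReal_rpow_of_nonneg hI hq0.le]
    gcongr
    rw [ENNReal.ofReal_add (by positivity) (by norm_num)]
    simp [hc]
  have h4 := mul_meas_ge_le_lintegral (μ := (volume : Measure (EuclideanSpace ℝ (Fin n))))
    (f := fun x => ‖u x‖ₑ ^ q) (by
      have := hu.continuous.measurable
      fun_prop) (ENNReal.ofReal (s ^ q))
  have hset : {x | s ≤ |u x|} ⊆ {x | ENNReal.ofReal (s ^ q) ≤ ‖u x‖ₑ ^ q} := by
    intro x hx
    simp only [Set.mem_ofPred_eq] at hx ⊢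
    rw [← ENNReal.ofReal_rpow_of_nonneg hs.le hq0.le]
    gcongr
    rw [Real.enorm_eq_ofReal_abs]
    exact ENNReal.ofReal_le_ofReal hx
  have h5 := (mul_le_mul_right (measure_mono hset) (ENNReal.ofReal (s ^ q))).trans (h4.trans h3)
  have hsq : 0 < s ^ q := by positivity
  have e : ENNReal.ofReal (((c:ℝ) + 1) * I ^ q) =
      ENNReal.ofReal (s^q) * ENNReal.ofReal (((((c:ℝ) + 1) ^ (1/q)) * I / s) ^ q) := by
    rw [← ENNReal.ofReal_mul hsq.le, Real.div_rpow (by positivity) hs.le,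
      Real.mul_rpow (by positivity) hI, ← Real.rpow_mul (by positivity), one_div,
      inv_mul_cancel₀ hq0.ne', Real.rpow_one]
    congr 1; field_simp
  rw [e] at h5
  rwa [ENNReal.mul_le_mul_iff_right (by simpa using hsq) ENNReal.ofReal_ne_top] at h5
end PartB2

section PartB3
open Filter Topology MeasureTheory

section
variable {n : ℕ}
local notation "E" => EuclideanSpace ℝ (Fin n)

lemma pd_comp {g : ℝ → ℝ} {g' : ℝ} {f : E → ℝ} {x : E} (hg : HasDerivAt g g' (f x))
    (hf : DifferentiableAt ℝ f x) (k : Fin n) : pd k (fun y => g (f y)) x = g' * pd k f x := by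
  have h := hg.comp_hasFDerivAt x hf.hasFDerivAt
  have := pd_eq_of_hasFDerivAt h k
  rw [show (fun y => g (f y)) = g ∘ f from rfl, this]
  simp [pd]

lemma pd_sub {f g : E → ℝ} {x : E} (hf : DifferentiableAt ℝ f x) (hg : DifferentiableAt ℝ g x)
    (k : Fin n) : pd k (fun y => f y - g y) x = pd k f x - pd k g x := by
  have := pd_eq_of_hasFDerivAt (hf.hasFDerivAt.sub hg.hasFDerivAt) k
  rw [show (fun y => f y - g y) = f - g from rfl, this]
  simp [pd]

lemma pd_add {f g : E → ℝ} {x : E} (hf : DifferentiableAt ℝ f x) (hg : DifferentiableAt ℝ g x)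
    (k : Fin n) : pd k (fun y => f y + g y) x = pd k f x + pd k g x := by
  have := pd_eq_of_hasFDerivAt (hf.hasFDerivAt.add hg.hasFDerivAt) k
  rw [show (fun y => f y + g y) = f + g from rfl, this]
  simp [pd]

lemma pd_mul {f g : E → ℝ} {x : E} (hf : DifferentiableAt ℝ f x) (hg : DifferentiableAt ℝ g x)
    (k : Fin n) : pd k (fun y => f y * g y) x = pd k f x * g x + f x * pd k g x := by
  have := pd_eq_of_hasFDerivAt (hf.hasFDerivAt.mul hg.hasFDerivAt) k
  rw [show (fun y => f y * g y) = f * g from rfl, this]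
  simp [pd]; ring

lemma pd_const_mul {f : E → ℝ} {x : E} (c : ℝ) (hf : DifferentiableAt ℝ f x)
    (k : Fin n) : pd k (fun y => c * f y) x = c * pd k f x := by
  have := pd_eq_of_hasFDerivAt (hf.hasFDerivAt.const_mul c) k
  simpa [pd] using this

lemma pd_const (c : ℝ) (x : E) (k : Fin n) : pd k (fun _ : E => c) x = 0 := by
  simp [pd]

lemma pd_quad (x0 x : E) (k : Fin n) :
    pd k (fun y : E => 32 * ‖y - x0‖ ^ 2) x = 64 * (x k - x0 k) := by
  have h := (((hasFDerivAt_id (𝕜 := ℝ) x).sub_const x0).norm_sq).const_mul 32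
  have := pd_eq_of_hasFDerivAt h k
  simp only [id] at this
  rw [this]
  simp [EuclideanSpace.inner_single_right]
  ring

end

/-- pointwise inequality used in the first lemma -/
lemma fl_point (n : ℕ) (lam Lam κ P : ℝ) (hlam : 0 < lam) (hLam : 0 < Lam) (hκ1 : κ ^ 2 ≤ 1)
    (hP0 : 0 ≤ P) (hP1 : P ≤ 1)
    (V g y : Fin n → ℝ) (hy : ∑ k, (y k)^2 ≤ 256)
    (s1 : lam * ∑ k, (g k) ^ 2 ≤ (∑ k, V k * g k) + κ ^ 2)
    (s2 : ∑ k, (V k) ^ 2 ≤ Lam * ((∑ k, (g k) ^ 2) + κ ^ 2)) :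
    Real.sqrt (∑ k, (3 * P^2 * (g k - y k))^2) ≤
      3 / lam * (∑ k, V k * (2 * P * (g k - y k))) + (6 / lam * (1 + lam / 2 + 128 * Lam / lam) + 800) := by
  set G := ∑ k, (g k)^2 with hG
  have hG0 : 0 ≤ G := Finset.sum_nonneg fun _ _ => sq_nonneg _
  have h1 : ∑ k, V k * y k ≤ lam / (2 * Lam) * ∑ k, (V k)^2 + Lam / (2 * lam) * ∑ k, (y k)^2 := by
    rw [Finset.mul_sum, Finset.mul_sum, ← Finset.sum_add_distrib]
    refine Finset.sum_le_sum fun k _ => ?_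
    have : 0 ≤ (lam * V k - Lam * y k)^2 / (2 * lam * Lam) := by positivity
    have e : (lam * V k - Lam * y k)^2 / (2 * lam * Lam)
      = lam / (2 * Lam) * (V k)^2 + Lam / (2 * lam) * (y k)^2 - V k * y k := by
      field_simp
      ring
    linarith
  have h2 : lam / (2 * Lam) * ∑ k, (V k)^2 ≤ lam / 2 * (G + κ^2) := by
    calc _ ≤ lam / (2 * Lam) * (Lam * (G + κ^2)) := by gcongr
      _ = _ := by field_simp
  have h3 : Lam / (2 * lam) * ∑ k, (y k)^2 ≤ 128 * Lam / lam := by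
    calc _ ≤ Lam / (2 * lam) * 256 := by gcongr
      _ = _ := by field_simp; norm_num
  have h4 : ∑ k, V k * (2 * P * (g k - y k)) = 2 * P * ((∑ k, V k * g k) - ∑ k, V k * y k) := by
    rw [← Finset.sum_sub_distrib, Finset.mul_sum]
    exact Finset.sum_congr rfl fun k _ => by ring
  set C1 := 1 + lam / 2 + 128 * Lam / lam with hC1
  have h5 : lam / 2 * G - C1 ≤ (∑ k, V k * g k) - ∑ k, V k * y k := by nlinarith
  have hC10 : 0 ≤ C1 := by positivity
  set G' := ∑ k, (g k - y k)^2 with hG'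
  have hG'0 : 0 ≤ G' := Finset.sum_nonneg fun _ _ => sq_nonneg _
  have h6 : G' ≤ 2 * G + 512 := by
    have : G' ≤ ∑ k, (2 * (g k)^2 + 2 * (y k)^2) :=
      Finset.sum_le_sum fun k _ => by nlinarith [sq_nonneg (g k + y k)]
    rw [Finset.sum_add_distrib, ← Finset.mul_sum, ← Finset.mul_sum] at this
    linarith
  have h7 : Real.sqrt (∑ k, (3 * P^2 * (g k - y k))^2) = 3 * P^2 * Real.sqrt G' := by
    have : ∑ k, (3 * P^2 * (g k - y k))^2 = (3 * P^2)^2 * G' := by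
      rw [hG', Finset.mul_sum]; exact Finset.sum_congr rfl fun k _ => by ring
    rw [this, Real.sqrt_mul (by positivity), Real.sqrt_sq (by positivity)]
  have h8 : Real.sqrt G' ≤ (1 + G') / 2 := by
    have := Real.sq_sqrt hG'0
    nlinarith [sq_nonneg (Real.sqrt G' - 1)]
  have h9 : 3 * P^2 * Real.sqrt G' ≤ 3 * P * G + 800 := by
    have : Real.sqrt G' ≤ G + 513/2 := by linarith
    have hP2 : P^2 ≤ P := by nlinarith
    calc 3 * P^2 * Real.sqrt G' ≤ 3 * P * (G + 513/2) := by
          apply mul_le_mul _ this (Real.sqrt_nonneg _) (by positivity); linarith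
      _ ≤ _ := by nlinarith
  rw [h7, h4]
  refine h9.trans ?_
  have h10 : 3 * P * G ≤ 3 / lam * (2 * P * ((∑ k, V k * g k) - ∑ k, V k * y k)) + 6 / lam * C1 := by
    have hh : 3 / lam * (2 * P * (lam / 2 * G - C1)) ≤
      3 / lam * (2 * P * ((∑ k, V k * g k) - ∑ k, V k * y k)) := by gcongr
    have e : 3 / lam * (2 * P * (lam / 2 * G - C1)) = 3 * P * G - 6 / lam * C1 * P := by
      field_simp
      ring
    have : 6 / lam * C1 * P ≤ 6 / lam * C1 := by
      have : 0 ≤ 6 / lam * C1 := by positivity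
      nlinarith
    linarith
  linarith

lemma FL (n : ℕ) (hn : 2 ≤ n) (lam Lam : ℝ) (hlam : 0 < lam) (hLam : 0 < Lam) :
    ∃ θ : ℝ, 0 < θ ∧ ∀ (x0 : EuclideanSpace ℝ (Fin n)) (w : EuclideanSpace ℝ (Fin n) → ℝ)
      (V : Fin n → EuclideanSpace ℝ (Fin n) → ℝ) (κ : ℝ), DG n x0 (1/4) lam Lam κ w V →
      0 ≤ κ → κ ≤ 1 → (∀ x ∈ Metric.ball x0 (1/4), w x ≤ 1) →
      volume.real {x | x ∈ Metric.ball x0 (1/4) ∧ 0 < w x} ≤ θ → w x0 ≤ 1/2 := by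
  obtain ⟨C, q, hC, hq, hsob⟩ := sob_lemma n hn
  set C1 : ℝ := 3 / lam + (6 / lam * (1 + lam / 2 + 128 * Lam / lam) + 800) with hC1
  have hC10 : 0 < C1 := by positivity
  obtain ⟨θ, hθ, hiter⟩ := iter_lemma (C * C1) q (by positivity) hq
  refine ⟨θ, hθ, fun x0 w V κ hDG hκ0 hκ1 hw1 hvol => ?_⟩
  set U := Metric.ball x0 (1/4 : ℝ) with hU
  have hUo : IsOpen U := Metric.isOpen_ball
  set W : EuclideanSpace ℝ (Fin n) → ℝ := fun x => w x - 32 * ‖x - x0‖^2 with hW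
  have hWc : ContDiffOn ℝ 1 W U :=
    hDG.hw.sub (contDiffOn_const.mul ((contDiff_id.sub contDiff_const).norm_sq ℝ).contDiffOn)
  have hW1 : ∀ x ∈ U, W x ≤ 1 := fun x hx => by
    have := hw1 x hx; simp only [hW]; nlinarith [sq_nonneg ‖x - x0‖]
  have hpdW : ∀ x ∈ U, ∀ k, pd k W x = pd k w x - 64 * (x k - x0 k) := by
    intro x hx k
    have h1 : DifferentiableAt ℝ w x :=
      (hDG.hw.differentiableOn one_ne_zero).differentiableAt (hUo.mem_nhds hx)
    have h2 : DifferentiableAt ℝ (fun y : EuclideanSpace ℝ (Fin n) => 32 * ‖y - x0‖ ^ 2) x :=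
      (((differentiableAt_id).sub_const x0).norm_sq ℝ).const_mul 32
    rw [hW, pd_sub h1 h2, pd_quad]
  set S : ℝ → Set (EuclideanSpace ℝ (Fin n)) := fun l => {x | x ∈ U ∧ l < W x} with hS
  have hSo : ∀ l, IsOpen (S l) := fun l => by
    have := hWc.continuousOn.isOpen_inter_preimage hUo (isOpen_Ioi (a := l))
    exact this
  have hSU : ∀ l, S l ⊆ U := fun l x hx => hx.1
  have hfin : ∀ l, volume (S l) ≠ ⊤ := fun l =>
    ((measure_mono (hSU l)).trans_lt measure_ball_lt_top).ne
  set m : ℝ → ℝ := fun l => volume.real (S l) with hm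
  have hstep : ∀ l l', 0 ≤ l → l < l' → l' ≤ 1/2 → m l' ≤ (C * C1 / (l' - l) ^ 3 * m l) ^ q := by
    intro l l' hl0 hll hl'
    set P : EuclideanSpace ℝ (Fin n) → ℝ := fun x => max (W x - l) 0 with hP
    have hKU : Metric.closedBall x0 (1/5 : ℝ) ⊆ U := Metric.closedBall_subset_ball (by norm_num)
    have hPz : ∀ x ∈ U, x ∉ Metric.closedBall x0 (1/5 : ℝ) → P x = 0 := by
      intro x hx hxK
      rw [Metric.mem_closedBall, dist_eq_norm, not_le] at hxK
      have := hw1 x hx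
      simp only [hP, hW]
      apply max_eq_right
      nlinarith
    have hcd : ∀ j : ℕ, ContDiffOn ℝ 1 (fun x => P x ^ (j + 2)) U := fun j =>
      (contDiff_pp j).comp_contDiffOn (hWc.sub contDiffOn_const)
    obtain ⟨hφ, hφc, hφs⟩ := ext0_spec hUo (isCompact_closedBall x0 (1/5 : ℝ)) hKU (hcd 0)
      (fun x hx hxK => by rw [hPz x hx hxK]; simp)
    obtain ⟨hu, huc, hus⟩ := ext0_spec hUo (isCompact_closedBall x0 (1/5 : ℝ)) hKU (hcd 1)
      (fun x hx hxK => by rw [hPz x hx hxK]; simp)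
    set φ := ext0 U (fun x => P x ^ (0 + 2)) with hφd
    set u := ext0 U (fun x => P x ^ (1 + 2)) with hud
    have hpd : ∀ j : ℕ, ∀ x ∈ U, ∀ k, pd k (ext0 U (fun x => P x ^ (j + 2))) x
        = ((j:ℝ) + 2) * P x ^ (j + 1) * (pd k w x - 64 * (x k - x0 k)) := by
      intro j x hx k
      rw [pd_ext0 hUo hx]
      have hd : DifferentiableAt ℝ (fun y => W y - l) x :=
        ((hWc.differentiableOn one_ne_zero).differentiableAt (hUo.mem_nhds hx)).sub_const l
      have h1 := pd_comp (hasDerivAt_pp j (W x - l)) hd k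
      rw [hP, h1]
      congr 1
      rw [pd_sub ((hWc.differentiableOn one_ne_zero).differentiableAt (hUo.mem_nhds hx))
        (differentiableAt_const l), pd_const, sub_zero, hpdW x hx k]
    have hP0 : ∀ x, 0 ≤ P x := fun x => le_max_right _ _
    have hP1 : ∀ x ∈ U, P x ≤ 1 := fun x hx => max_le (by linarith [hW1 x hx]) (by norm_num)
    have hφ0 : ∀ x, 0 ≤ φ x := fun x => by
      by_cases hx : x ∈ U
      · rw [hφd, ext0_of_mem hx]; exact pow_nonneg (hP0 x) _
      · rw [hφd, ext0_of_notMem hx]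
    have hweak := weak_form hDG hφ hφc (hφs.trans hKU) hφ0
    have hPS : ∀ x ∈ U, x ∉ S l → P x = 0 := fun x hx hxS => by
      simp only [hP]
      apply max_eq_right
      by_contra h
      exact hxS ⟨hx, by linarith⟩
    have hφS : ∀ x, φ x ≤ (S l).indicator (fun _ => (1:ℝ)) x := by
      intro x
      by_cases hx : x ∈ S l
      · rw [Set.indicator_of_mem hx, hφd, ext0_of_mem (hSU l hx)]
        exact pow_le_one₀ (hP0 x) (hP1 x (hSU l hx))
      · rw [Set.indicator_of_notMem hx]
        by_cases hxU : x ∈ U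
        · rw [hφd, ext0_of_mem hxU, hPS x hxU hx]; simp
        · rw [hφd, ext0_of_notMem hxU]
    have hind : Integrable ((S l).indicator (fun _ => (1:ℝ))) :=
      (integrable_indicator_iff (hSo l).measurableSet).2 (integrableOn_const (hfin l))
    have hindI : ∫ x, (S l).indicator (fun _ => (1:ℝ)) x = m l := by
      rw [integral_indicator (hSo l).measurableSet]; simp [hm]
    have hφI : ∫ x, φ x ≤ m l := by
      rw [← hindI]
      exact integral_mono (hφ.continuous.integrable_of_hasCompactSupport hφc) hind hφS
    have hpoint : ∀ x, ‖fderiv ℝ u x‖ ≤ 3 / lam * (∑ k, V k x * pd k φ x) +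
        (6 / lam * (1 + lam / 2 + 128 * Lam / lam) + 800) * (S l).indicator (fun _ => (1:ℝ)) x := by
      intro x
      refine (norm_fderiv_le_sqrt u x).trans ?_
      by_cases hxU : x ∈ U
      · by_cases hx : x ∈ S l
        · rw [Set.indicator_of_mem hx, mul_one]
          have hy : ∑ k, (64 * (x k - x0 k))^2 ≤ 256 := by
            have h1 : ‖x - x0‖ ≤ 1/4 := by
              rw [hU, Metric.mem_ball, dist_eq_norm] at hxU; exact hxU.le
            have h2 : ‖x - x0‖^2 = ∑ k, (x k - x0 k)^2 := by
              rw [EuclideanSpace.norm_sq_eq]; simp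
            have h3 : ∑ k, (64 * (x k - x0 k))^2 = 4096 * ∑ k, (x k - x0 k)^2 := by
              rw [Finset.mul_sum]; exact Finset.sum_congr rfl fun k _ => by ring
            rw [h3, ← h2]
            nlinarith [norm_nonneg (x - x0)]
          have := fl_point n lam Lam κ (P x) hlam hLam (by nlinarith) (hP0 x) (hP1 x hxU)
            (fun k => V k x) (fun k => pd k w x) (fun k => 64 * (x k - x0 k)) hy
            (hDG.s1 x hxU) (hDG.s2 x hxU)
          have e1 : ∀ k, pd k u x = 3 * P x ^2 * (pd k w x - 64 * (x k - x0 k)) := fun k => by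
            rw [hud, hpd 1 x hxU k]; norm_num
          have e2 : ∀ k, pd k φ x = 2 * P x * (pd k w x - 64 * (x k - x0 k)) := fun k => by
            rw [hφd, hpd 0 x hxU k]; norm_num
          simp_rw [e1, e2]
          exact this
        · have e1 : ∀ k, pd k u x = 0 := fun k => by
            rw [hud, hpd 1 x hxU k, hPS x hxU hx]; simp
          have e2 : ∀ k, pd k φ x = 0 := fun k => by
            rw [hφd, hpd 0 x hxU k, hPS x hxU hx]; simp
          rw [Set.indicator_of_notMem hx]
          simp [e1, e2]
      · have hx : x ∉ S l := fun h => hxU h.1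
        have e1 : ∀ k, pd k u x = 0 := fun k =>
          image_eq_zero_of_notMem_tsupport fun h => hxU (hKU (hus (tsupport_pd_subset u k h)))
        have e2 : ∀ k, pd k φ x = 0 := fun k =>
          image_eq_zero_of_notMem_tsupport fun h => hxU (hKU (hφs (tsupport_pd_subset φ k h)))
        rw [Set.indicator_of_notMem hx]
        simp [e1, e2]
    have hm0 : 0 ≤ m l := measureReal_nonneg
    have hVi : Integrable (fun x => ∑ k, V k x * pd k φ x) :=
      integrable_finsetSum _ fun k _ => integrable_mul_of_tsupport hUo (hDG.hV k).continuousOn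
        (continuous_pd hφ k) (hφc.mono' ((subset_tsupport _).trans (tsupport_pd_subset φ k)))
        ((tsupport_pd_subset φ k).trans (hφs.trans hKU))
    have hI : ∫ x, ‖fderiv ℝ u x‖ ≤ C1 * m l := by
      have h1 := integral_mono ((hu.continuous_fderiv one_ne_zero).norm.integrable_of_hasCompactSupport
        (huc.fderiv ℝ).norm) ((hVi.const_mul (3 / lam)).add (hind.const_mul
          (6 / lam * (1 + lam / 2 + 128 * Lam / lam) + 800))) hpoint
      simp only [Pi.add_apply] at h1
      rw [integral_add (hVi.const_mul _) (hind.const_mul _), integral_const_mul, integral_const_mul,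
        hindI] at h1
      have h2 : ∫ x, ∑ k, V k x * pd k φ x ≤ m l := by
        refine hweak.trans ?_
        have : 0 ≤ ∫ x, φ x := integral_nonneg hφ0
        nlinarith
      have h3 : 3 / lam * (∫ x, ∑ k, V k x * pd k φ x) ≤ 3 / lam * m l := by gcongr
      rw [hC1]; linarith
    have hd : 0 < (l' - l)^3 := by have : 0 < l' - l := by linarith
                                   positivity
    have hs := hsob u hu huc (C1 * m l) ((l' - l)^3) (by positivity) hd hI
    have hsub : S l' ⊆ {x | (l' - l)^3 ≤ |u x|} := by
      intro x hx
      change (l' - l)^3 ≤ |u x|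
      rw [hud, ext0_of_mem hx.1, abs_of_nonneg (pow_nonneg (hP0 x) _)]
      have : l' - l ≤ P x := (by linarith [hx.2] : l' - l ≤ W x - l).trans (le_max_left _ _)
      exact pow_le_pow_left₀ (by linarith) this 3
    have := ENNReal.toReal_le_of_le_ofReal (by positivity) ((measure_mono hsub).trans hs)
    refine this.trans (le_of_eq ?_)
    congr 1; ring
  have hanti : Antitone m := fun l l' hll =>
    measureReal_mono (fun x hx => ⟨hx.1, hll.trans_lt hx.2⟩) (hfin l)
  have hm0 : m 0 ≤ θ := by
    have hsub : S 0 ⊆ {x | x ∈ U ∧ 0 < w x} := fun x hx => ⟨hx.1, by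
      have := hx.2; simp only [hW] at this; nlinarith [sq_nonneg ‖x - x0‖]⟩
    have hsub2 : {x | x ∈ U ∧ 0 < w x} ⊆ U := fun x hx => hx.1
    exact (measureReal_mono hsub ((measure_mono hsub2).trans_lt measure_ball_lt_top).ne).trans hvol
  have hzero := hiter m (fun l => measureReal_nonneg) hanti hstep hm0
  by_contra hcon
  rw [not_le] at hcon
  have hx0 : x0 ∈ S (1/2) := ⟨by simp [hU], by simpa [hW] using hcon⟩
  have hpos := (hSo (1/2)).measure_pos volume ⟨x0, hx0⟩
  have := ENNReal.toReal_pos hpos.ne' (hfin _)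
  exact absurd hzero this.ne'
end PartB3

section PartB4
open Filter Topology MeasureTheory
open scoped ENNReal

section
variable {n : ℕ}
local notation "E" => EuclideanSpace ℝ (Fin n)

lemma lint_affine (g : E → ℝ≥0∞) (hg : Measurable g) (t : ℝ) (ht : 1/2 ≤ t) (c : E) :
    ∫⁻ z, g (c + t • z) ≤ 2 ^ n * ∫⁻ z, g z := by
  have ht0 : 0 < t := by linarith
  have h1 : ∫⁻ z, g (c + t • z) = ∫⁻ z, g (c + z) ∂(Measure.map (t • ·) (volume : Measure E)) := by
    rw [lintegral_map (by fun_prop) (by fun_prop)]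
  rw [h1, Measure.map_addHaar_smul _ ht0.ne', lintegral_smul_measure, lintegral_add_left_eq_self]
  rw [smul_eq_mul]
  gcongr
  rw [finrank_euclideanSpace_fin, abs_of_pos (by positivity), ← inv_pow,
    ENNReal.ofReal_pow (by positivity)]
  gcongr
  rw [← ENNReal.ofReal_ofNat]
  apply ENNReal.ofReal_le_ofReal
  rw [inv_le_comm₀ ht0 (by norm_num)]
  linarith

lemma poinc (f : E → ℝ) (hf : ContDiffOn ℝ 1 f (Metric.ball 0 (1/2))) (X Z : Set E)
    (hX : MeasurableSet X) (hZ : MeasurableSet Z)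
    (hXb : X ⊆ Metric.ball 0 (1/2)) (hZb : Z ⊆ Metric.ball 0 (1/2)) (l : ℝ)
    (h : ∀ x ∈ X, ∀ z ∈ Z, l ≤ f z - f x) :
    ENNReal.ofReal l * volume X * volume Z ≤ 2 ^ n * volume (Metric.ball (0 : E) (1/2)) *
      ∫⁻ x in Metric.ball (0:E) (1/2), ‖fderiv ℝ f x‖ₑ := by
  set U := Metric.ball (0:E) (1/2) with hU
  have hUo : IsOpen U := Metric.isOpen_ball
  set g : E → ℝ≥0∞ := U.indicator (fun x => ‖fderiv ℝ f x‖ₑ) with hg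
  have hgm : Measurable g := (measurable_fderiv ℝ f).enorm.indicator hUo.measurableSet
  have hI : ∫⁻ x in U, ‖fderiv ℝ f x‖ₑ = ∫⁻ x, g x := (lintegral_indicator hUo.measurableSet _).symm
  rw [hI]
  have hmem : ∀ x ∈ U, ∀ z ∈ U, ∀ t ∈ Set.Icc (0:ℝ) 1, x + t • (z - x) ∈ U := by
    intro x hx z hz t ht
    exact (convex_ball (0:E) (1/2)).add_smul_sub_mem hx hz ht
  have hseg : ∀ x ∈ X, ∀ z ∈ Z, ENNReal.ofReal l ≤ ∫⁻ t in Set.Ioc (0:ℝ) 1, g (x + t • (z - x)) := by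
    intro x hx z hz
    have hx' := hXb hx
    have hz' := hZb hz
    have hd : ∀ t ∈ Set.uIcc (0:ℝ) 1, HasDerivAt (fun t : ℝ => f (x + t • (z - x)))
        (fderiv ℝ f (x + t • (z - x)) (z - x)) t := by
      intro t ht
      rw [Set.uIcc_of_le zero_le_one] at ht
      have h1 : DifferentiableAt ℝ f (x + t • (z - x)) :=
        (hf.differentiableOn one_ne_zero).differentiableAt (hUo.mem_nhds (hmem x hx' z hz' t ht))
      have h2 : HasDerivAt (fun t : ℝ => x + t • (z - x)) (z - x) t := by
        simpa using ((hasDerivAt_id t).smul_const (z - x)).const_add x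
      exact h1.hasFDerivAt.comp_hasDerivAt t h2
    have hc : ContinuousOn (fun t : ℝ => fderiv ℝ f (x + t • (z - x)) (z - x)) (Set.uIcc 0 1) := by
      rw [Set.uIcc_of_le zero_le_one]
      refine ContinuousOn.clm_apply ?_ continuousOn_const
      exact (hf.continuousOn_fderiv_of_isOpen hUo le_rfl).comp (by fun_prop)
        (fun t ht => hmem x hx' z hz' t ht)
    have hintg := intervalIntegral.integral_eq_sub_of_hasDerivAt hd hc.intervalIntegrable
    simp only [one_smul, add_sub_cancel, zero_smul, add_zero] at hintg
    have h1 : ENNReal.ofReal l ≤ ENNReal.ofReal ‖∫ t in (0:ℝ)..1, fderiv ℝ f (x + t • (z - x)) (z - x)‖ := by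
      apply ENNReal.ofReal_le_ofReal
      rw [hintg]
      exact (h x hx z hz).trans (le_abs_self _)
    refine h1.trans ?_
    rw [ofReal_norm, intervalIntegral.integral_of_le zero_le_one]
    refine (enorm_integral_le_lintegral_enorm _).trans ?_
    refine setLIntegral_mono (hgm.comp (by fun_prop)) fun t ht => ?_
    rw [hg, Set.indicator_of_mem (hmem x hx' z hz' t ⟨ht.1.le, ht.2⟩)]
    have h3 := (fderiv ℝ f (x + t • (z - x))).le_opNorm (z - x)
    have h4 : ‖z - x‖ ≤ 1 := by
      have := norm_sub_le z x
      have a1 : ‖x‖ < 1/2 := by simpa [hU] using hx'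
      have a2 : ‖z‖ < 1/2 := by simpa [hU] using hz'
      linarith
    rw [← ofReal_norm, ← ofReal_norm]
    apply ENNReal.ofReal_le_ofReal
    nlinarith [norm_nonneg (fderiv ℝ f (x + t • (z - x)))]
  have hm2 : Measurable (fun p : E × E × ℝ => g (p.1 + p.2.2 • (p.2.1 - p.1))) :=
    hgm.comp (by fun_prop)
  have hslice : ∀ t ∈ Set.Ioc (0:ℝ) 1, ∫⁻ x in X, ∫⁻ z in Z, g (x + t • (z - x)) ≤
      2 ^ n * volume U * ∫⁻ x, g x := by
    intro t ht
    rcases le_total (1/2) t with h2 | h2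
    · calc _ ≤ ∫⁻ x in X, 2 ^ n * ∫⁻ x, g x := by
            refine lintegral_mono fun x => ?_
            refine (setLIntegral_le_lintegral _ _).trans ?_
            have := lint_affine g hgm t h2 ((1 - t) • x)
            refine le_trans (le_of_eq ?_) this
            refine lintegral_congr fun z => ?_
            congr 1; module
        _ = 2 ^ n * (∫⁻ x, g x) * volume X := by rw [setLIntegral_const]
        _ ≤ 2 ^ n * (∫⁻ x, g x) * volume U := by gcongr
        _ = _ := by ring
    · rw [lintegral_lintegral_swap (f := fun x z => g (x + t • (z - x)))
        (Measurable.aemeasurable (hgm.comp (by fun_prop)))]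
      calc _ ≤ ∫⁻ z in Z, 2 ^ n * ∫⁻ x, g x := by
            refine lintegral_mono fun z => ?_
            refine (setLIntegral_le_lintegral _ _).trans ?_
            have := lint_affine g hgm (1 - t) (by linarith) (t • z)
            refine le_trans (le_of_eq ?_) this
            refine lintegral_congr fun x => ?_
            congr 1; module
        _ = 2 ^ n * (∫⁻ x, g x) * volume Z := by rw [setLIntegral_const]
        _ ≤ 2 ^ n * (∫⁻ x, g x) * volume U := by gcongr
        _ = _ := by ring
  calc ENNReal.ofReal l * volume X * volume Z = ∫⁻ x in X, ∫⁻ z in Z, ENNReal.ofReal l := by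
        rw [setLIntegral_const, setLIntegral_const]; ring
    _ ≤ ∫⁻ x in X, ∫⁻ z in Z, ∫⁻ t in Set.Ioc (0:ℝ) 1, g (x + t • (z - x)) := by
        refine setLIntegral_mono' hX fun x hx => setLIntegral_mono' hZ fun z hz => hseg x hx z hz
    _ = ∫⁻ x in X, ∫⁻ t in Set.Ioc (0:ℝ) 1, ∫⁻ z in Z, g (x + t • (z - x)) := by
        refine lintegral_congr fun x => ?_
        exact lintegral_lintegral_swap (hgm.comp (by fun_prop)).aemeasurable
    _ = ∫⁻ t in Set.Ioc (0:ℝ) 1, ∫⁻ x in X, ∫⁻ z in Z, g (x + t • (z - x)) := by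
        refine lintegral_lintegral_swap ?_
        refine Measurable.aemeasurable ?_
        have : Measurable (fun q : (E × ℝ) × E => g (q.1.1 + q.1.2 • (q.2 - q.1.1))) :=
          hgm.comp (by fun_prop)
        exact this.lintegral_prod_right
    _ ≤ ∫⁻ t in Set.Ioc (0:ℝ) 1, 2 ^ n * volume U * ∫⁻ x, g x :=
        setLIntegral_mono' measurableSet_Ioc hslice
    _ = _ := by rw [setLIntegral_const]; simp

end
end PartB4

section PartB5
open Filter Topology MeasureTheory
open scoped ENNReal

/-- pointwise inequality for the logarithmic estimate -/
lemma log_point (n : ℕ) (lam Lam D ζ : ℝ) (hlam : 0 < lam) (hLam : 0 < Lam)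
    (hζ0 : 0 ≤ ζ) (hζ1 : ζ ≤ 1)
    (v g y : Fin n → ℝ) (hy : ∑ k, (y k)^2 ≤ D)
    (s1 : lam * ∑ k, (g k) ^ 2 ≤ (∑ k, v k * g k) + 1)
    (s2 : ∑ k, (v k) ^ 2 ≤ Lam * ((∑ k, (g k) ^ 2) + 1)) :
    lam / 2 * (ζ^2 * ∑ k, (g k)^2) ≤
      (∑ k, (2 * ζ * v k * y k + ζ^2 * (v k * g k))) + (1 + lam / 2 + 2 * Lam / lam * D) := by
  set G := ∑ k, (g k)^2 with hG
  have hG0 : 0 ≤ G := Finset.sum_nonneg fun _ _ => sq_nonneg _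
  have h1 : -∑ k, (2 * ζ * v k * y k) ≤ lam / (2 * Lam) * ζ^2 * ∑ k, (v k)^2 + 2 * Lam / lam * ∑ k, (y k)^2 := by
    rw [Finset.mul_sum, Finset.mul_sum, ← Finset.sum_add_distrib, ← Finset.sum_neg_distrib]
    refine Finset.sum_le_sum fun k _ => ?_
    have : 0 ≤ (lam * ζ * v k + 2 * Lam * y k)^2 / (2 * lam * Lam) := by positivity
    have e : (lam * ζ * v k + 2 * Lam * y k)^2 / (2 * lam * Lam)
      = lam / (2 * Lam) * ζ^2 * (v k)^2 + 2 * Lam / lam * (y k)^2 + 2 * ζ * v k * y k := by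
      field_simp
      ring
    linarith
  have h2 : lam / (2 * Lam) * ζ^2 * ∑ k, (v k)^2 ≤ lam / 2 * ζ^2 * (G + 1) := by
    calc _ ≤ lam / (2 * Lam) * ζ^2 * (Lam * (G + 1)) := by gcongr
      _ = _ := by field_simp
  have h3 : 2 * Lam / lam * ∑ k, (y k)^2 ≤ 2 * Lam / lam * D := by gcongr
  rw [Finset.sum_add_distrib, ← Finset.mul_sum]
  have hz : ζ^2 ≤ 1 := by nlinarith
  have h4 : ζ^2 * (lam * G) ≤ ζ^2 * ((∑ k, v k * g k) + 1) := by gcongr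
  have h5 : lam / 2 * ζ^2 ≤ lam / 2 := by nlinarith
  nlinarith

lemma log_est (n : ℕ) (lam Lam : ℝ) (hlam : 0 < lam) (hLam : 0 < Lam) :
    ∃ C : ℝ, 0 < C ∧ ∀ (w : EuclideanSpace ℝ (Fin n) → ℝ)
      (V : Fin n → EuclideanSpace ℝ (Fin n) → ℝ) (κ τ S : ℝ), DG n 0 1 lam Lam κ w V →
      0 ≤ κ → κ ≤ τ → 0 < τ → (∀ x ∈ Metric.ball 0 1, w x ≤ S) →
      ∫⁻ x in Metric.ball (0:EuclideanSpace ℝ (Fin n)) (1/2),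
        ‖fderiv ℝ (fun x => Real.log (S - w x + τ)) x‖ₑ ≤ ENNReal.ofReal C := by
  let ζ : ContDiffBump (0 : EuclideanSpace ℝ (Fin n)) := ⟨1/2, 3/4, by norm_num, by norm_num⟩
  have hζd : ContDiff ℝ 1 (ζ : EuclideanSpace ℝ (Fin n) → ℝ) := ζ.contDiff
  obtain ⟨D, hD⟩ : ∃ D, ∀ x, ∑ k, (pd k ζ x)^2 ≤ D := by
    have hc : Continuous (fun x => ∑ k, (pd k ζ x)^2) :=
      continuous_finsetSum _ fun k _ => (continuous_pd hζd k).pow 2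
    have hs : HasCompactSupport (fun x => ∑ k, (pd k ζ x)^2) := by
      refine HasCompactSupport.intro ζ.hasCompactSupport fun x hx => ?_
      refine Finset.sum_eq_zero fun k _ => ?_
      rw [image_eq_zero_of_notMem_tsupport fun h => hx (tsupport_pd_subset _ k h)]; simp
    obtain ⟨D, hD⟩ := hc.bounded_above_of_compact_support hs
    exact ⟨D, fun x => (le_abs_self _).trans (hD x)⟩
  set K := Metric.closedBall (0 : EuclideanSpace ℝ (Fin n)) (3/4) with hK
  have hD0 : 0 ≤ D := (Finset.sum_nonneg fun _ _ => sq_nonneg _).trans (hD 0)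
  set C0 := 1 + lam / 2 + 2 * Lam / lam * D with hC0
  have hC0p : 0 < C0 := by positivity
  set vK := volume.real K with hvK
  have hvK0 : 0 ≤ vK := measureReal_nonneg
  refine ⟨1 / lam * (vK + C0 * vK) + vK + 1, by positivity, fun w V κ τ S hDG hκ0 hκτ hτ hw => ?_⟩
  set U := Metric.ball (0 : EuclideanSpace ℝ (Fin n)) 1 with hU
  have hUo : IsOpen U := Metric.isOpen_ball
  have hKU : K ⊆ U := Metric.closedBall_subset_ball (by norm_num)
  have hKc : IsCompact K := isCompact_closedBall _ _
  set z : EuclideanSpace ℝ (Fin n) → ℝ := fun x => S - w x + τ with hz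
  have hzc : ContDiffOn ℝ 1 z U := (contDiffOn_const.sub hDG.hw).add contDiffOn_const
  have hzτ : ∀ x ∈ U, τ ≤ z x := fun x hx => by have := hw x hx; simp only [hz]; linarith
  have hz0 : ∀ x ∈ U, 0 < z x := fun x hx => hτ.trans_le (hzτ x hx)
  have hwd : ∀ x ∈ U, DifferentiableAt ℝ w x := fun x hx =>
    (hDG.hw.differentiableOn one_ne_zero).differentiableAt (hUo.mem_nhds hx)
  have hzd : ∀ x ∈ U, DifferentiableAt ℝ z x := fun x hx =>
    (hzc.differentiableOn one_ne_zero).differentiableAt (hUo.mem_nhds hx)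
  have hpz : ∀ x ∈ U, ∀ k, pd k z x = - pd k w x := by
    intro x hx k
    rw [hz, pd_add (f := fun y => S - w y) ((differentiableAt_const S).sub (hwd x hx)) (differentiableAt_const τ),
      pd_sub (differentiableAt_const S) (hwd x hx), pd_const, pd_const]
    ring
  have hζK : ∀ x, x ∉ K → ζ x = 0 := fun x hx => by
    apply ζ.zero_of_le_dist
    change 3/4 ≤ dist x 0
    rw [hK, Metric.mem_closedBall, not_le] at hx
    exact hx.le
  set f : EuclideanSpace ℝ (Fin n) → ℝ := fun x => (ζ x)^2 * (z x)⁻¹ with hf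
  have hfc : ContDiffOn ℝ 1 f U :=
    (hζd.contDiffOn.pow 2).mul (hzc.inv fun x hx => (hz0 x hx).ne')
  obtain ⟨hφ, hφc, hφs⟩ := ext0_spec hUo hKc hKU hfc (fun x _ hx => by simp [hf, hζK x hx])
  set φ := ext0 U f with hφd
  have hpφ : ∀ x ∈ U, ∀ k, pd k φ x = 2 * ζ x * pd k ζ x / z x + (ζ x)^2 * pd k w x / (z x)^2 := by
    intro x hx k
    rw [hφd, pd_ext0 hUo hx]
    have d1 : DifferentiableAt ℝ (ζ : EuclideanSpace ℝ (Fin n) → ℝ) x :=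
      (hζd.differentiable one_ne_zero) x
    have d2 : DifferentiableAt ℝ (fun y => (z y)⁻¹) x := (hzd x hx).inv (hz0 x hx).ne'
    have e1 := pd_comp (hasDerivAt_pow 2 (ζ x)) d1 k
    have e2 := pd_comp (hasDerivAt_inv (hz0 x hx).ne') (hzd x hx) k
    rw [hf, pd_mul (f := fun y => (ζ y)^2) (d1.pow 2) d2, e1, e2, hpz x hx k]
    have := (hz0 x hx).ne'
    field_simp
    push_cast
    ring
  have hφ0 : ∀ x, 0 ≤ φ x := fun x => by
    by_cases hx : x ∈ U
    · rw [hφd, ext0_of_mem hx]; have := hz0 x hx; positivity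
    · rw [hφd, ext0_of_notMem hx]
  have hweak := weak_form hDG hφ hφc (hφs.trans hKU) hφ0
  have hφI : κ * ∫ x, φ x ≤ vK := by
    have h1 : ∫ x, κ * φ x ≤ ∫ x, K.indicator (fun _ => (1:ℝ)) x := by
      refine integral_mono ((hφ.continuous.integrable_of_hasCompactSupport hφc).const_mul κ)
        ((integrable_indicator_iff hKc.measurableSet).2 (integrableOn_const hKc.measure_ne_top)) ?_
      intro x
      change κ * φ x ≤ _
      by_cases hx : x ∈ K
      · rw [Set.indicator_of_mem hx, hφd, ext0_of_mem (hKU hx)]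
        have h2 := hzτ x (hKU hx)
        have h3 : (ζ x)^2 ≤ 1 := by nlinarith [ζ.nonneg (x := x), ζ.le_one (x := x)]
        have h4 := hz0 x (hKU hx)
        simp only [hf]
        rw [← mul_assoc, mul_inv_le_iff₀ h4]
        nlinarith
      · rw [Set.indicator_of_notMem hx, image_eq_zero_of_notMem_tsupport fun h => hx (hφs h)]
        simp
    rw [integral_const_mul, integral_indicator hKc.measurableSet] at h1
    simpa [hvK] using h1
  set Q : EuclideanSpace ℝ (Fin n) → ℝ := fun x => ∑ k, V k x * pd k φ x with hQ
  have hQi : Integrable Q :=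
    integrable_finsetSum _ fun k _ => integrable_mul_of_tsupport hUo (hDG.hV k).continuousOn
      (continuous_pd hφ k) (hφc.mono' ((subset_tsupport _).trans (tsupport_pd_subset φ k)))
      ((tsupport_pd_subset φ k).trans (hφs.trans hKU))
  have hpoint : ∀ x ∈ U, lam / 2 * ((ζ x)^2 * ∑ k, (pd k w x / z x)^2) ≤ Q x + C0 := by
    intro x hx
    have hzx := hz0 x hx
    have hk : κ^2 / (z x)^2 ≤ 1 := by
      rw [div_le_one (by positivity)]
      exact pow_le_pow_left₀ hκ0 (hκτ.trans (hzτ x hx)) 2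
    have s1 := hDG.s1 x hx
    have s2 := hDG.s2 x hx
    have eg : ∑ k, (pd k w x / z x)^2 = (∑ k, (pd k w x)^2) / (z x)^2 := by
      rw [Finset.sum_div]; exact Finset.sum_congr rfl fun k _ => by rw [div_pow]
    have ev : ∑ k, (V k x / z x)^2 = (∑ k, (V k x)^2) / (z x)^2 := by
      rw [Finset.sum_div]; exact Finset.sum_congr rfl fun k _ => by rw [div_pow]
    have evg : ∑ k, (V k x / z x) * (pd k w x / z x) = (∑ k, V k x * pd k w x) / (z x)^2 := by
      rw [Finset.sum_div]; exact Finset.sum_congr rfl fun k _ => by rw [div_mul_div_comm, sq]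
    have := log_point n lam Lam D (ζ x) hlam hLam ζ.nonneg ζ.le_one (fun k => V k x / z x)
      (fun k => pd k w x / z x) (fun k => pd k ζ x) (hD x) (by
        rw [eg, evg]
        have : (lam * ∑ k, (pd k w x)^2) / (z x)^2 ≤ ((∑ k, V k x * pd k w x) + κ^2) / (z x)^2 := by
          gcongr
        rw [add_div] at this
        rw [← mul_div_assoc]; linarith) (by
        rw [eg, ev]
        have : (∑ k, (V k x)^2) / (z x)^2 ≤ (Lam * ((∑ k, (pd k w x)^2) + κ^2)) / (z x)^2 := by
          gcongr
        rw [mul_div_assoc, add_div] at this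
        nlinarith)
    refine this.trans (le_of_eq ?_)
    rw [hC0, hQ]
    congr 1
    refine Finset.sum_congr rfl fun k _ => ?_
    rw [hpφ x hx k]
    field_simp
  have hQ0 : ∀ x ∈ U, 0 ≤ Q x + C0 := fun x hx => le_trans (by positivity) (hpoint x hx)
  have hlog : ∀ x ∈ Metric.ball (0 : EuclideanSpace ℝ (Fin n)) (1/2),
      ‖fderiv ℝ (fun x => Real.log (z x)) x‖ ≤ 1 / lam * (Q x + C0) + 1 := by
    intro x hx
    have hxU : x ∈ U := Metric.ball_subset_ball (by norm_num) hx
    have h1 := hpoint x hxU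
    have hz1 : ζ x = 1 := ζ.one_of_mem_closedBall (Metric.ball_subset_closedBall hx)
    rw [hz1, one_pow, one_mul] at h1
    refine (norm_fderiv_le_sqrt _ x).trans ?_
    have e : ∀ k, pd k (fun x => Real.log (z x)) x = - (pd k w x / z x) := fun k => by
      rw [pd_comp (Real.hasDerivAt_log (hz0 x hxU).ne') (hzd x hxU) k, hpz x hxU k]; ring
    simp_rw [e, neg_sq]
    set G := ∑ k, (pd k w x / z x)^2
    have hG0 : 0 ≤ G := Finset.sum_nonneg fun _ _ => sq_nonneg _
    have h8 : Real.sqrt G ≤ (1 + G) / 2 := by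
      have := Real.sq_sqrt hG0
      nlinarith [sq_nonneg (Real.sqrt G - 1)]
    have h9 : G / 2 ≤ 1 / lam * (Q x + C0) := by
      rw [one_div, ← div_eq_inv_mul, le_div_iff₀ hlam]; linarith
    linarith
  have hintg : IntegrableOn (fun x => 1 / lam * (Q x + C0) + 1) K :=
    (((hQi.integrableOn (s := K)).add (integrableOn_const hKc.measure_ne_top)).const_mul _).add
      (integrableOn_const hKc.measure_ne_top)
  calc ∫⁻ x in Metric.ball (0:EuclideanSpace ℝ (Fin n)) (1/2), ‖fderiv ℝ (fun x => Real.log (z x)) x‖ₑ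
      ≤ ∫⁻ x in Metric.ball (0:EuclideanSpace ℝ (Fin n)) (1/2),
          ENNReal.ofReal (1 / lam * (Q x + C0) + 1) := by
        refine setLIntegral_mono' measurableSet_ball fun x hx => ?_
        rw [← ofReal_norm]
        exact ENNReal.ofReal_le_ofReal (hlog x hx)
    _ ≤ ∫⁻ x in K, ENNReal.ofReal (1 / lam * (Q x + C0) + 1) :=
        lintegral_mono_set (Metric.ball_subset_closedBall.trans
          (Metric.closedBall_subset_closedBall (by norm_num)))
    _ = ENNReal.ofReal (∫ x in K, (1 / lam * (Q x + C0) + 1)) := by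
        rw [ofReal_integral_eq_lintegral_ofReal hintg]
        refine (ae_restrict_mem hKc.measurableSet).mono fun x hx => ?_
        have := hQ0 x (hKU hx)
        change 0 ≤ 1 / lam * (Q x + C0) + 1
        positivity
    _ ≤ _ := by
        apply ENNReal.ofReal_le_ofReal
        have hQK : ∫ x in K, Q x = ∫ x, Q x := by
          refine setIntegral_eq_integral_of_forall_compl_eq_zero fun x hx => ?_
          refine Finset.sum_eq_zero fun k _ => ?_
          rw [image_eq_zero_of_notMem_tsupport fun h => hx (hφs (tsupport_pd_subset φ k h)), mul_zero]
        have i1 := hQi.integrableOn (s := K)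
        have ic : ∀ c : ℝ, IntegrableOn (fun _ : EuclideanSpace ℝ (Fin n) => c) K :=
          fun c => integrableOn_const hKc.measure_ne_top
        rw [integral_add (f := fun x => 1 / lam * (Q x + C0)) ((i1.add (ic C0)).const_mul _) (ic 1), integral_const_mul,
          integral_add i1 (ic C0), hQK, setIntegral_const, setIntegral_const]
        simp only [smul_eq_mul, mul_one]
        rw [← hvK]
        have : 1 / lam * (∫ x, Q x) ≤ 1 / lam * vK := by
          gcongr; exact hweak.trans hφI
        nlinarith

lemma DG_scale {n : ℕ} {x0 y : EuclideanSpace ℝ (Fin n)} {r r' lam Lam κ τ m : ℝ} (hτ : 0 < τ)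
    {w : EuclideanSpace ℝ (Fin n) → ℝ} {V : Fin n → EuclideanSpace ℝ (Fin n) → ℝ}
    (hsub : Metric.ball y r' ⊆ Metric.ball x0 r) (h : DG n x0 r lam Lam κ w V) :
    DG n y r' lam Lam (κ / τ) (fun x => τ⁻¹ * (w x - m)) (fun k x => τ⁻¹ * V k x) := by
  have hd : ∀ x ∈ Metric.ball y r', DifferentiableAt ℝ w x := fun x hx =>
    (h.hw.differentiableOn one_ne_zero).differentiableAt (Metric.isOpen_ball.mem_nhds (hsub hx))
  have hdV : ∀ k, ∀ x ∈ Metric.ball y r', DifferentiableAt ℝ (V k) x := fun k x hx =>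
    ((h.hV k).differentiableOn one_ne_zero).differentiableAt (Metric.isOpen_ball.mem_nhds (hsub hx))
  have e : ∀ x ∈ Metric.ball y r', ∀ k, pd k (fun x => τ⁻¹ * (w x - m)) x = τ⁻¹ * pd k w x := by
    intro x hx k
    rw [pd_const_mul _ ((hd x hx).sub_const m), pd_sub (hd x hx) (differentiableAt_const m), pd_const,
      sub_zero]
  have eg : ∀ x ∈ Metric.ball y r', ∑ k, (pd k (fun x => τ⁻¹ * (w x - m)) x)^2
      = τ⁻¹^2 * ∑ k, (pd k w x)^2 := by
    intro x hx
    rw [Finset.mul_sum]; exact Finset.sum_congr rfl fun k _ => by rw [e x hx k, mul_pow]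
  refine ⟨contDiffOn_const.mul ((h.hw.mono hsub).sub contDiffOn_const),
    fun k => contDiffOn_const.mul ((h.hV k).mono hsub), ?_, ?_, ?_⟩
  · intro x hx
    have s := h.s1 x (hsub hx)
    rw [eg x hx]
    have : ∑ k, τ⁻¹ * V k x * pd k (fun x => τ⁻¹ * (w x - m)) x = τ⁻¹^2 * ∑ k, V k x * pd k w x := by
      rw [Finset.mul_sum]; exact Finset.sum_congr rfl fun k _ => by rw [e x hx k]; ring
    rw [this, div_eq_inv_mul, mul_pow]
    have h2 : 0 ≤ τ⁻¹^2 := by positivity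
    nlinarith
  · intro x hx
    have s := h.s2 x (hsub hx)
    rw [eg x hx]
    have : ∑ k, (τ⁻¹ * V k x)^2 = τ⁻¹^2 * ∑ k, (V k x)^2 := by
      rw [Finset.mul_sum]; exact Finset.sum_congr rfl fun k _ => by ring
    rw [this, div_eq_inv_mul, mul_pow]
    have h2 : 0 ≤ τ⁻¹^2 := by positivity
    nlinarith
  · intro x hx
    have s := h.s3 x (hsub hx)
    have : ∑ k, pd k (fun x => τ⁻¹ * V k x) x = τ⁻¹ * ∑ k, pd k (V k) x := by
      rw [Finset.mul_sum]; exact Finset.sum_congr rfl fun k _ => pd_const_mul _ (hdV k x hx) k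
    rw [this, div_eq_inv_mul]
    have h2 : 0 ≤ τ⁻¹ := by positivity
    nlinarith

lemma ML (n : ℕ) (hn : 2 ≤ n) (lam Lam ε η : ℝ) (hlam : 0 < lam) (hLam : 0 < Lam)
    (hε : 0 < ε) (hη : 0 < η) :
    ∃ δ : ℝ, 0 < δ ∧ ∀ (w : EuclideanSpace ℝ (Fin n) → ℝ)
      (V : Fin n → EuclideanSpace ℝ (Fin n) → ℝ) (κ S : ℝ), DG n 0 1 lam Lam κ w V →
      0 ≤ κ → κ ≤ δ → (∀ x ∈ Metric.ball 0 1, w x ≤ S) →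
      ∀ y ∈ Metric.ball (0:EuclideanSpace ℝ (Fin n)) (1/4), S - δ ≤ w y →
      volume.real {x | x ∈ Metric.ball (0:EuclideanSpace ℝ (Fin n)) (1/2) ∧ w x ≤ S - ε} ≤ η := by
  obtain ⟨θ, hθ, hFL⟩ := FL n hn lam Lam hlam hLam
  obtain ⟨C, hC, hlog⟩ := log_est n lam Lam hlam hLam
  set vB := volume.real (Metric.ball (0:EuclideanSpace ℝ (Fin n)) (1/2)) with hvB
  have hvB0 : 0 ≤ vB := measureReal_nonneg
  set l : ℝ := 2^n * (vB + 1) * C / (θ * η) with hl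
  have hl0 : 0 < l := by positivity
  set τ : ℝ := ε * Real.exp (-l) / 2 with hτ
  have hτ0 : 0 < τ := by positivity
  refine ⟨τ / 3, by positivity, fun w V κ S hDG hκ0 hκ hw y hy hwy => ?_⟩
  by_contra hcon
  rw [not_le] at hcon
  set U := Metric.ball (0 : EuclideanSpace ℝ (Fin n)) (1/2) with hU
  have hUo : IsOpen U := Metric.isOpen_ball
  have hU1 : U ⊆ Metric.ball 0 1 := Metric.ball_subset_ball (by norm_num)
  have hwc : ContinuousOn w U := hDG.hw.continuousOn.mono hU1
  set Z := {x | x ∈ U ∧ w x ≤ S - ε} with hZ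
  set X := {x | x ∈ U ∧ S - τ < w x} with hX
  have hXm : IsOpen X := hwc.isOpen_inter_preimage hUo isOpen_Ioi
  have hZm : MeasurableSet Z := by
    have : Z = U \ {x | x ∈ U ∧ S - ε < w x} := by
      ext x
      constructor
      · rintro ⟨h1, h2⟩; exact ⟨h1, fun h => absurd h.2 (not_lt.2 h2)⟩
      · rintro ⟨h1, h2⟩; exact ⟨h1, not_lt.1 fun h => h2 ⟨h1, h⟩⟩
    rw [this]
    exact hUo.measurableSet.diff (hwc.isOpen_inter_preimage hUo (isOpen_Ioi (a := S - ε))).measurableSet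
  have hXU : X ⊆ U := fun x hx => hx.1
  have hZU : Z ⊆ U := fun x hx => hx.1
  have hXf : volume X ≠ ⊤ := ((measure_mono hXU).trans_lt measure_ball_lt_top).ne
  have hZf : volume Z ≠ ⊤ := ((measure_mono hZU).trans_lt measure_ball_lt_top).ne
  have hzpos : ∀ x ∈ U, 0 < S - w x + τ := fun x hx => by have := hw x (hU1 hx); linarith
  have hL := hlog w V κ τ S hDG hκ0 (by linarith) hτ0 hw
  have hP := poinc (fun x => Real.log (S - w x + τ))
    (ContDiffOn.log (((contDiffOn_const.sub (hDG.hw.mono hU1)).add contDiffOn_const))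
      fun x hx => (hzpos x hx).ne') X Z hXm.measurableSet hZm hXU hZU l (by
      intro x hx z hz
      have h1 : S - w x + τ ≤ ε * Real.exp (-l) := by have := hx.2; linarith
      have h2 : ε ≤ S - w z + τ := by have := hz.2; linarith
      have h3 := Real.log_le_log (hzpos x hx.1) h1
      have h4 := Real.log_le_log hε h2
      rw [Real.log_mul hε.ne' (Real.exp_pos _).ne', Real.log_exp] at h3
      linarith)
  have hXv : volume.real X ≤ θ := by
    have h1 : ENNReal.ofReal l * volume X * volume Z ≤ 2 ^ n * volume U * ENNReal.ofReal C :=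
      hP.trans (by gcongr)
    have h2 := ENNReal.toReal_mono (by finiteness) h1
    rw [ENNReal.toReal_mul, ENNReal.toReal_mul, ENNReal.toReal_mul, ENNReal.toReal_mul,
      ENNReal.toReal_ofReal hl0.le, ENNReal.toReal_ofReal hC.le] at h2
    simp only [ENNReal.toReal_pow, ENNReal.toReal_ofNat] at h2
    change l * volume.real X * volume.real Z ≤ 2^n * vB * C at h2
    by_contra hθX
    rw [not_le] at hθX
    have h3 : l * θ * η ≤ l * volume.real X * volume.real Z := by gcongr
    have h4 : l * θ * η = 2^n * (vB + 1) * C := by rw [hl]; field_simp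
    have h5 : (0:ℝ) < 2^n * C := by positivity
    nlinarith
  have hsub : Metric.ball y (1/4) ⊆ U := fun x hx => by
    rw [hU, Metric.mem_ball]
    have := dist_triangle x y 0
    rw [Metric.mem_ball] at hx hy
    linarith
  have hDG' := DG_scale (m := S - τ) hτ0 (hsub.trans hU1) hDG
  have := hFL y _ _ _ hDG' (by positivity) (by rw [div_le_one hτ0]; linarith) (by
    intro x hx
    have := hw x (hU1 (hsub hx))
    rw [inv_mul_le_iff₀ hτ0]; linarith) (by
    refine (measureReal_mono (fun x hx => ?_) hXf).trans hXv
    have h2 : 0 < τ⁻¹ * (w x - (S - τ)) := hx.2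
    have := pos_of_mul_pos_right h2 (by positivity)
    exact ⟨hsub hx.1, by linarith⟩)
  rw [inv_mul_le_iff₀ hτ0] at this
  linarith
end PartB5

section PartC1
open Filter Topology MeasureTheory Matrix
open scoped ContDiff

section
variable {n : ℕ}
local notation "E" => EuclideanSpace ℝ (Fin n)

lemma pd_pd_eq {f : E → ℝ} (hf : ContDiff ℝ ∞ f) (i j : Fin n) (x : E) :
    pd i (pd j f) x = fderiv ℝ (fderiv ℝ f) x (EuclideanSpace.single i 1) (EuclideanSpace.single j 1) := by
  have h1 : DifferentiableAt ℝ (fderiv ℝ f) x :=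
    ((hf.fderiv_right (m := 1) (by norm_cast)).differentiable one_ne_zero) x
  have h2 := h1.hasFDerivAt.clm_apply (hasFDerivAt_const (EuclideanSpace.single j (1:ℝ)) x)
  have := pd_eq_of_hasFDerivAt h2 i
  change pd i (fun y => fderiv ℝ f y (EuclideanSpace.single j 1)) x = _
  rw [this]
  simp

lemma contDiff_pd {f : E → ℝ} (hf : ContDiff ℝ ∞ f) (i : Fin n) : ContDiff ℝ ∞ (pd i f) :=
  (hf.fderiv_right (m := ∞) (by norm_cast)).clm_apply contDiff_const

lemma pd_comm {f : E → ℝ} (hf : ContDiff ℝ ∞ f) (i j : Fin n) : pd i (pd j f) = pd j (pd i f) := by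
  ext x
  rw [pd_pd_eq hf, pd_pd_eq hf]
  exact (hf.contDiffAt.isSymmSndFDerivAt (by
    rw [minSmoothness_of_isRCLikeNormedField]; exact WithTop.coe_le_coe.2 le_top)) _ _

/-- `f` is differentiable at `x` with partial derivatives `g` -/
def HasPd (f : E → ℝ) (g : Fin n → ℝ) (x : E) : Prop := DifferentiableAt ℝ f x ∧ ∀ l, pd l f x = g l

lemma HasPd.congr {f : E → ℝ} {g g' : Fin n → ℝ} {x : E} (h : HasPd f g x) (e : ∀ l, g l = g' l) :
    HasPd f g' x := ⟨h.1, fun l => (h.2 l).trans (e l)⟩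

lemma HasPd.add {f1 f2 : E → ℝ} {g1 g2 : Fin n → ℝ} {x : E} (h1 : HasPd f1 g1 x) (h2 : HasPd f2 g2 x) :
    HasPd (fun y => f1 y + f2 y) (fun l => g1 l + g2 l) x :=
  ⟨h1.1.add h2.1, fun l => by rw [pd_add h1.1 h2.1, h1.2, h2.2]⟩

lemma HasPd.mul {f1 f2 : E → ℝ} {g1 g2 : Fin n → ℝ} {x : E} (h1 : HasPd f1 g1 x) (h2 : HasPd f2 g2 x) :
    HasPd (fun y => f1 y * f2 y) (fun l => g1 l * f2 x + f1 x * g2 l) x :=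
  ⟨h1.1.mul h2.1, fun l => by rw [pd_mul h1.1 h2.1, h1.2, h2.2]⟩

lemma HasPd.const_mul {f : E → ℝ} {g : Fin n → ℝ} {x : E} (c : ℝ) (h1 : HasPd f g x) :
    HasPd (fun y => c * f y) (fun l => c * g l) x :=
  ⟨h1.1.const_mul c, fun l => by rw [pd_const_mul c h1.1, h1.2]⟩

lemma HasPd.neg {f : E → ℝ} {g : Fin n → ℝ} {x : E} (h1 : HasPd f g x) :
    HasPd (fun y => - f y) (fun l => - g l) x := by
  have := h1.const_mul (-1)
  simpa using this

lemma HasPd.sum {ι : Type*} [Fintype ι] {f : ι → E → ℝ} {g : ι → Fin n → ℝ} {x : E}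
    (h : ∀ i, HasPd (f i) (g i) x) : HasPd (fun y => ∑ i, f i y) (fun l => ∑ i, g i l) x := by
  have h1 : HasFDerivAt (fun y => ∑ i, f i y) (∑ i, fderiv ℝ (f i) x) x :=
    HasFDerivAt.fun_sum fun i _ => (h i).1.hasFDerivAt
  refine ⟨h1.differentiableAt, fun l => ?_⟩
  rw [pd_eq_of_hasFDerivAt h1, _root_.sum_apply]
  exact Finset.sum_congr rfl fun i _ => (h i).2 l

lemma hasPd_of_diff {f : E → ℝ} {x : E} (h : DifferentiableAt ℝ f x) : HasPd f (fun l => pd l f x) x :=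
  ⟨h, fun _ => rfl⟩

lemma hasPd_smooth {f : E → ℝ} (h : ContDiff ℝ ∞ f) (x : E) : HasPd f (fun l => pd l f x) x :=
  hasPd_of_diff (h.differentiable (by simp) x)

lemma hasPd_det {M : E → Matrix (Fin n) (Fin n) ℝ} {dM : Fin n → Fin n → Fin n → ℝ} {x : E}
    (h : ∀ i j, HasPd (fun y => M y i j) (fun l => dM l i j) x) :
    HasPd (fun y => (M y).det) (fun l => ∑ r, ∑ s, (M x).adjugate s r * dM l r s) x := by
  have h1 := det_hasFDerivAt (fun i j => (h i j).1.hasFDerivAt)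
  refine ⟨h1.differentiableAt, fun l => ?_⟩
  rw [pd_eq_of_hasFDerivAt h1, _root_.sum_apply]
  refine Finset.sum_congr rfl fun r _ => ?_
  rw [_root_.sum_apply]
  refine Finset.sum_congr rfl fun s _ => ?_
  rw [_root_.smul_apply, smul_eq_mul]
  congr 1
  exact (h r s).2 l

lemma hasPd_adj {M : E → Matrix (Fin n) (Fin n) ℝ} {dM : Fin n → Fin n → Fin n → ℝ} {x : E}
    (h : ∀ i j, HasPd (fun y => M y i j) (fun l => dM l i j) x) (i j : Fin n) :
    HasPd (fun y => (M y).adjugate i j) (fun l => ∑ r, ∑ s, cof2 (M x) i j s r * dM l r s) x := by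
  have h1 := adj_hasFDerivAt (fun i j => (h i j).1.hasFDerivAt) i j
  refine ⟨h1.differentiableAt, fun l => ?_⟩
  rw [pd_eq_of_hasFDerivAt h1, _root_.sum_apply]
  refine Finset.sum_congr rfl fun r _ => ?_
  rw [_root_.sum_apply]
  refine Finset.sum_congr rfl fun s _ => ?_
  rw [_root_.smul_apply, smul_eq_mul]
  congr 1
  exact (h r s).2 l

/-- Hessian matrix through iterated partial derivatives -/
noncomputable def Hm (h : E → ℝ) (x : E) : Matrix (Fin n) (Fin n) ℝ :=
  Matrix.of fun i j => pd i (pd j h) x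

/-- third derivatives -/
noncomputable def T3 (h : E → ℝ) (k i j : Fin n) : E → ℝ := pd k (pd i (pd j h))

lemma T3_symm1 {h : E → ℝ} (hh : ContDiff ℝ ∞ h) (k i j : Fin n) : T3 h k i j = T3 h i k j :=
  pd_comm (contDiff_pd hh j) k i

lemma T3_symm2 {h : E → ℝ} (hh : ContDiff ℝ ∞ h) (k i j : Fin n) : T3 h k i j = T3 h k j i := by
  unfold T3; rw [pd_comm hh i j]

lemma contDiff_T3 {h : E → ℝ} (hh : ContDiff ℝ ∞ h) (k i j : Fin n) : ContDiff ℝ ∞ (T3 h k i j) :=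
  contDiff_pd (contDiff_pd (contDiff_pd hh j) i) k

lemma contDiff_Hm {h : E → ℝ} (hh : ContDiff ℝ ∞ h) (i j : Fin n) : ContDiff ℝ ∞ (fun x => Hm h x i j) :=
  contDiff_pd (contDiff_pd hh j) i

lemma hasPd_Hm {h : E → ℝ} (hh : ContDiff ℝ ∞ h) (i j : Fin n) (x : E) :
    HasPd (fun y => Hm h y i j) (fun l => T3 h l i j x) x := hasPd_smooth (contDiff_Hm hh i j) x

/-- solutions of the equation on a ball, with controlled data -/
structure Sol (n : ℕ) (lam M' K L : ℝ) (x0 : EuclideanSpace ℝ (Fin n)) (r : ℝ)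
    (h : EuclideanSpace ℝ (Fin n) → ℝ) (a : EuclideanSpace ℝ (Fin n) → Matrix (Fin n) (Fin n) ℝ)
    (b : EuclideanSpace ℝ (Fin n) → ℝ) : Prop where
  hh : ContDiff ℝ ∞ h
  ha : ∀ i j, ContDiff ℝ 1 (fun x => a x i j)
  hb : ContDiff ℝ 1 b
  asymm : ∀ x, (a x)ᵀ = a x
  acoe : ∀ x ∈ Metric.ball x0 r, ∀ v : Fin n → ℝ, lam * (v ⬝ᵥ v) ≤ v ⬝ᵥ (a x *ᵥ v)
  abd : ∀ x ∈ Metric.ball x0 r, ∀ i j, |a x i j| ≤ M'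
  b0 : ∀ x ∈ Metric.ball x0 r, 0 ≤ b x
  bbd : ∀ x ∈ Metric.ball x0 r, b x ≤ M'
  da : ∀ x ∈ Metric.ball x0 r, ∀ k i j, |pd k (fun y => a y i j) x| ≤ L
  db : ∀ x ∈ Metric.ball x0 r, ∀ k, |pd k b x| ≤ L
  psd : ∀ x ∈ Metric.ball x0 r, (Hm h x).PosSemidef
  hbd : ∀ x ∈ Metric.ball x0 r, ∀ i j, |Hm h x i j| ≤ K
  eqn : ∀ x ∈ Metric.ball x0 r, (∑ i, ∑ j, a x i j * Hm h x i j) + b x * (Hm h x).det = 1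

noncomputable def Bm (h : E → ℝ) (c : ℝ) (x : E) : Matrix (Fin n) (Fin n) ℝ :=
  (Hm h x + c • (1 : Matrix (Fin n) (Fin n) ℝ))⁻¹

noncomputable def et (h : E → ℝ) (c : ℝ) (ξ : Fin n → ℝ) (p : Fin n) (x : E) : ℝ :=
  ∑ q, Bm h c x p q * ξ q

noncomputable def Xm (h : E → ℝ) (c : ℝ) (ξ : Fin n → ℝ) (x : E) : Matrix (Fin n) (Fin n) ℝ :=
  Matrix.of fun k q => ∑ p, et h c ξ p x * T3 h k p q x

noncomputable def wf (h : E → ℝ) (c : ℝ) (ξ : Fin n → ℝ) (x : E) : ℝ := ∑ p, ξ p * et h c ξ p x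

noncomputable def Fm (h : E → ℝ) (a : E → Matrix (Fin n) (Fin n) ℝ) (b : E → ℝ) (x : E) :
    Matrix (Fin n) (Fin n) ℝ := a x + b x • (Hm h x).adjugate

noncomputable def Vf (h : E → ℝ) (a : E → Matrix (Fin n) (Fin n) ℝ) (b : E → ℝ) (c : ℝ)
    (ξ : Fin n → ℝ) (l : Fin n) (x : E) : ℝ :=
  (∑ k, Fm h a b x k l * (-(∑ q, Xm h c ξ x k q * et h c ξ q x))) +
    (∑ k, ∑ q, Fm h a b x k q * Xm h c ξ x k q) * et h c ξ l x

lemma Xm_symm {h : E → ℝ} (hh : ContDiff ℝ ∞ h) (c : ℝ) (ξ : Fin n → ℝ) (x : E) :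
    (Xm h c ξ x)ᵀ = Xm h c ξ x := by
  ext k q
  simp only [Matrix.transpose_apply, Xm, Matrix.of_apply]
  refine Finset.sum_congr rfl fun p _ => ?_
  rw [T3_symm2 hh q p k, T3_symm1 hh q k p, T3_symm2 hh k q p]

lemma Hm_symm {h : E → ℝ} (hh : ContDiff ℝ ∞ h) (x : E) : (Hm h x)ᵀ = Hm h x := by
  ext i j
  simp only [Matrix.transpose_apply, Hm, Matrix.of_apply]
  rw [pd_comm hh]

lemma Bm_symm {h : E → ℝ} (hh : ContDiff ℝ ∞ h) (c : ℝ) (x : E) : (Bm h c x)ᵀ = Bm h c x := by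
  rw [Bm, Matrix.transpose_nonsing_inv, Matrix.transpose_add, Hm_symm hh, Matrix.transpose_smul,
    Matrix.transpose_one]

lemma hasPd_Bm {h : E → ℝ} (hh : ContDiff ℝ ∞ h) {c : ℝ} {x : E}
    (hx : ∀ᶠ y in 𝓝 x, (Hm h y + c • (1 : Matrix (Fin n) (Fin n) ℝ)).det ≠ 0) (i j : Fin n) :
    HasPd (fun y => Bm h c y i j)
      (fun l => -(Bm h c x * Matrix.of (fun r s => T3 h l r s x) * Bm h c x) i j) x := by
  set P : E → Matrix (Fin n) (Fin n) ℝ := fun y => Hm h y + c • (1 : Matrix (Fin n) (Fin n) ℝ) with hP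
  have hPs : ∀ i j, HasPd (fun y => P y i j) (fun l => T3 h l i j x) x := fun i j => by
    have h1 : HasPd (fun _ : E => (c • (1 : Matrix (Fin n) (Fin n) ℝ)) i j) (fun _ => 0) x :=
      ⟨differentiableAt_const _, fun l => pd_const _ _ _⟩
    have := (hasPd_Hm hh i j x).add h1
    simp only [add_zero] at this
    exact this
  have hdiff : ∀ i j, DifferentiableAt ℝ (fun y => Bm h c y i j) x := by
    intro i j
    have : (fun y => Bm h c y i j) = fun y => (P y).det⁻¹ * (P y).adjugate i j := by
      ext y; exact inv_entry _ i j
    rw [this]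
    exact ((hasPd_det hPs).1.inv hx.self_of_nhds).mul (hasPd_adj hPs i j).1
  have hu : IsUnit (P x).det := isUnit_iff_ne_zero.2 hx.self_of_nhds
  refine ⟨hdiff i j, fun l => ?_⟩
  set dB : Matrix (Fin n) (Fin n) ℝ := Matrix.of fun i j => pd l (fun y => Bm h c y i j) x with hdB
  set TT : Matrix (Fin n) (Fin n) ℝ := Matrix.of (fun r s => T3 h l r s x) with hTT
  have key : TT * Bm h c x + P x * dB = 0 := by
    ext r s
    have h1 := HasPd.sum (fun q => (hPs r q).mul (hasPd_of_diff (hdiff q s)))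
    have h2 : (fun y => ∑ q, P y r q * Bm h c y q s) =ᶠ[𝓝 x]
        fun _ => (1 : Matrix (Fin n) (Fin n) ℝ) r s := by
      filter_upwards [hx] with y hy
      rw [← Matrix.mul_apply]
      rw [Bm, Matrix.mul_nonsing_inv _ (isUnit_iff_ne_zero.2 hy)]
    have h3 := h1.2 l
    rw [pd, h2.fderiv_eq] at h3
    simp only [fderiv_fun_const, Pi.zero_apply, _root_.zero_apply] at h3
    rw [Matrix.add_apply, Matrix.mul_apply, Matrix.mul_apply, ← Finset.sum_add_distrib]
    exact h3.symm
  have h4 : dB = -(Bm h c x * TT * Bm h c x) := by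
    have h5 : Bm h c x * (TT * Bm h c x + P x * dB) = 0 := by rw [key, Matrix.mul_zero]
    rw [Matrix.mul_add, ← Matrix.mul_assoc, ← Matrix.mul_assoc,
      show Bm h c x * P x = 1 from Matrix.nonsing_inv_mul _ hu, Matrix.one_mul] at h5
    exact eq_neg_of_add_eq_zero_right h5
  have h6 := congrFun (congrFun h4 i) j
  rw [hdB, Matrix.of_apply, Matrix.neg_apply] at h6
  exact h6

lemma hasPd_et {h : E → ℝ} (hh : ContDiff ℝ ∞ h) {c : ℝ} {x : E} (ξ : Fin n → ℝ)
    (hx : ∀ᶠ y in 𝓝 x, (Hm h y + c • (1 : Matrix (Fin n) (Fin n) ℝ)).det ≠ 0) (p : Fin n) :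
    HasPd (et h c ξ p) (fun l => -(Xm h c ξ x * Bm h c x) l p) x := by
  have h1 := HasPd.sum (fun q => (hasPd_Bm hh hx p q).mul
    (⟨differentiableAt_const _, fun l => pd_const _ _ _⟩ : HasPd (fun _ : E => ξ q) (fun _ => 0) x))
  refine HasPd.congr (f := et h c ξ p) h1 fun l => ?_
  simp only [mul_zero, add_zero]
  have e : ∑ q, -(Bm h c x * Matrix.of (fun r s => T3 h l r s x) * Bm h c x) p q * ξ q
    = -((Bm h c x * Matrix.of (fun r s => T3 h l r s x) * Bm h c x) *ᵥ ξ) p := by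
    simp [Matrix.mulVec, dotProduct]
  rw [e, Matrix.mul_assoc, ← Matrix.mulVec_mulVec, ← Matrix.mulVec_mulVec]
  congr 1
  rw [Matrix.mul_apply, Matrix.mulVec, dotProduct]
  refine Finset.sum_congr rfl fun q _ => ?_
  rw [mul_comm]
  congr 1
  · simp only [Matrix.mulVec, dotProduct, Matrix.of_apply, Xm, et]
    refine Finset.sum_congr rfl fun r _ => ?_
    rw [mul_comm, T3_symm2 hh l q r]
  · have := congrFun (congrFun (Bm_symm hh c x) q) p
    rw [Matrix.transpose_apply] at this
    exact this

lemma hasPd_wf {h : E → ℝ} (hh : ContDiff ℝ ∞ h) {c : ℝ} {x : E} (ξ : Fin n → ℝ)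
    (hx : ∀ᶠ y in 𝓝 x, (Hm h y + c • (1 : Matrix (Fin n) (Fin n) ℝ)).det ≠ 0) :
    HasPd (wf h c ξ) (fun k => -(∑ q, Xm h c ξ x k q * et h c ξ q x)) x := by
  have h1 := HasPd.sum (fun p => (hasPd_et hh ξ hx p).const_mul (ξ p))
  refine HasPd.congr (f := wf h c ξ) h1 fun k => ?_
  have : ∑ i, ξ i * -(Xm h c ξ x * Bm h c x) k i = -((Xm h c ξ x * Bm h c x) *ᵥ ξ) k := by
    simp [Matrix.mulVec, dotProduct, mul_comm]
  rw [this, ← Matrix.mulVec_mulVec]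
  rfl

end
end PartC1

section PartC2
open Filter Topology MeasureTheory Matrix
open scoped ContDiff

section
variable {n : ℕ}
local notation "E" => EuclideanSpace ℝ (Fin n)

/-- derivative of `Fm` -/
noncomputable def dF (h : E → ℝ) (a : E → Matrix (Fin n) (Fin n) ℝ) (b : E → ℝ) (x : E)
    (l k q : Fin n) : ℝ :=
  pd l (fun y => a y k q) x + (pd l b x * (Hm h x).adjugate k q +
    b x * ∑ r, ∑ s, cof2 (Hm h x) k q s r * T3 h l r s x)

lemma hasPd_Fm {h : E → ℝ} (hh : ContDiff ℝ ∞ h) {a : E → Matrix (Fin n) (Fin n) ℝ} {b : E → ℝ}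
    (ha : ∀ i j, ContDiff ℝ 1 (fun x => a x i j)) (hb : ContDiff ℝ 1 b) (x : E) (k q : Fin n) :
    HasPd (fun y => Fm h a b y k q) (fun l => dF h a b x l k q) x := by
  have h1 := (hasPd_of_diff ((ha k q).differentiable one_ne_zero x)).add
    ((hasPd_of_diff (hb.differentiable one_ne_zero x)).mul (hasPd_adj (fun i j => hasPd_Hm hh i j x) k q))
  exact h1

/-- the part of the derivative of `Xm` which carries fourth derivatives -/
noncomputable def R4 (h : E → ℝ) (c : ℝ) (ξ : Fin n → ℝ) (x : E) (l k q : Fin n) : ℝ :=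
  ∑ p, et h c ξ p x * pd l (T3 h k p q) x

lemma R4_symm {h : E → ℝ} (hh : ContDiff ℝ ∞ h) (c : ℝ) (ξ : Fin n → ℝ) (x : E) (l k q : Fin n) :
    R4 h c ξ x l k q = R4 h c ξ x q k l := by
  refine Finset.sum_congr rfl fun p _ => ?_
  congr 1
  rw [T3_symm2 hh k p q, T3_symm1 hh k q p, T3_symm2 hh k p l, T3_symm1 hh k l p]
  unfold T3
  rw [pd_comm (contDiff_pd (contDiff_pd hh p) k) l q]

lemma hasPd_Xm {h : E → ℝ} (hh : ContDiff ℝ ∞ h) {c : ℝ} {x : E} (ξ : Fin n → ℝ)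
    (hx : ∀ᶠ y in 𝓝 x, (Hm h y + c • (1 : Matrix (Fin n) (Fin n) ℝ)).det ≠ 0) (k q : Fin n) :
    HasPd (fun y => Xm h c ξ y k q)
      (fun l => (∑ p, -(Xm h c ξ x * Bm h c x) l p * T3 h k p q x) + R4 h c ξ x l k q) x := by
  have h1 := HasPd.sum (fun p => (hasPd_et hh ξ hx p).mul (hasPd_smooth (contDiff_T3 hh k p q) x))
  refine HasPd.congr (f := fun y => Xm h c ξ y k q) h1 fun l => ?_
  rw [Finset.sum_add_distrib]; rfl

/-- purely algebraic identity behind the divergence computation -/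
lemma div_alg (F X B : Matrix (Fin n) (Fin n) ℝ) (T R dF : Fin n → Fin n → Fin n → ℝ) (η : Fin n → ℝ)
    (hX : ∀ k q, X k q = ∑ p, η p * T k p q) (hT : ∀ k p q, T k p q = T k q p)
    (hXs : Xᵀ = X) (hR : ∀ l k q, R l k q = R q k l) :
    (∑ l, ((∑ k, (dF l k l * (-(∑ q, X k q * η q)) + F k l *
        (-(∑ q, (((∑ p, -(X * B) l p * T k p q) + R l k q) * η q + X k q * -(X * B) l q)))))
      + ((∑ k, ∑ q, (dF l k q * X k q + F k q * ((∑ p, -(X * B) l p * T k p q) + R l k q))) * η l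
        + (∑ k, ∑ q, F k q * X k q) * -(X * B) l l)))
    = 2 * (F * (X * B * X)).trace + (∑ k, ∑ q, (∑ l, dF l k q * η l) * X k q)
      - (∑ k, (∑ l, dF l k l) * ∑ q, X k q * η q)
      - (∑ p, (∑ l, (X * B) l p * η l) * ∑ k, ∑ q, F k q * T k p q)
      - (∑ k, ∑ q, F k q * X k q) * (X * B).trace := by
  set Y := X * B with hY
  have hXk : ∀ k p, ∑ q, T k p q * η q = X k p := fun k p => by
    rw [hX]; exact Finset.sum_congr rfl fun q _ => by rw [hT k p q, mul_comm]
  have htr : (F * (Y * X)).trace = ∑ l, ∑ k, F k l * ∑ q, X k q * Y l q := by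
    rw [Matrix.trace]
    simp only [Matrix.diag_apply, Matrix.mul_apply]
    rw [Finset.sum_comm]
    refine Finset.sum_congr rfl fun l _ => Finset.sum_congr rfl fun k _ => ?_
    congr 1
    refine Finset.sum_congr rfl fun q _ => ?_
    have : X q k = X k q := congrFun (congrFun hXs k) q
    rw [this, mul_comm]
  have e1 : ∑ l, ∑ k, F k l * (-(∑ q, (((∑ p, -Y l p * T k p q) + R l k q) * η q + X k q * -Y l q)))
      = 2 * (F * (Y * X)).trace - ∑ l, ∑ k, ∑ q, F k l * (R l k q * η q) := by
    rw [htr, Finset.mul_sum, ← Finset.sum_sub_distrib]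
    refine Finset.sum_congr rfl fun l _ => ?_
    rw [Finset.mul_sum, ← Finset.sum_sub_distrib]
    refine Finset.sum_congr rfl fun k _ => ?_
    have h1 : ∑ q, (∑ p, -Y l p * T k p q) * η q = -∑ q, X k q * Y l q := by
      simp_rw [Finset.sum_mul]
      rw [Finset.sum_comm, ← Finset.sum_neg_distrib]
      refine Finset.sum_congr rfl fun p _ => ?_
      rw [← hXk k p, Finset.sum_mul, ← Finset.sum_neg_distrib]
      exact Finset.sum_congr rfl fun q _ => by ring
    simp only [add_mul, Finset.sum_add_distrib, h1, mul_neg, Finset.sum_neg_distrib]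
    rw [← Finset.mul_sum]
    ring
  have e2 : ∑ l, (∑ k, ∑ q, F k q * ((∑ p, -Y l p * T k p q) + R l k q)) * η l
      = -(∑ p, (∑ l, Y l p * η l) * ∑ k, ∑ q, F k q * T k p q) + ∑ l, ∑ k, ∑ q, F k l * (R l k q * η q) := by
    have h1 : ∑ l, ∑ k, ∑ q, F k l * (R l k q * η q) = ∑ l, ∑ k, ∑ q, F k q * (R l k q * η l) := by
      rw [Finset.sum_comm]
      conv_rhs => rw [Finset.sum_comm]
      refine Finset.sum_congr rfl fun k _ => ?_
      rw [Finset.sum_comm]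
      exact Finset.sum_congr rfl fun q _ => Finset.sum_congr rfl fun l _ => by rw [hR l k q]
    have h2 : ∀ p, (∑ l, Y l p * η l) * ∑ k, ∑ q, F k q * T k p q
        = ∑ l, ∑ k, ∑ q, Y l p * η l * (F k q * T k p q) := fun p => by
      rw [Finset.sum_mul]; refine Finset.sum_congr rfl fun l _ => ?_
      rw [Finset.mul_sum]; refine Finset.sum_congr rfl fun k _ => ?_
      rw [Finset.mul_sum]
    rw [h1]
    simp_rw [h2]
    have h3 : ∑ p, ∑ l, ∑ k, ∑ q, Y l p * η l * (F k q * T k p q)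
        = ∑ l, ∑ k, ∑ q, ∑ p, Y l p * η l * (F k q * T k p q) := by
      rw [Finset.sum_comm]
      refine Finset.sum_congr rfl fun l _ => ?_
      rw [Finset.sum_comm]
      refine Finset.sum_congr rfl fun k _ => ?_
      rw [Finset.sum_comm]
    rw [h3, ← Finset.sum_neg_distrib, ← Finset.sum_add_distrib]
    refine Finset.sum_congr rfl fun l _ => ?_
    rw [← Finset.sum_neg_distrib, ← Finset.sum_add_distrib, Finset.sum_mul]
    refine Finset.sum_congr rfl fun k _ => ?_
    rw [← Finset.sum_neg_distrib, ← Finset.sum_add_distrib, Finset.sum_mul]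
    refine Finset.sum_congr rfl fun q _ => ?_
    rw [mul_add, add_mul, Finset.mul_sum, Finset.sum_mul, ← Finset.sum_neg_distrib]
    congr 1
    · exact Finset.sum_congr rfl fun p _ => by ring
    · ring
  have e3 : ∑ l, ∑ k, dF l k l * (-(∑ q, X k q * η q)) = -(∑ k, (∑ l, dF l k l) * ∑ q, X k q * η q) := by
    rw [Finset.sum_comm, ← Finset.sum_neg_distrib]
    refine Finset.sum_congr rfl fun k _ => ?_
    rw [← Finset.sum_mul]; ring
  have e4 : ∑ l, (∑ k, ∑ q, dF l k q * X k q) * η l = ∑ k, ∑ q, (∑ l, dF l k q * η l) * X k q := by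
    simp_rw [Finset.sum_mul]
    rw [Finset.sum_comm]
    refine Finset.sum_congr rfl fun k _ => ?_
    rw [Finset.sum_comm]
    exact Finset.sum_congr rfl fun q _ => Finset.sum_congr rfl fun l _ => by ring
  have e5 : ∑ l, (∑ k, ∑ q, F k q * X k q) * -Y l l = -((∑ k, ∑ q, F k q * X k q) * Y.trace) := by
    rw [← Finset.mul_sum, Finset.sum_neg_distrib, Matrix.trace]
    simp
  have e6 : ∀ l, (∑ k, ∑ q, (dF l k q * X k q + F k q * ((∑ p, -Y l p * T k p q) + R l k q))) * η l
      = (∑ k, ∑ q, dF l k q * X k q) * η l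
        + (∑ k, ∑ q, F k q * ((∑ p, -Y l p * T k p q) + R l k q)) * η l := fun l => by
    rw [← add_mul]; congr 1
    simp_rw [Finset.sum_add_distrib]
  simp_rw [e6]
  simp only [Finset.sum_add_distrib (ι := Fin n) (s := Finset.univ) (f := fun l => ∑ k, (dF l k l * (-(∑ q, X k q * η q)) + F k l *
        (-(∑ q, (((∑ p, -Y l p * T k p q) + R l k q) * η q + X k q * -Y l q)))))]
  have e7 : ∑ l, ∑ k, (dF l k l * (-(∑ q, X k q * η q)) + F k l *
        (-(∑ q, (((∑ p, -Y l p * T k p q) + R l k q) * η q + X k q * -Y l q))))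
      = ∑ l, ∑ k, dF l k l * (-(∑ q, X k q * η q)) + ∑ l, ∑ k, F k l *
        (-(∑ q, (((∑ p, -Y l p * T k p q) + R l k q) * η q + X k q * -Y l q))) := by
    simp_rw [← Finset.sum_add_distrib]
  rw [e7, Finset.sum_add_distrib, Finset.sum_add_distrib, e1, e2, e3, e4, e5]
  ring

lemma div_Vf {h : E → ℝ} (hh : ContDiff ℝ ∞ h) {a : E → Matrix (Fin n) (Fin n) ℝ} {b : E → ℝ}
    (ha : ∀ i j, ContDiff ℝ 1 (fun x => a x i j)) (hb : ContDiff ℝ 1 b) {c : ℝ} {x : E} (ξ : Fin n → ℝ)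
    (hx : ∀ᶠ y in 𝓝 x, (Hm h y + c • (1 : Matrix (Fin n) (Fin n) ℝ)).det ≠ 0) :
    ∑ l, pd l (Vf h a b c ξ l) x =
      2 * (Fm h a b x * (Xm h c ξ x * Bm h c x * Xm h c ξ x)).trace
      + (∑ k, ∑ q, (∑ l, dF h a b x l k q * et h c ξ l x) * Xm h c ξ x k q)
      - (∑ k, (∑ l, dF h a b x l k l) * ∑ q, Xm h c ξ x k q * et h c ξ q x)
      - (∑ p, (∑ l, (Xm h c ξ x * Bm h c x) l p * et h c ξ l x) * ∑ k, ∑ q, Fm h a b x k q * T3 h k p q x)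
      - (∑ k, ∑ q, Fm h a b x k q * Xm h c ξ x k q) * (Xm h c ξ x * Bm h c x).trace := by
  rw [← div_alg (Fm h a b x) (Xm h c ξ x) (Bm h c x) (fun k p q => T3 h k p q x) (R4 h c ξ x)
    (dF h a b x) (fun p => et h c ξ p x) (fun k q => rfl) (fun k p q => by rw [T3_symm2 hh])
    (Xm_symm hh c ξ x) (R4_symm hh c ξ x)]
  refine Finset.sum_congr rfl fun l _ => ?_
  have h1 := HasPd.sum (fun k => (hasPd_Fm hh ha hb x k l).mul
    (HasPd.neg (HasPd.sum (fun q => (hasPd_Xm hh ξ hx k q).mul (hasPd_et hh ξ hx q)))))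
  have h2 := (HasPd.sum (fun k => HasPd.sum (fun q => (hasPd_Fm hh ha hb x k q).mul
    (hasPd_Xm hh ξ hx k q)))).mul (hasPd_et hh ξ hx l)
  exact (h1.add h2).2 l

end
end PartC2

section PartC3
open Filter Topology MeasureTheory Matrix
open scoped ContDiff

lemma abs_sum_le' {n : ℕ} (f : Fin n → ℝ) (u : ℝ) (h : ∀ i, |f i| ≤ u) : |∑ i, f i| ≤ n * u := by
  refine (Finset.abs_sum_le_sum_abs _ _).trans ?_
  refine (Finset.sum_le_sum fun i _ => h i).trans ?_
  simp

lemma abs_mul_le' {a b u v : ℝ} (ha : |a| ≤ u) (hb : |b| ≤ v) : |a * b| ≤ u * v := by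
  rw [abs_mul]; exact mul_le_mul ha hb (abs_nonneg _) ((abs_nonneg _).trans ha)

lemma abs_sum_mul_le' {n : ℕ} (f g : Fin n → ℝ) (u v : ℝ) (h : ∀ i, |f i| ≤ u) (h' : ∀ i, |g i| ≤ v) :
    |∑ i, f i * g i| ≤ n * (u * v) :=
  abs_sum_le' _ _ fun i => abs_mul_le' (h i) (h' i)

lemma adj_psd {n : ℕ} {A : Matrix (Fin n) (Fin n) ℝ} (hA : A.PosSemidef) : A.adjugate.PosSemidef := by
  have hs : A.adjugateᵀ = A.adjugate := by rw [Matrix.adjugate_transpose, psd_symm hA]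
  refine Matrix.PosSemidef.of_dotProduct_mulVec_nonneg (by
    rw [Matrix.IsHermitian, Matrix.conjTranspose_eq_transpose_of_trivial, hs]) fun v => ?_
  have hcont : Continuous fun t : ℝ => v ⬝ᵥ ((A + t • (1 : Matrix (Fin n) (Fin n) ℝ)).adjugate *ᵥ v) := by
    have : Continuous fun t : ℝ => (A + t • (1 : Matrix (Fin n) (Fin n) ℝ)).adjugate :=
      Continuous.matrix_adjugate (by fun_prop)
    fun_prop
  have h2 : Tendsto (fun t : ℝ => v ⬝ᵥ ((A + t • (1 : Matrix (Fin n) (Fin n) ℝ)).adjugate *ᵥ v))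
      (𝓝[>] 0) (𝓝 (v ⬝ᵥ (A.adjugate *ᵥ v))) := by
    have := (hcont.tendsto 0).mono_left (nhdsWithin_le_nhds (s := Set.Ioi 0))
    simpa using this
  have : 0 ≤ v ⬝ᵥ (A.adjugate *ᵥ v) := by
    refine ge_of_tendsto h2 ?_
    filter_upwards [self_mem_nhdsWithin] with t ht
    have hP := pd_add_smul_one hA ht
    set P := A + t • (1 : Matrix (Fin n) (Fin n) ℝ)
    have e : P.adjugate = P.det • P⁻¹ := by
      ext i j
      rw [Matrix.smul_apply, inv_entry, smul_eq_mul, ← mul_assoc, mul_inv_cancel₀ hP.det_pos.ne', one_mul]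
    rw [e, Matrix.smul_mulVec, dotProduct_smul, smul_eq_mul]
    exact mul_nonneg hP.det_pos.le (psd_quad hP.inv.posSemidef v)
  simpa using this

lemma inv_bd {n : ℕ} {P : Matrix (Fin n) (Fin n) ℝ} {c : ℝ} (hc : 0 < c) (hP : P.PosDef)
    (h : ∀ v : Fin n → ℝ, c * (v ⬝ᵥ v) ≤ v ⬝ᵥ (P *ᵥ v)) (i j : Fin n) : |P⁻¹ i j| ≤ n / c := by
  refine (psd_entry_le_trace hP.inv.posSemidef i j).trans ?_
  have hd : ∀ i, P⁻¹ i i ≤ 1 / c := by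
    intro i
    set v : Fin n → ℝ := P⁻¹ *ᵥ (Pi.single i 1) with hv
    have hvi : v i = P⁻¹ i i := by rw [hv]; simp
    have hPv : P *ᵥ v = Pi.single i 1 := by
      rw [hv, Matrix.mulVec_mulVec, Matrix.mul_nonsing_inv _ (isUnit_iff_ne_zero.2 hP.det_pos.ne'),
        Matrix.one_mulVec]
    have h1 := h v
    rw [hPv] at h1
    have h2 : v ⬝ᵥ (Pi.single i 1) = P⁻¹ i i := by rw [← hvi]; simp
    rw [h2] at h1
    have h3 : (P⁻¹ i i)^2 ≤ v ⬝ᵥ v := by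
      rw [← hvi, sq, dotProduct]
      exact Finset.single_le_sum (f := fun i => v i * v i) (fun k _ => mul_self_nonneg _) (Finset.mem_univ i)
    rw [le_div_iff₀ hc]
    by_contra hcon
    push Not at hcon
    have hB : 0 < P⁻¹ i i := by
      by_contra h0
      push Not at h0
      nlinarith
    have h4 := mul_le_mul_of_nonneg_left h3 hc.le
    nlinarith [mul_lt_mul_of_pos_right hcon hB]
  rw [Matrix.trace]
  refine (Finset.sum_le_sum fun i _ => hd i).trans (le_of_eq ?_)
  simp; ring

section
variable {n : ℕ}
local notation "E" => EuclideanSpace ℝ (Fin n)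

variable {lam M' K L : ℝ} {x0 : EuclideanSpace ℝ (Fin n)} {r : ℝ} {h : EuclideanSpace ℝ (Fin n) → ℝ}
  {a : EuclideanSpace ℝ (Fin n) → Matrix (Fin n) (Fin n) ℝ} {b : EuclideanSpace ℝ (Fin n) → ℝ}

lemma Fm_symm (hh : ContDiff ℝ ∞ h) (asymm : ∀ x, (a x)ᵀ = a x) (x : E) :
    (Fm h a b x)ᵀ = Fm h a b x := by
  rw [Fm, Matrix.transpose_add, asymm, Matrix.transpose_smul, Matrix.adjugate_transpose, Hm_symm hh]

lemma dF_symm (S : Sol n lam M' K L x0 r h a b) (x : E) (l k q : Fin n) :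
    dF h a b x l k q = dF h a b x l q k := by
  refine ((hasPd_Fm S.hh S.ha S.hb x k q).2 l).symm.trans (Eq.trans ?_ ((hasPd_Fm S.hh S.ha S.hb x q k).2 l))
  congr 1
  ext y
  exact congrFun (congrFun (Fm_symm S.hh S.asymm y) q) k

lemma Sol.det_ne (S : Sol n lam M' K L x0 r h a b) {c : ℝ} (hc : 0 < c) {x : E}
    (hx : x ∈ Metric.ball x0 r) :
    ∀ᶠ y in 𝓝 x, (Hm h y + c • (1 : Matrix (Fin n) (Fin n) ℝ)).det ≠ 0 := by
  filter_upwards [Metric.isOpen_ball.mem_nhds hx] with y hy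
  exact (pd_add_smul_one (S.psd y hy) hc).det_pos.ne'

lemma psd_add_quad {A : Matrix (Fin n) (Fin n) ℝ} (hA : A.PosSemidef) (c : ℝ) (v : Fin n → ℝ) :
    c * (v ⬝ᵥ v) ≤ v ⬝ᵥ ((A + c • (1 : Matrix (Fin n) (Fin n) ℝ)) *ᵥ v) := by
  rw [Matrix.add_mulVec, dotProduct_add, Matrix.smul_mulVec, Matrix.one_mulVec, dotProduct_smul,
      smul_eq_mul]
  linarith [psd_quad hA v]

lemma Bm_bd (S : Sol n lam M' K L x0 r h a b) {c : ℝ} (hc : 0 < c) {x : E}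
    (hx : x ∈ Metric.ball x0 r) (i j : Fin n) : |Bm h c x i j| ≤ n / c :=
  inv_bd hc (pd_add_smul_one (S.psd x hx) hc) (psd_add_quad (S.psd x hx) c) i j

lemma et_bd (S : Sol n lam M' K L x0 r h a b) {c : ℝ} (hc : 0 < c) {x : E}
    (hx : x ∈ Metric.ball x0 r) {ξ : Fin n → ℝ} {R : ℝ} (hξ : ∀ i, |ξ i| ≤ R) (i : Fin n) :
    |et h c ξ i x| ≤ n * (n / c * R) :=
  abs_sum_mul_le' _ _ _ _ (Bm_bd S hc hx i) hξ

lemma tau_eq (S : Sol n lam M' K L x0 r h a b) {x : E} (hx : x ∈ Metric.ball x0 r) (p : Fin n) :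
    ∑ k, ∑ q, Fm h a b x k q * T3 h k p q x
      = -((∑ i, ∑ j, pd p (fun y => a y i j) x * Hm h x i j) + pd p b x * (Hm h x).det) := by
  have h1 := ((HasPd.sum fun i => HasPd.sum fun j =>
    (hasPd_of_diff ((S.ha i j).differentiable one_ne_zero x)).mul (hasPd_Hm S.hh i j x)).add
      ((hasPd_of_diff (S.hb.differentiable one_ne_zero x)).mul
        (hasPd_det (fun i j => hasPd_Hm S.hh i j x)))).2 p
  have h2 : (fun y => (∑ i, ∑ j, a y i j * Hm h y i j) + b y * (Hm h y).det) =ᶠ[𝓝 x] fun _ => 1 := by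
    filter_upwards [Metric.isOpen_ball.mem_nhds hx] with y hy
    exact S.eqn y hy
  rw [pd, h2.fderiv_eq] at h1
  simp only [fderiv_fun_const, Pi.zero_apply, _root_.zero_apply] at h1
  have h3 : ∑ k, ∑ q, Fm h a b x k q * T3 h k p q x = (∑ i, ∑ j, a x i j * T3 h p i j x)
      + b x * ∑ r, ∑ s, (Hm h x).adjugate s r * T3 h p r s x := by
    rw [Finset.mul_sum, ← Finset.sum_add_distrib]
    refine Finset.sum_congr rfl fun i _ => ?_
    rw [Finset.mul_sum, ← Finset.sum_add_distrib]
    refine Finset.sum_congr rfl fun j _ => ?_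
    have : (Hm h x).adjugate j i = (Hm h x).adjugate i j := by
      have := congrFun (congrFun (Matrix.adjugate_transpose (Hm h x)) i) j
      rw [Hm_symm S.hh] at this
      exact this
    rw [this, T3_symm1 S.hh i p j, Fm, Matrix.add_apply, Matrix.smul_apply, smul_eq_mul]
    ring
  rw [h3]
  simp only [Finset.sum_add_distrib] at h1 ⊢
  linarith

lemma sumFX_eq (c : ℝ) (ξ : Fin n → ℝ) (x : E) :
    ∑ k, ∑ q, Fm h a b x k q * Xm h c ξ x k q
      = ∑ p, et h c ξ p x * ∑ k, ∑ q, Fm h a b x k q * T3 h k p q x := by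
  simp only [Xm, Matrix.of_apply, Finset.mul_sum]
  conv_rhs => rw [Finset.sum_comm]
  refine Finset.sum_congr rfl fun k _ => ?_
  conv_rhs => rw [Finset.sum_comm]
  exact Finset.sum_congr rfl fun q _ => Finset.sum_congr rfl fun p _ => by ring

lemma piola_dF (S : Sol n lam M' K L x0 r h a b) (x : E) (k : Fin n) :
    ∑ l, dF h a b x l k l
      = ∑ l, (pd l (fun y => a y l k) x + pd l b x * (Hm h x).adjugate l k) := by
  have h1 := piola_alg (Hm h x) (fun i r s => T3 h i r s x) (fun i r s => by
    rw [T3_symm1 S.hh i r s, T3_symm2 S.hh r i s, T3_symm1 S.hh r s i]) k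
  simp_rw [dF_symm S x _ k _, dF]
  rw [Finset.sum_add_distrib, Finset.sum_add_distrib, Finset.sum_add_distrib, ← Finset.mul_sum, h1]
  ring

lemma dF_eta (S : Sol n lam M' K L x0 r h a b) (c : ℝ) (ξ : Fin n → ℝ) (x : E) :
    ∑ k, ∑ q, (∑ l, dF h a b x l k q * et h c ξ l x) * Xm h c ξ x k q
      = (∑ k, ∑ q, (∑ l, (pd l (fun y => a y k q) x + pd l b x * (Hm h x).adjugate k q)
          * et h c ξ l x) * Xm h c ξ x k q) + b x * q2 (Hm h x) (Xm h c ξ x) := by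
  have e : b x * q2 (Hm h x) (Xm h c ξ x) = ∑ k, ∑ q, (b x * ∑ r, ∑ s, cof2 (Hm h x) k q s r *
      Xm h c ξ x r s) * Xm h c ξ x k q := by
    rw [q2, Finset.sum_comm, Finset.mul_sum]
    refine Finset.sum_congr rfl fun k _ => ?_
    rw [Finset.mul_sum]
    refine Finset.sum_congr rfl fun q _ => ?_
    rw [show Xm h c ξ x q k = Xm h c ξ x k q from congrFun (congrFun (Xm_symm S.hh c ξ x) k) q]
    ring
  rw [e, ← Finset.sum_add_distrib]
  refine Finset.sum_congr rfl fun k _ => ?_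
  rw [← Finset.sum_add_distrib]
  refine Finset.sum_congr rfl fun q _ => ?_
  rw [← add_mul]
  congr 1
  have e2 : ∑ r, ∑ s, cof2 (Hm h x) k q s r * Xm h c ξ x r s
      = ∑ l, (∑ r, ∑ s, cof2 (Hm h x) k q s r * T3 h l r s x) * et h c ξ l x := by
    simp_rw [Finset.sum_mul]
    conv_rhs => rw [Finset.sum_comm]
    refine Finset.sum_congr rfl fun r _ => ?_
    conv_rhs => rw [Finset.sum_comm]
    refine Finset.sum_congr rfl fun s _ => ?_
    rw [Xm, Matrix.of_apply, Finset.mul_sum]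
    refine Finset.sum_congr rfl fun l _ => ?_
    rw [T3_symm1 S.hh r l s]; ring
  rw [e2, Finset.mul_sum, ← Finset.sum_add_distrib]
  refine Finset.sum_congr rfl fun l _ => ?_
  rw [dF]; ring

lemma Fm_coe (S : Sol n lam M' K L x0 r h a b) {x : E} (hx : x ∈ Metric.ball x0 r) (v : Fin n → ℝ) :
    lam * (v ⬝ᵥ v) ≤ v ⬝ᵥ (Fm h a b x *ᵥ v) := by
  rw [Fm, Matrix.add_mulVec, dotProduct_add, Matrix.smul_mulVec, dotProduct_smul, smul_eq_mul]
  have := mul_nonneg (S.b0 x hx) (psd_quad (adj_psd (S.psd x hx)) v)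
  linarith [S.acoe x hx v]

lemma contDiff_Bm (S : Sol n lam M' K L x0 r h a b) {c : ℝ} (hc : 0 < c) (i j : Fin n) :
    ContDiffOn ℝ 1 (fun y => Bm h c y i j) (Metric.ball x0 r) := by
  have hP : ∀ i j, ContDiff ℝ 1 (fun y : E => (Hm h y + c • (1 : Matrix (Fin n) (Fin n) ℝ)) i j) :=
    fun i j => ((contDiff_Hm S.hh i j).of_le (by norm_cast)).add contDiff_const
  have : (fun y => Bm h c y i j) = fun y => ((Hm h y + c • (1 : Matrix (Fin n) (Fin n) ℝ)).det)⁻¹ *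
      (Hm h y + c • (1 : Matrix (Fin n) (Fin n) ℝ)).adjugate i j := by
    ext y; exact inv_entry _ i j
  rw [this]
  exact ((contDiff_det' hP).contDiffOn.inv fun y hy =>
    (pd_add_smul_one (S.psd y hy) hc).det_pos.ne').mul (contDiff_adj hP i j).contDiffOn

lemma contDiff_et (S : Sol n lam M' K L x0 r h a b) {c : ℝ} (hc : 0 < c) (ξ : Fin n → ℝ) (i : Fin n) :
    ContDiffOn ℝ 1 (et h c ξ i) (Metric.ball x0 r) := by
  unfold et
  exact ContDiffOn.sum fun q _ => (contDiff_Bm S hc i q).mul contDiffOn_const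

lemma contDiff_wf (S : Sol n lam M' K L x0 r h a b) {c : ℝ} (hc : 0 < c) (ξ : Fin n → ℝ) :
    ContDiffOn ℝ 1 (wf h c ξ) (Metric.ball x0 r) := by
  unfold wf
  exact ContDiffOn.sum fun q _ => contDiffOn_const.mul (contDiff_et S hc ξ q)

lemma contDiff_Xm (S : Sol n lam M' K L x0 r h a b) {c : ℝ} (hc : 0 < c) (ξ : Fin n → ℝ) (k q : Fin n) :
    ContDiffOn ℝ 1 (fun y => Xm h c ξ y k q) (Metric.ball x0 r) := by
  change ContDiffOn ℝ 1 (fun y => ∑ p, et h c ξ p y * T3 h k p q y) (Metric.ball x0 r)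
  exact ContDiffOn.sum fun p _ => (contDiff_et S hc ξ p).mul
    ((contDiff_T3 S.hh k p q).of_le (by norm_cast)).contDiffOn

lemma contDiff_Fm (S : Sol n lam M' K L x0 r h a b) (k q : Fin n) :
    ContDiff ℝ 1 (fun y => Fm h a b y k q) :=
  (S.ha k q).add (S.hb.mul (contDiff_adj (fun i j => (contDiff_Hm S.hh i j).of_le (by norm_cast)) k q))

lemma contDiff_Vf (S : Sol n lam M' K L x0 r h a b) {c : ℝ} (hc : 0 < c) (ξ : Fin n → ℝ) (l : Fin n) :
    ContDiffOn ℝ 1 (Vf h a b c ξ l) (Metric.ball x0 r) := by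
  unfold Vf
  exact (ContDiffOn.sum fun k _ => (contDiff_Fm S k l).contDiffOn.mul
    (ContDiffOn.sum fun q _ => (contDiff_Xm S hc ξ k q).mul (contDiff_et S hc ξ q)).neg).add
    ((ContDiffOn.sum fun k _ => ContDiffOn.sum fun q _ => (contDiff_Fm S k q).contDiffOn.mul
      (contDiff_Xm S hc ξ k q)).mul (contDiff_et S hc ξ l))
end
end PartC3

section PartC4
open Filter Topology MeasureTheory Matrix
open scoped ContDiff

section
variable {n : ℕ}
local notation "E" => EuclideanSpace ℝ (Fin n)
variable {lam M' K L : ℝ} {x0 : EuclideanSpace ℝ (Fin n)} {r : ℝ} {h : EuclideanSpace ℝ (Fin n) → ℝ}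
  {a : EuclideanSpace ℝ (Fin n) → Matrix (Fin n) (Fin n) ℝ} {b : EuclideanSpace ℝ (Fin n) → ℝ}

lemma div_lower (S : Sol n lam M' K L x0 r h a b) (hL : 0 ≤ L) {c c0 e CA t β : ℝ} (hc : 0 < c)
    (hβ : 0 ≤ β) (he : 0 ≤ e) (ht : 0 ≤ t) (hCA : 0 ≤ CA)
    (hkey : ∀ X : Matrix (Fin n) (Fin n) ℝ, Xᵀ = X → ∀ x ∈ Metric.ball x0 r, c0 * fsq X ≤
      b x / 2 * q2 (Hm h x) X + (Fm h a b x * (X * Bm h c x * X)).trace)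
    {ξ : Fin n → ℝ} {x : E} (hx : x ∈ Metric.ball x0 r)
    (hη : ∀ i, |et h c ξ i x| ≤ e) (hadj : ∀ i j, |(Hm h x).adjugate i j| ≤ CA)
    (hτ : ∀ p, |∑ k, ∑ q, Fm h a b x k q * T3 h k p q x| ≤ t * L)
    (hB : ∀ i j, |Bm h c x i j| ≤ β) :
    2 * (c0 * fsq (Xm h c ξ x)) - (n^3 * (1 + CA) * e + n^3 * (1+CA) * e + n^3*β*e*t + n^3*e*t*β) * L
        * √(fsq (Xm h c ξ x))
      ≤ ∑ l, pd l (Vf h a b c ξ l) x := by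
  set s := √(fsq (Xm h c ξ x)) with hs
  have hs0 : 0 ≤ s := Real.sqrt_nonneg _
  have hX : ∀ i j, |Xm h c ξ x i j| ≤ s := abs_entry_le_sqrt_fsq _
  have hn : (0:ℝ) ≤ n := Nat.cast_nonneg n
  have hXB : ∀ i j, |(Xm h c ξ x * Bm h c x) i j| ≤ n * (s * β) := fun i j => by
    rw [Matrix.mul_apply]; exact abs_sum_mul_le' _ _ _ _ (hX i) (fun k => hB k j)
  rw [div_Vf S.hh S.ha S.hb ξ (S.det_ne hc hx), dF_eta S, sumFX_eq]
  have hk := hkey _ (Xm_symm S.hh c ξ x) x hx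
  have hd : ∀ l k q, |pd l (fun y => a y k q) x + pd l b x * (Hm h x).adjugate k q| ≤ (1 + CA) * L := by
    intro l k q
    refine (abs_add_le _ _).trans ?_
    have := abs_mul_le' (S.db x hx l) (hadj k q)
    linarith [S.da x hx l k q]
  have e1 : |∑ k, ∑ q, (∑ l, (pd l (fun y => a y k q) x + pd l b x * (Hm h x).adjugate k q)
          * et h c ξ l x) * Xm h c ξ x k q| ≤ n * (n * ((n * ((1+CA)*L * e)) * s)) := by
    refine abs_sum_le' _ _ fun k => ?_
    exact abs_sum_mul_le' _ _ _ _ (fun q => abs_sum_mul_le' _ _ _ _ (fun l => hd l k q) hη) (hX k)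
  have e2 : |∑ k, (∑ l, dF h a b x l k l) * ∑ q, Xm h c ξ x k q * et h c ξ q x|
      ≤ n * ((n * ((1+CA)*L)) * (n * (s * e))) := by
    refine abs_sum_mul_le' _ _ _ _ (fun k => ?_) (fun k => abs_sum_mul_le' _ _ _ _ (hX k) hη)
    rw [piola_dF S]
    exact abs_sum_le' _ _ fun l => hd l l k
  have e3 : |∑ p, (∑ l, (Xm h c ξ x * Bm h c x) l p * et h c ξ l x) *
      ∑ k, ∑ q, Fm h a b x k q * T3 h k p q x| ≤ n * ((n * (n * (s*β) * e)) * (t * L)) :=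
    abs_sum_mul_le' _ _ _ _ (fun p => abs_sum_mul_le' _ _ _ _ (fun l => hXB l p) hη) hτ
  have e4 : |(∑ p, et h c ξ p x * ∑ k, ∑ q, Fm h a b x k q * T3 h k p q x) *
      (Xm h c ξ x * Bm h c x).trace| ≤ (n * (e * (t * L))) * (n * (n * (s * β))) := by
    refine abs_mul_le' (abs_sum_mul_le' _ _ _ _ hη hτ) ?_
    rw [Matrix.trace]
    exact abs_sum_le' _ _ fun i => hXB i i
  have f1 := (abs_le.1 e1).1
  have f2 := (abs_le.1 e2).2
  have f3 := (abs_le.1 e3).2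
  have f4 := (abs_le.1 e4).2
  nlinarith

set_option maxHeartbeats 1000000 in
lemma DG_of_Sol (n : ℕ) (lam M' K c c0 R : ℝ) (hlam : 0 < lam) (hM' : 0 < M') (hK : 0 ≤ K) (hc : 0 < c)
    (hc0 : 0 < c0) (hR : 0 ≤ R)
    (hkey : ∀ (a A A1 : Matrix (Fin n) (Fin n) ℝ) (b : ℝ),
      (A + c • (1 : Matrix (Fin n) (Fin n) ℝ)).PosDef →
      (A1 + c • (1 : Matrix (Fin n) (Fin n) ℝ)).PosDef →
      (∀ i j, |A i j| ≤ K + 1) → (∀ i j, |A1 i j| ≤ K + 1) →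
      (∀ v : Fin n → ℝ, lam * (v ⬝ᵥ v) ≤ v ⬝ᵥ (a *ᵥ v)) → 0 ≤ b → b ≤ M' →
      c0 * fsq (A - A1) ≤ b * (A.det - A1.det - (A1.adjugate * (A - A1)).trace)
        + ((a + b • A1.adjugate) * ((A - A1) * (A + c • (1 : Matrix (Fin n) (Fin n) ℝ))⁻¹ * (A - A1))).trace) :
    ∃ Lam' C2 : ℝ, 0 < Lam' ∧ 0 < C2 ∧ ∀ (L : ℝ) (x0 : EuclideanSpace ℝ (Fin n)) (r : ℝ)
      (h : EuclideanSpace ℝ (Fin n) → ℝ) (a : EuclideanSpace ℝ (Fin n) → Matrix (Fin n) (Fin n) ℝ)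
      (b : EuclideanSpace ℝ (Fin n) → ℝ) (ξ : Fin n → ℝ), 0 ≤ L → L ≤ 1 → Sol n lam M' K L x0 r h a b →
      (∀ i, |ξ i| ≤ R) →
      DG n x0 r (lam / 2) Lam' (C2 * L) (wf h c ξ) (Vf h a b c ξ) := by
  obtain ⟨CA, hCA, HA⟩ := adj_lip n K hK
  obtain ⟨CD, hCD, HD⟩ := det_lip n K hK
  have hn : (0:ℝ) ≤ n := Nat.cast_nonneg n
  obtain ⟨β, hβd⟩ : ∃ β : ℝ, β = n / c := ⟨_, rfl⟩
  have hβ : 0 ≤ β := by rw [hβd]; positivity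
  obtain ⟨e, hed⟩ : ∃ e : ℝ, e = n * (n / c * R) := ⟨_, rfl⟩
  have he : 0 ≤ e := by rw [hed]; positivity
  obtain ⟨t, htd⟩ : ∃ t : ℝ, t = n * (n * K) + CD := ⟨_, rfl⟩
  have ht : 0 ≤ t := by rw [htd]; positivity
  obtain ⟨f, hfd⟩ : ∃ f : ℝ, f = M' + M' * CA := ⟨_, rfl⟩
  have hf : 0 ≤ f := by rw [hfd]; positivity
  obtain ⟨m, hmd⟩ : ∃ m : ℝ, m = n * (e * t) * e := ⟨_, rfl⟩
  have hm : 0 ≤ m := by rw [hmd]; positivity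
  obtain ⟨C1, hC1d⟩ : ∃ C1 : ℝ, C1 = n^3 * (1 + CA) * e + n^3 * (1+CA) * e + n^3*β*e*t + n^3*e*t*β := ⟨_, rfl⟩
  have hC1 : 0 ≤ C1 := by rw [hC1d]; positivity
  obtain ⟨C2, hC2d⟩ : ∃ C2 : ℝ, C2 = C1^2/(8*c0) + n * m^2/(2*lam) + 2*n*m^2 + 1 := ⟨_, rfl⟩
  have g1 : 0 ≤ C1^2/(8*c0) := by positivity
  have g2 : 0 ≤ n * m^2/(2*lam) := by positivity
  have g3 : 0 ≤ 2*n*m^2 := by positivity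
  have hC2 : 1 ≤ C2 := by linarith
  have hC22 : C2 ≤ C2^2 := by nlinarith
  refine ⟨2*n^2*f^2 + 1, C2, by positivity, by linarith, ?_⟩
  intro L x0 r h a b ξ hL hL1 S hξ
  have hadj : ∀ x ∈ Metric.ball x0 r, ∀ i j, |(Hm h x).adjugate i j| ≤ CA := fun x hx i j =>
    (HA _ _ (S.hbd x hx) (S.hbd x hx) i j).1
  have hη : ∀ x ∈ Metric.ball x0 r, ∀ i, |et h c ξ i x| ≤ e := fun x hx i => by
    rw [hed]; exact et_bd S hc hx hξ i
  have hτ : ∀ x ∈ Metric.ball x0 r, ∀ p, |∑ k, ∑ q, Fm h a b x k q * T3 h k p q x| ≤ t * L := by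
    intro x hx p
    rw [tau_eq S hx, abs_neg]
    refine (abs_add_le _ _).trans ?_
    have h1 : |∑ i, ∑ j, pd p (fun y => a y i j) x * Hm h x i j| ≤ n * (n * (L * K)) :=
      abs_sum_le' _ _ fun i => abs_sum_mul_le' _ _ _ _ (fun j => S.da x hx p i j) (S.hbd x hx i)
    have h2 : |pd p b x * (Hm h x).det| ≤ L * CD :=
      abs_mul_le' (S.db x hx p) (HD _ _ (S.hbd x hx) (S.hbd x hx)).1
    rw [htd]; linarith
  have hF : ∀ x ∈ Metric.ball x0 r, ∀ k q, |Fm h a b x k q| ≤ f := by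
    intro x hx k q
    rw [Fm, Matrix.add_apply, Matrix.smul_apply, smul_eq_mul, hfd]
    refine (abs_add_le _ _).trans (add_le_add (S.abd x hx k q) ?_)
    exact abs_mul_le' (abs_le.2 ⟨by linarith [S.b0 x hx], S.bbd x hx⟩) (hadj x hx k q)
  have hσ : ∀ x ∈ Metric.ball x0 r, ∀ l, |(∑ k, ∑ q, Fm h a b x k q * Xm h c ξ x k q) * et h c ξ l x| ≤ m * L := by
    intro x hx l
    rw [sumFX_eq]
    refine (abs_mul_le' (abs_sum_mul_le' _ _ _ _ (hη x hx) (hτ x hx)) (hη x hx l)).trans (le_of_eq ?_)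
    rw [hmd]; ring
  have hV : ∀ x ∈ Metric.ball x0 r, ∀ l, Vf h a b c ξ l x = (∑ k, Fm h a b x k l * pd k (wf h c ξ) x) +
      (∑ k, ∑ q, Fm h a b x k q * Xm h c ξ x k q) * et h c ξ l x := by
    intro x hx l
    rw [Vf]; congr 1
    refine Finset.sum_congr rfl fun k _ => ?_
    rw [(hasPd_wf S.hh ξ (S.det_ne hc hx)).2 k]
  have hmL : (m * L)^2 = m^2 * L^2 := by ring
  refine ⟨contDiff_wf S hc ξ, contDiff_Vf S hc ξ, ?_, ?_, ?_⟩
  · intro x hx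
    set g : Fin n → ℝ := fun k => pd k (wf h c ξ) x with hg
    have h1 := Fm_coe S hx g
    have h2 : g ⬝ᵥ (Fm h a b x *ᵥ g) = ∑ l, (∑ k, Fm h a b x k l * g k) * g l := by
      rw [dotProduct]
      refine Finset.sum_congr rfl fun l _ => ?_
      rw [mul_comm, Matrix.mulVec, dotProduct]
      congr 1
      refine Finset.sum_congr rfl fun k _ => ?_
      rw [show Fm h a b x l k = Fm h a b x k l from congrFun (congrFun (Fm_symm S.hh S.asymm x) k) l]
    have h3 : g ⬝ᵥ g = ∑ k, g k ^ 2 := by simp [dotProduct, sq]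
    have h4 : ∀ l, -(lam/2 * g l ^2) - (m*L)^2/(2*lam) ≤
        ((∑ k, ∑ q, Fm h a b x k q * Xm h c ξ x k q) * et h c ξ l x) * g l := by
      intro l
      have := hσ x hx l
      set σ := (∑ k, ∑ q, Fm h a b x k q * Xm h c ξ x k q) * et h c ξ l x
      have hsq : σ^2 ≤ (m*L)^2 := sq_le_sq' (by linarith [(abs_le.1 this).1]) (abs_le.1 this).2
      have h5 : σ^2/(2*lam) ≤ (m*L)^2/(2*lam) := by gcongr
      have h6 : 0 ≤ (lam * g l + σ)^2 / (2*lam) := by positivity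
      have h7 : (lam * g l + σ)^2 / (2*lam) = lam/2*g l^2 + σ * g l + σ^2/(2*lam) := by field_simp; ring
      linarith
    have h5 := Finset.sum_le_sum fun l (_ : l ∈ Finset.univ) => h4 l
    rw [Finset.sum_sub_distrib, Finset.sum_neg_distrib, ← Finset.mul_sum] at h5
    simp only [Finset.sum_const, Finset.card_univ, Fintype.card_fin, nsmul_eq_mul] at h5
    have h6 : ∑ k, Vf h a b c ξ k x * g k = ∑ l, (∑ k, Fm h a b x k l * g k) * g l +
        ∑ l, ((∑ k, ∑ q, Fm h a b x k q * Xm h c ξ x k q) * et h c ξ l x) * g l := by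
      rw [← Finset.sum_add_distrib]
      refine Finset.sum_congr rfl fun l _ => ?_
      rw [hV x hx l, add_mul]
    change lam/2 * ∑ k, g k ^2 ≤ (∑ k, Vf h a b c ξ k x * g k) + _
    rw [h6, ← h2]
    rw [h3] at h1
    have h8 : n * ((m*L)^2/(2*lam)) = (n * m^2/(2*lam)) * L^2 := by ring
    have h9 : (n * m^2/(2*lam)) * L^2 ≤ C2^2 * L^2 := by
      refine mul_le_mul_of_nonneg_right ?_ (sq_nonneg _); linarith
    have h10 : (C2*L)^2 = C2^2*L^2 := by ring
    linarith
  · intro x hx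
    set g : Fin n → ℝ := fun k => pd k (wf h c ξ) x with hg
    change _ ≤ _ * ((∑ k, g k ^2) + _)
    have h1 : ∀ l, (Vf h a b c ξ l x)^2 ≤ 2 * (n * f^2 * ∑ k, g k^2) + 2 * (m*L)^2 := by
      intro l
      have hs := hσ x hx l
      rw [hV x hx l]
      set σ := (∑ k, ∑ q, Fm h a b x k q * Xm h c ξ x k q) * et h c ξ l x
      have hsq : σ^2 ≤ (m*L)^2 := sq_le_sq' (by linarith [(abs_le.1 hs).1]) (abs_le.1 hs).2
      have h2 : (∑ k, Fm h a b x k l * g k)^2 ≤ n * f^2 * ∑ k, g k^2 := by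
        refine (Finset.sum_mul_sq_le_sq_mul_sq _ _ _).trans ?_
        refine mul_le_mul_of_nonneg_right ?_ (Finset.sum_nonneg fun k _ => sq_nonneg _)
        refine (Finset.sum_le_sum fun k _ => (sq_le_sq' (by linarith [(abs_le.1 (hF x hx k l)).1])
          (abs_le.1 (hF x hx k l)).2 : (Fm h a b x k l)^2 ≤ f^2)).trans ?_
        simp
      change ((∑ k, Fm h a b x k l * g k) + σ)^2 ≤ _
      nlinarith [sq_nonneg ((∑ k, Fm h a b x k l * g k) - σ)]
    refine (Finset.sum_le_sum fun l _ => h1 l).trans ?_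
    simp only [Finset.sum_const, Finset.card_univ, Fintype.card_fin, nsmul_eq_mul]
    have hG : 0 ≤ ∑ k, g k^2 := Finset.sum_nonneg fun k _ => sq_nonneg _
    have h9 : (2*n * m^2) * L^2 ≤ C2^2 * L^2 := by
      refine mul_le_mul_of_nonneg_right ?_ (sq_nonneg _); linarith
    have h10 : (C2*L)^2 = C2^2*L^2 := by ring
    rw [h10]
    have h11 : 0 ≤ (2*n^2*f^2) * (C2^2*L^2) := by positivity
    nlinarith
  · intro x hx
    have h1 := div_lower S hL hc hβ he ht hCA (c0 := c0) (fun X hX x hx =>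
      key_inf n lam M' K c c0 hc hK hkey (a x) (Hm h x) X (b x) (S.psd x hx) hX (S.hbd x hx)
        (S.acoe x hx) (S.b0 x hx) (S.bbd x hx)) hx (hη x hx) (hadj x hx) (hτ x hx)
      (fun i j => by rw [hβd]; exact Bm_bd S hc hx i j)
    rw [← hC1d] at h1
    refine le_trans ?_ h1
    set s := √(fsq (Xm h c ξ x)) with hs
    have hs2 : fsq (Xm h c ξ x) = s^2 := (Real.sq_sqrt (fsq_nonneg _)).symm
    rw [hs2]
    have h2 : 0 ≤ (4*c0*s - C1*L)^2/(8*c0) := by positivity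
    have h3 : (4*c0*s - C1*L)^2/(8*c0) = 2*(c0*s^2) - C1*L*s + C1^2/(8*c0)*L^2 := by
      field_simp; ring
    have h4 : C1^2/(8*c0)*L^2 ≤ C2 * L := by
      refine (mul_le_mul_of_nonneg_right (by linarith : C1^2/(8*c0) ≤ C2) (sq_nonneg _)).trans ?_
      refine mul_le_mul_of_nonneg_left (by nlinarith) (by linarith)
    linarith
end
end PartC4

section PartC5
open Filter Topology MeasureTheory Matrix
open scoped ContDiff

section
variable {n : ℕ}
local notation "E" => EuclideanSpace ℝ (Fin n)

lemma pd_affine {f : E → ℝ} (y : E) (s : ℝ) (x : E) (hf : DifferentiableAt ℝ f (y + s • x)) (k : Fin n) :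
    pd k (fun z => f (y + s • z)) x = s * pd k f (y + s • x) := by
  have h1 : HasFDerivAt (fun z : E => y + s • z) (s • ContinuousLinearMap.id ℝ E) x :=
    ((hasFDerivAt_id x).const_smul s).const_add y
  have h2 : HasFDerivAt (fun z => f (y + s • z)) _ x := hf.hasFDerivAt.comp x h1
  rw [pd_eq_of_hasFDerivAt h2]
  simp [pd]

lemma contDiff_affine {f : E → ℝ} {m : WithTop ℕ∞} (hf : ContDiff ℝ m f) (y : E) (s : ℝ) :
    ContDiff ℝ m (fun z => f (y + s • z)) :=
  hf.comp (by fun_prop)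

/-- the quadratic rescaling of `h` -/
noncomputable def resc (h : E → ℝ) (y : E) (s : ℝ) : E → ℝ := fun x => (s^2)⁻¹ * h (y + s • x)

lemma Hm_resc {h : E → ℝ} (hh : ContDiff ℝ ∞ h) (y : E) {s : ℝ} (hs : 0 < s) (x : E) :
    Hm (resc h y s) x = Hm h (y + s • x) := by
  ext i j
  simp only [Hm, Matrix.of_apply]
  have hd : ∀ z, DifferentiableAt ℝ h z := fun z => hh.differentiable (by simp) z
  have hd2 : ∀ z, DifferentiableAt ℝ (pd j h) z := fun z => (contDiff_pd hh j).differentiable (by simp) z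
  have h1 : pd j (resc h y s) = fun x => s⁻¹ * pd j h (y + s • x) := by
    ext z
    have := pd_const_mul ((s^2)⁻¹) (((contDiff_affine hh y s).differentiable (by simp)) z) j
    unfold resc
    rw [this, pd_affine y s z (hd _)]
    field_simp
  rw [h1]
  rw [pd_const_mul s⁻¹ (((contDiff_affine (contDiff_pd hh j) y s).differentiable (by simp)) x) i,
    pd_affine y s x (hd2 _)]
  field_simp

lemma wf_resc {h : E → ℝ} (hh : ContDiff ℝ ∞ h) (y : E) {s : ℝ} (hs : 0 < s) (c : ℝ) (ξ : Fin n → ℝ) (x : E) :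
    wf (resc h y s) c ξ x = wf h c ξ (y + s • x) := by
  simp only [wf, et, Bm, Hm_resc hh y hs]

lemma mem_ball_affine {x0 y : E} {r s : ℝ} (hs : 0 < s) (hsub : Metric.ball y s ⊆ Metric.ball x0 r) {x : E}
    (hx : x ∈ Metric.ball (0 : E) 1) : y + s • x ∈ Metric.ball x0 r := by
  apply hsub
  rw [Metric.mem_ball, dist_eq_norm, add_sub_cancel_left, norm_smul, Real.norm_of_nonneg hs.le]
  rw [mem_ball_zero_iff] at hx
  nlinarith

lemma Sol.rescale {lam M' K L : ℝ} {x0 : E} {r : ℝ} {h : E → ℝ}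
    {a : E → Matrix (Fin n) (Fin n) ℝ} {b : E → ℝ}
    (S : Sol n lam M' K L x0 r h a b) {y : E} {s : ℝ} (hs : 0 < s)
    (hsub : Metric.ball y s ⊆ Metric.ball x0 r) :
    Sol n lam M' K (L * s) 0 1 (resc h y s) (fun x => a (y + s • x)) (fun x => b (y + s • x)) where
  hh := contDiff_const.mul (contDiff_affine S.hh y s)
  ha i j := contDiff_affine (S.ha i j) y s
  hb := contDiff_affine S.hb y s
  asymm x := S.asymm _
  acoe x hx := S.acoe _ (mem_ball_affine hs hsub hx)
  abd x hx := S.abd _ (mem_ball_affine hs hsub hx)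
  b0 x hx := S.b0 _ (mem_ball_affine hs hsub hx)
  bbd x hx := S.bbd _ (mem_ball_affine hs hsub hx)
  da x hx k i j := by
    rw [pd_affine (f := fun y => a y i j) y s x ((S.ha i j).differentiable one_ne_zero _), abs_mul, abs_of_pos hs,
      mul_comm]
    exact mul_le_mul_of_nonneg_right (S.da _ (mem_ball_affine hs hsub hx) k i j) hs.le
  db x hx k := by
    rw [pd_affine (f := b) y s x (S.hb.differentiable one_ne_zero _), abs_mul, abs_of_pos hs, mul_comm]
    exact mul_le_mul_of_nonneg_right (S.db _ (mem_ball_affine hs hsub hx) k) hs.le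
  psd x hx := by rw [Hm_resc S.hh y hs]; exact S.psd _ (mem_ball_affine hs hsub hx)
  hbd x hx := by rw [Hm_resc S.hh y hs]; exact S.hbd _ (mem_ball_affine hs hsub hx)
  eqn x hx := by rw [Hm_resc S.hh y hs]; exact S.eqn _ (mem_ball_affine hs hsub hx)

/-- Lipschitz bound from bounds on partial derivatives -/
lemma lip_of_pd {f : E → ℝ} {x0 : E} {r L : ℝ} (hf : ContDiff ℝ 1 f) (hL : 0 ≤ L)
    (h : ∀ x ∈ Metric.ball x0 r, ∀ k, |pd k f x| ≤ L) {x y : E} (hx : x ∈ Metric.ball x0 r)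
    (hy : y ∈ Metric.ball x0 r) : |f y - f x| ≤ n * L * ‖y - x‖ := by
  have := (convex_ball x0 r).norm_image_sub_le_of_norm_fderiv_le (𝕜 := ℝ) (f := f) (C := n * L)
    (fun z _ => hf.differentiable one_ne_zero z) (fun z hz => ?_) hx hy
  · exact this
  · refine (norm_fderiv_le_sqrt f z).trans ?_
    rw [Real.sqrt_le_left (by positivity)]
    have h1 : ∀ k, (pd k f z)^2 ≤ L^2 := fun k =>
      sq_le_sq' (by linarith [(abs_le.1 (h z hz k)).1]) (abs_le.1 (h z hz k)).2
    refine (Finset.sum_le_sum fun k _ => h1 k).trans ?_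
    simp only [Finset.sum_const, Finset.card_univ, Fintype.card_fin, nsmul_eq_mul]
    rw [mul_pow]
    refine mul_le_mul_of_nonneg_right ?_ (sq_nonneg _)
    have : n ≤ n^2 := by nlinarith [Nat.zero_le n, sq_nonneg (n:ℤ), Nat.le_self_pow (two_ne_zero) n]
    exact_mod_cast this
end
end PartC5

section PartC6
open Filter Topology MeasureTheory Matrix
open scoped ContDiff

lemma alg_osc {n : ℕ} {lam M' K c c0 : ℝ} (hc : 0 < c)
    (hkey : ∀ (a A A1 : Matrix (Fin n) (Fin n) ℝ) (b : ℝ),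
      (A + c • (1 : Matrix (Fin n) (Fin n) ℝ)).PosDef →
      (A1 + c • (1 : Matrix (Fin n) (Fin n) ℝ)).PosDef →
      (∀ i j, |A i j| ≤ K + 1) → (∀ i j, |A1 i j| ≤ K + 1) →
      (∀ v : Fin n → ℝ, lam * (v ⬝ᵥ v) ≤ v ⬝ᵥ (a *ᵥ v)) → 0 ≤ b → b ≤ M' →
      c0 * fsq (A - A1) ≤ b * (A.det - A1.det - (A1.adjugate * (A - A1)).trace)
        + ((a + b • A1.adjugate) * ((A - A1) * (A + c • (1 : Matrix (Fin n) (Fin n) ℝ))⁻¹ * (A - A1))).trace)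
    {a A A1 : Matrix (Fin n) (Fin n) ℝ} {b : ℝ} (hA : A.PosSemidef) (hA1 : A1.PosSemidef)
    (hAK : ∀ i j, |A i j| ≤ K) (hA1K : ∀ i j, |A1 i j| ≤ K)
    (ha : ∀ v : Fin n → ℝ, lam * (v ⬝ᵥ v) ≤ v ⬝ᵥ (a *ᵥ v)) (hb0 : 0 ≤ b) (hb : b ≤ M') :
    c0 * fsq (A - A1) ≤ b * (A.det - A1.det) + (a * (A - A1)).trace +
      (((A1 + c • (1 : Matrix (Fin n) (Fin n) ℝ)) * (a + b • A1.adjugate) *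
        (A1 + c • (1 : Matrix (Fin n) (Fin n) ℝ))) * ((A + c • (1 : Matrix (Fin n) (Fin n) ℝ))⁻¹ -
          (A1 + c • (1 : Matrix (Fin n) (Fin n) ℝ))⁻¹)).trace := by
  have hP := pd_add_smul_one hA hc
  have hP1 := pd_add_smul_one hA1 hc
  have h1 := hkey a A A1 b hP hP1 (fun i j => (hAK i j).trans (by linarith))
    (fun i j => (hA1K i j).trans (by linarith)) ha hb0 hb
  have h2 := key_id (P := A + c • (1 : Matrix (Fin n) (Fin n) ℝ)) (P1 := A1 + c • (1 : Matrix (Fin n) (Fin n) ℝ))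
    (D := A - A1) (isUnit_iff_ne_zero.2 hP.det_pos.ne') (isUnit_iff_ne_zero.2 hP1.det_pos.ne') (by abel)
  set P := A + c • (1 : Matrix (Fin n) (Fin n) ℝ)
  set P1 := A1 + c • (1 : Matrix (Fin n) (Fin n) ℝ)
  set D := A - A1
  set F := a + b • A1.adjugate with hF
  have h3 : D * P⁻¹ * D = D + P1 * (P⁻¹ - P1⁻¹) * P1 := by rw [h2]; abel
  rw [h3, Matrix.mul_add, Matrix.trace_add] at h1
  have h4 : (F * (P1 * (P⁻¹ - P1⁻¹) * P1)).trace = (P1 * F * P1 * (P⁻¹ - P1⁻¹)).trace := by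
    rw [Matrix.trace_mul_comm, Matrix.mul_assoc, Matrix.trace_mul_comm, ← Matrix.mul_assoc,
      Matrix.trace_mul_comm, ← Matrix.mul_assoc, ← Matrix.mul_assoc]
  have h5 : (F * D).trace = (a * D).trace + b * (A1.adjugate * D).trace := by
    rw [hF, Matrix.add_mul, Matrix.trace_add, Matrix.smul_mul, Matrix.trace_smul, smul_eq_mul]
  rw [h4, h5] at h1
  linarith

lemma exists_net (n : ℕ) (R ε : ℝ) (hR : 0 ≤ R) (hε : 0 < ε) :
    ∃ N : Finset (Fin n → ℝ), (∀ ξ ∈ N, ∀ i, |ξ i| ≤ R) ∧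
      ∀ v : Fin n → ℝ, (∀ i, |v i| ≤ R) → ∃ ξ ∈ N, ∀ i, |v i - ξ i| ≤ ε := by
  obtain ⟨t, ht, hfin, hcov⟩ := (isCompact_closedBall (0 : Fin n → ℝ) R).finite_cover_balls hε
  refine ⟨hfin.toFinset, fun ξ hξ i => ?_, fun v hv => ?_⟩
  · have h1 := ht (hfin.mem_toFinset.1 hξ)
    rw [mem_closedBall_zero_iff] at h1
    exact (norm_le_pi_norm ξ i).trans h1
  · have h1 : v ∈ Metric.closedBall (0 : Fin n → ℝ) R := by
      rw [mem_closedBall_zero_iff]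
      exact (pi_norm_le_iff_of_nonneg hR).2 hv
    obtain ⟨ξ, hξ, h2⟩ := Set.mem_iUnion₂.1 (hcov h1)
    refine ⟨ξ, hfin.mem_toFinset.2 hξ, fun i => ?_⟩
    rw [Metric.mem_ball, dist_eq_norm] at h2
    exact (norm_le_pi_norm (v - ξ) i).trans h2.le

section
variable {n : ℕ}

lemma qf_lip (B : Matrix (Fin n) (Fin n) ℝ) {β R ε : ℝ} (hB : ∀ i j, |B i j| ≤ β) {u v : Fin n → ℝ}
    (hu : ∀ i, |u i| ≤ R) (hv : ∀ i, |v i| ≤ R) (huv : ∀ i, |u i - v i| ≤ ε) :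
    |(∑ p, u p * ∑ q, B p q * u q) - ∑ p, v p * ∑ q, B p q * v q| ≤ n * (n * (2 * β * R * ε)) := by
  have e : (∑ p, u p * ∑ q, B p q * u q) - ∑ p, v p * ∑ q, B p q * v q
      = ∑ p, ∑ q, ((u p - v p) * (B p q * u q) + v p * (B p q * (u q - v q))) := by
    rw [← Finset.sum_sub_distrib]
    refine Finset.sum_congr rfl fun p _ => ?_
    rw [Finset.mul_sum, Finset.mul_sum, ← Finset.sum_sub_distrib]
    exact Finset.sum_congr rfl fun q _ => by ring
  rw [e]
  refine abs_sum_le' _ _ fun p => abs_sum_le' _ _ fun q => (abs_add_le _ _).trans ?_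
  have h1 := abs_mul_le' (huv p) (abs_mul_le' (hB p q) (hu q))
  have h2 := abs_mul_le' (hv p) (abs_mul_le' (hB p q) (huv q))
  linarith

lemma trace_factor (R B : Matrix (Fin n) (Fin n) ℝ) :
    ((Rᵀ * R) * B).trace = ∑ k, ∑ p, R k p * ∑ q, B p q * R k q := by
  rw [Matrix.mul_assoc, Matrix.trace_mul_comm, Matrix.trace]
  refine Finset.sum_congr rfl fun k _ => ?_
  rw [Matrix.diag_apply, Matrix.mul_apply]
  simp only [Matrix.mul_apply, Matrix.transpose_apply, Finset.sum_mul, Finset.mul_sum]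
  rw [Finset.sum_comm]
  exact Finset.sum_congr rfl fun p _ => Finset.sum_congr rfl fun q _ => by ring

lemma sandwich_psd {F P : Matrix (Fin n) (Fin n) ℝ} (hF : F.PosSemidef) (hP : Pᵀ = P) :
    (P * F * P).PosSemidef := by
  have := hF.conjTranspose_mul_mul_same P
  rwa [Matrix.conjTranspose_eq_transpose_of_trivial, hP] at this
end
end PartC6

section PartC7
open Filter Topology MeasureTheory Matrix
open scoped ContDiff

set_option maxHeartbeats 1000000 in
/-- oscillation at one point pair, once all `w` are almost maximal at `x1` -/
lemma osc_pt (n : ℕ) (lam M' K c c0 : ℝ) (hlam : 0 < lam) (hM' : 0 < M') (hK : 0 ≤ K) (hc : 0 < c)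
    (hc1 : c ≤ 1)
    (hkey : ∀ (a A A1 : Matrix (Fin n) (Fin n) ℝ) (b : ℝ),
      (A + c • (1 : Matrix (Fin n) (Fin n) ℝ)).PosDef →
      (A1 + c • (1 : Matrix (Fin n) (Fin n) ℝ)).PosDef →
      (∀ i j, |A i j| ≤ K + 1) → (∀ i j, |A1 i j| ≤ K + 1) →
      (∀ v : Fin n → ℝ, lam * (v ⬝ᵥ v) ≤ v ⬝ᵥ (a *ᵥ v)) → 0 ≤ b → b ≤ M' →
      c0 * fsq (A - A1) ≤ b * (A.det - A1.det - (A1.adjugate * (A - A1)).trace)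
        + ((a + b • A1.adjugate) * ((A - A1) * (A + c • (1 : Matrix (Fin n) (Fin n) ℝ))⁻¹ * (A - A1))).trace) :
    ∃ R C3 : ℝ, 0 ≤ R ∧ 0 < C3 ∧ ∀ (L : ℝ)
      (h : EuclideanSpace ℝ (Fin n) → ℝ) (a : EuclideanSpace ℝ (Fin n) → Matrix (Fin n) (Fin n) ℝ)
      (b : EuclideanSpace ℝ (Fin n) → ℝ), 0 ≤ L → Sol n lam M' K L 0 1 h a b →
      ∀ (N : Finset (Fin n → ℝ)) (ε : ℝ), 0 ≤ ε → (∀ ξ ∈ N, ∀ i, |ξ i| ≤ R) →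
      (∀ v : Fin n → ℝ, (∀ i, |v i| ≤ R) → ∃ ξ ∈ N, ∀ i, |v i - ξ i| ≤ ε) →
      ∀ x ∈ Metric.ball (0 : EuclideanSpace ℝ (Fin n)) 1, ∀ x1 ∈ Metric.ball (0 : EuclideanSpace ℝ (Fin n)) 1,
      (∀ ξ ∈ N, wf h c ξ x ≤ wf h c ξ x1 + ε) → c0 * fsq (Hm h x - Hm h x1) ≤ C3 * (L + ε) := by
  obtain ⟨CA, hCA, HA⟩ := adj_lip n K hK
  obtain ⟨CD, hCD, HD⟩ := det_lip n K hK
  have hn : (0:ℝ) ≤ n := Nat.cast_nonneg n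
  obtain ⟨f, hfd⟩ : ∃ f : ℝ, f = M' + M' * CA := ⟨_, rfl⟩
  have hf : 0 ≤ f := by rw [hfd]; positivity
  obtain ⟨β, hβd⟩ : ∃ β : ℝ, β = n / c := ⟨_, rfl⟩
  have hβ : 0 ≤ β := by rw [hβd]; positivity
  obtain ⟨z, hzd⟩ : ∃ z : ℝ, z = n * ((n * ((K+1) * f)) * (K+1)) := ⟨_, rfl⟩
  have hz : 0 ≤ z := by rw [hzd]; positivity
  set R := z + 1 with hR
  have hR0 : 0 ≤ R := by linarith
  set C3 := (n * (n * (2 * n * K)) + 2 * n * CD) + n * (n * (n * (2 * β * R)) * 2 + 1) + 1 with hC3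
  have q1 : 0 ≤ (n * (n * (2 * n * K)) + 2 * n * CD) := by positivity
  have q2 : 0 ≤ n * (n * (n * (2 * β * R)) * 2 + 1) := by positivity
  refine ⟨R, C3, hR0, by linarith, ?_⟩
  intro L h a b hL S N ε hε hN hnet x hx x1 hx1 hw
  have hosc := alg_osc hc hkey (a := a x1) (b := b x1) (S.psd x hx) (S.psd x1 hx1) (S.hbd x hx) (S.hbd x1 hx1)
    (S.acoe x1 hx1) (S.b0 x1 hx1) (S.bbd x1 hx1)
  refine hosc.trans ?_
  have hdist : ‖x1 - x‖ ≤ 2 := by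
    rw [mem_ball_zero_iff] at hx hx1
    exact (norm_sub_le _ _).trans (by linarith)
  -- the equation part
  have heq : b x1 * ((Hm h x).det - (Hm h x1).det) + (a x1 * (Hm h x - Hm h x1)).trace
      ≤ (n * (n * (2 * n * K)) + 2 * n * CD) * L := by
    have e1 := S.eqn x hx
    have e2 := S.eqn x1 hx1
    have tr : ∀ (A H : Matrix (Fin n) (Fin n) ℝ), Hᵀ = H → (A * H).trace = ∑ i, ∑ j, A i j * H i j := by
      intro A H hH
      rw [Matrix.trace]
      refine Finset.sum_congr rfl fun i _ => ?_
      rw [Matrix.diag_apply, Matrix.mul_apply]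
      exact Finset.sum_congr rfl fun j _ => by
        rw [show H j i = H i j from congrFun (congrFun hH i) j]
    rw [Matrix.mul_sub, Matrix.trace_sub, tr _ _ (Hm_symm S.hh x1), tr _ _ (Hm_symm S.hh x)]
    have e3 : (∑ i, ∑ j, a x1 i j * Hm h x i j) - ∑ i, ∑ j, a x i j * Hm h x i j
        = ∑ i, ∑ j, (a x1 i j - a x i j) * Hm h x i j := by
      simp_rw [← Finset.sum_sub_distrib, sub_mul]
    have e4 : |∑ i, ∑ j, (a x1 i j - a x i j) * Hm h x i j| ≤ n * (n * ((n * L * 2) * K)) := by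
      refine abs_sum_le' _ _ fun i => abs_sum_mul_le' _ _ _ _ (fun j => ?_) (S.hbd x hx i)
      refine (lip_of_pd (S.ha i j) hL (fun y hy k => S.da y hy k i j) hx hx1).trans ?_
      exact mul_le_mul_of_nonneg_left hdist (by positivity)
    have e5 : |(b x1 - b x) * (Hm h x).det| ≤ (n * L * 2) * CD := by
      refine abs_mul_le' ?_ (HD _ _ (S.hbd x hx) (S.hbd x hx)).1
      refine (lip_of_pd S.hb hL S.db hx hx1).trans ?_
      exact mul_le_mul_of_nonneg_left hdist (by positivity)
    have e6 := (abs_le.1 e4).2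
    have e7 := (abs_le.1 e5).2
    nlinarith
  -- the trace part
  have hB : ∀ y ∈ Metric.ball (0 : EuclideanSpace ℝ (Fin n)) 1, ∀ i j, |Bm h c y i j| ≤ β := fun y hy i j => by
    rw [hβd]; exact Bm_bd S hc hy i j
  have hFpsd : (Fm h a b x1).PosSemidef :=
    (posDef_of_quad (Fm_symm S.hh S.asymm x1) hlam (Fm_coe S hx1)).posSemidef
  have hP1s := pd_symm (pd_add_smul_one (S.psd x1 hx1) hc)
  have hZ := sandwich_psd hFpsd hP1s
  set P1 := Hm h x1 + c • (1 : Matrix (Fin n) (Fin n) ℝ) with hP1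
  have hFb : ∀ i j, |Fm h a b x1 i j| ≤ f := by
    intro k q
    rw [Fm, Matrix.add_apply, Matrix.smul_apply, smul_eq_mul, hfd]
    refine (abs_add_le _ _).trans (add_le_add (S.abd x1 hx1 k q) ?_)
    exact abs_mul_le' (abs_le.2 ⟨by linarith [S.b0 x1 hx1], S.bbd x1 hx1⟩)
      (HA _ _ (S.hbd x1 hx1) (S.hbd x1 hx1) k q).1
  have hPb : ∀ i j, |P1 i j| ≤ K + 1 := by
    intro i j
    rw [hP1, Matrix.add_apply, Matrix.smul_apply, smul_eq_mul]
    refine (abs_add_le _ _).trans (add_le_add (S.hbd x1 hx1 i j) ?_)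
    rw [Matrix.one_apply]
    split_ifs
    · rw [mul_one, abs_of_pos hc]; exact hc1
    · simp
  have hZb : ∀ i j, |(P1 * Fm h a b x1 * P1) i j| ≤ z := by
    intro i j
    rw [Matrix.mul_apply, hzd]
    refine abs_sum_mul_le' _ _ _ _ (fun k => ?_) (fun k => hPb k j)
    rw [Matrix.mul_apply]
    exact abs_sum_mul_le' _ _ _ _ (hPb i) (fun l => hFb l k)
  obtain ⟨Q, hQ⟩ := psd_factor hZ
  have hQb : ∀ k i, |Q k i| ≤ R := by
    intro k i
    have h1 := (abs_le.1 (hZb i i)).2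
    rw [hQ, Matrix.mul_apply] at h1
    have h2 : (Q k i)^2 ≤ z := by
      refine le_trans ?_ h1
      simp only [Matrix.transpose_apply]
      rw [sq]
      exact Finset.single_le_sum (f := fun k => Q k i * Q k i) (fun _ _ => mul_self_nonneg _) (Finset.mem_univ k)
    rw [abs_le]
    constructor <;> nlinarith
  have htr : ((P1 * Fm h a b x1 * P1) * (Bm h c x - Bm h c x1)).trace
      ≤ n * (n * (n * (2 * β * R)) * 2 + 1) * ε := by
    rw [Matrix.mul_sub, Matrix.trace_sub, hQ, trace_factor, trace_factor, ← Finset.sum_sub_distrib]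
    have : ∀ k, (∑ p, Q k p * ∑ q, Bm h c x p q * Q k q) - (∑ p, Q k p * ∑ q, Bm h c x1 p q * Q k q)
        ≤ (n * (n * (2 * β * R)) * 2 + 1) * ε := by
      intro k
      obtain ⟨ξ, hξ, hd⟩ := hnet (Q k) (hQb k)
      have h1 := (abs_le.1 (qf_lip (Bm h c x) (hB x hx) (hQb k) (hN ξ hξ) hd)).2
      have h2 := (abs_le.1 (qf_lip (Bm h c x1) (hB x1 hx1) (hQb k) (hN ξ hξ) hd)).1
      have h3 := hw ξ hξ
      simp only [wf, et] at h3
      linarith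
    refine (Finset.sum_le_sum fun k _ => this k).trans (le_of_eq ?_)
    simp; ring
  have h4 : (P1 * (a x1 + b x1 • (Hm h x1).adjugate) * P1 *
      ((Hm h x + c • (1 : Matrix (Fin n) (Fin n) ℝ))⁻¹ - P1⁻¹)).trace
      = ((P1 * Fm h a b x1 * P1) * (Bm h c x - Bm h c x1)).trace := rfl
  rw [h4]
  have h5 : (n * (n * (2 * n * K)) + 2 * n * CD) * L ≤ C3 * L :=
    mul_le_mul_of_nonneg_right (by linarith) hL
  have h6 : n * (n * (n * (2 * β * R)) * 2 + 1) * ε ≤ C3 * ε :=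
    mul_le_mul_of_nonneg_right (by linarith) hε
  linarith

lemma exists_good_pt {n : ℕ} (hn : 0 < n) {ι : Type*} (N : Finset ι) (bad : ι → Set (EuclideanSpace ℝ (Fin n)))
    {η : ℝ} (hη : 0 ≤ η) (hbs : ∀ i ∈ N, bad i ⊆ Metric.ball 0 (1/2)) (hb : ∀ i ∈ N, volume.real (bad i) ≤ η)
    (hN : N.card * η < volume.real (Metric.ball (0 : EuclideanSpace ℝ (Fin n)) (1/2))) :
    ∃ x ∈ Metric.ball (0 : EuclideanSpace ℝ (Fin n)) (1/2), ∀ i ∈ N, x ∉ bad i := by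
  by_contra hcon
  push Not at hcon
  have h1 : Metric.ball (0 : EuclideanSpace ℝ (Fin n)) (1/2) ⊆ ⋃ i ∈ N, bad i := by
    intro x hx
    obtain ⟨i, hi, hxi⟩ := hcon x hx
    exact Set.mem_biUnion hi hxi
  have hfin : volume (⋃ i ∈ N, bad i) ≠ ⊤ := by
    refine ne_top_of_le_ne_top (measure_ball_lt_top (x := (0 : EuclideanSpace ℝ (Fin n))) (r := 1/2)).ne
      (measure_mono ?_)
    exact Set.iUnion₂_subset hbs
  have h2 := measureReal_mono h1 hfin
  have h3 := measureReal_biUnion_finset_le (μ := (volume : Measure (EuclideanSpace ℝ (Fin n)))) N bad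
  have h4 : ∑ i ∈ N, volume.real (bad i) ≤ N.card * η := by
    refine (Finset.sum_le_sum hb).trans ?_
    simp
  linarith
end PartC7

section PartC8
open Filter Topology MeasureTheory Matrix
open scoped ContDiff

set_option maxHeartbeats 1000000 in
lemma one_scale (n : ℕ) (hn : 2 ≤ n) (lam M' K : ℝ) (hlam : 0 < lam) (hM' : 0 < M') (hK : 0 ≤ K)
    (ε : ℝ) (hε : 0 < ε) :
    ∃ (N : Finset (Fin n → ℝ)) (c δ r0 W : ℝ), 0 < c ∧ 0 < δ ∧ 0 < r0 ∧ r0 ≤ 1 ∧ 0 ≤ W ∧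
      (∀ (L : ℝ) (x0 : EuclideanSpace ℝ (Fin n)) (r : ℝ)
      (h : EuclideanSpace ℝ (Fin n) → ℝ) (a : EuclideanSpace ℝ (Fin n) → Matrix (Fin n) (Fin n) ℝ)
      (b : EuclideanSpace ℝ (Fin n) → ℝ), Sol n lam M' K L x0 r h a b →
        ∀ x ∈ Metric.ball x0 r, ∀ ξ ∈ N, |wf h c ξ x| ≤ W) ∧
      (∀ (L : ℝ)
      (h : EuclideanSpace ℝ (Fin n) → ℝ) (a : EuclideanSpace ℝ (Fin n) → Matrix (Fin n) (Fin n) ℝ)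
      (b : EuclideanSpace ℝ (Fin n) → ℝ), 0 ≤ L → L ≤ r0 → Sol n lam M' K L 0 1 h a b →
        (∀ ξ ∈ N, ∃ S : ℝ, (∀ x ∈ Metric.ball (0 : EuclideanSpace ℝ (Fin n)) 1, wf h c ξ x ≤ S) ∧
          ∃ y ∈ Metric.ball (0 : EuclideanSpace ℝ (Fin n)) (1/4), S - δ ≤ wf h c ξ y) →
        ∀ x ∈ Metric.ball (0 : EuclideanSpace ℝ (Fin n)) 1,
        ∀ x' ∈ Metric.ball (0 : EuclideanSpace ℝ (Fin n)) 1, ∀ i j, |Hm h x i j - Hm h x' i j| ≤ ε) := by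
  obtain ⟨c, c0, hc, hc1, hc0, hkey⟩ := key_ineq n lam M' (K+1) hlam hM' (by linarith)
  obtain ⟨R, C3, hR, hC3, hosc⟩ := osc_pt n lam M' K c c0 hlam hM' hK hc hc1 hkey
  obtain ⟨Lam', C2, hLam', hC2, hDG⟩ := DG_of_Sol n lam M' K c c0 R hlam hM' hK hc hc0 hR hkey
  obtain ⟨ε1, hε1d⟩ : ∃ e : ℝ, e = c0 * (ε/2)^2 / (2 * C3) := ⟨_, rfl⟩
  have hε1 : 0 < ε1 := by rw [hε1d]; positivity
  have hε1' : C3 * (ε1 + ε1) = c0 * (ε/2)^2 := by rw [hε1d]; field_simp; ring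
  obtain ⟨N, hN, hnet⟩ := exists_net n R ε1 hR hε1
  have hvB : 0 < volume.real (Metric.ball (0:EuclideanSpace ℝ (Fin n)) (1/2)) :=
    ENNReal.toReal_pos (Metric.measure_ball_pos _ _ (by norm_num)).ne' measure_ball_lt_top.ne
  set vB := volume.real (Metric.ball (0:EuclideanSpace ℝ (Fin n)) (1/2)) with hvBd
  obtain ⟨η, hηd⟩ : ∃ η : ℝ, η = vB / (2 * (N.card + 1)) := ⟨_, rfl⟩
  have hη : 0 < η := by rw [hηd]; positivity
  have hη' : N.card * η < vB := by
    rw [hηd, ← mul_div_assoc, div_lt_iff₀ (by positivity)]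
    nlinarith [(Nat.cast_nonneg N.card : (0:ℝ) ≤ N.card)]
  obtain ⟨δ, hδ, hML⟩ := ML n hn (lam/2) Lam' ε1 η (by linarith) hLam' hε1 hη
  have hnn : (0:ℝ) ≤ n := Nat.cast_nonneg n
  refine ⟨N, c, δ, min 1 (min ε1 (δ/C2)), n * (R * (n * (n / c * R))), hc, hδ, by positivity, min_le_left _ _,
    by positivity, ?_, ?_⟩
  · intro L x0 r h a b S x hx ξ hξ
    exact abs_sum_mul_le' _ _ _ _ (hN ξ hξ) (fun p => et_bd S hc hx (hN ξ hξ) p)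
  · intro L h a b hL hLr S hS
    have hL1 : L ≤ 1 := hLr.trans (min_le_left _ _)
    have hLε : L ≤ ε1 := hLr.trans ((min_le_right _ _).trans (min_le_left _ _))
    have hLδ : C2 * L ≤ δ := by
      have := hLr.trans ((min_le_right _ _).trans (min_le_right _ _))
      rw [le_div_iff₀ hC2] at this; linarith
    choose! Sf hSf hSy using hS
    have hbad := exists_good_pt (n := n) (by omega) N
      (fun ξ => {x | x ∈ Metric.ball (0:EuclideanSpace ℝ (Fin n)) (1/2) ∧ wf h c ξ x ≤ Sf ξ - ε1}) hη.le
      (fun ξ _ x hx => hx.1) (fun ξ hξ => by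
        obtain ⟨y, hy, hy2⟩ := hSy ξ hξ
        exact hML _ _ _ _ (hDG L 0 1 h a b ξ hL hL1 S (hN ξ hξ)) (by positivity) hLδ (hSf ξ hξ) y hy hy2) hη'
    obtain ⟨x1, hx1, hgood⟩ := hbad
    have hx1' : x1 ∈ Metric.ball (0:EuclideanSpace ℝ (Fin n)) 1 :=
      Metric.ball_subset_ball (by norm_num) hx1
    have hw : ∀ x ∈ Metric.ball (0 : EuclideanSpace ℝ (Fin n)) 1, ∀ ξ ∈ N, wf h c ξ x ≤ wf h c ξ x1 + ε1 := by
      intro x hx ξ hξ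
      have h1 := hgood ξ hξ
      have h2 : ¬ (wf h c ξ x1 ≤ Sf ξ - ε1) := fun h3 => h1 ⟨hx1, h3⟩
      push Not at h2
      linarith [hSf ξ hξ x hx]
    have hfin : ∀ x ∈ Metric.ball (0 : EuclideanSpace ℝ (Fin n)) 1, ∀ i j, |Hm h x i j - Hm h x1 i j| ≤ ε/2 := by
      intro x hx i j
      have h1 := hosc L h a b hL S N ε1 hε1.le hN hnet x hx x1 hx1' (hw x hx)
      have h2 : c0 * fsq (Hm h x - Hm h x1) ≤ c0 * (ε/2)^2 := by
        rw [← hε1']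
        refine h1.trans (mul_le_mul_of_nonneg_left (by linarith) hC3.le)
      have h3 := le_of_mul_le_mul_left h2 hc0
      have h4 := abs_entry_le_sqrt_fsq (Hm h x - Hm h x1) i j
      rw [Matrix.sub_apply] at h4
      refine h4.trans ?_
      rw [Real.sqrt_le_left (by linarith)]
      exact h3
    intro x hx x' hx' i j
    have h1 := hfin x hx i j
    have h2 := hfin x' hx' i j
    rw [abs_le] at *
    constructor <;> linarith [h1.1, h1.2, h2.1, h2.2]

set_option maxHeartbeats 1000000 in
lemma Mod2 (n : ℕ) (hn : 2 ≤ n) (lam M' K : ℝ) (hlam : 0 < lam) (hM' : 0 < M') (hK : 0 ≤ K)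
    (ε : ℝ) (hε : 0 < ε) : ∃ ρ : ℝ, 0 < ρ ∧ ρ ≤ 1 ∧ ∀ (L : ℝ)
      (h : EuclideanSpace ℝ (Fin n) → ℝ) (a : EuclideanSpace ℝ (Fin n) → Matrix (Fin n) (Fin n) ℝ)
      (b : EuclideanSpace ℝ (Fin n) → ℝ), 0 ≤ L → L ≤ 1 → Sol n lam M' K L 0 1 h a b →
      ∀ x ∈ Metric.ball (0 : EuclideanSpace ℝ (Fin n)) ρ,
      ∀ x' ∈ Metric.ball (0 : EuclideanSpace ℝ (Fin n)) ρ, ∀ i j, |Hm h x i j - Hm h x' i j| ≤ ε := by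
  obtain ⟨N, c, δ, r0, W, hc, hδ, hr0, hr01, hW, hbd, hone⟩ := one_scale n hn lam M' K hlam hM' hK ε hε
  obtain ⟨J, hJ⟩ := exists_nat_gt (2 * W * N.card / δ)
  set rr : ℕ → ℝ := fun j => r0 * (1/4)^j with hrr
  have hrr0 : ∀ j, 0 < rr j := fun j => by positivity
  have hrrs : ∀ j, rr (j+1) = rr j * (1/4) := fun j => by simp only [hrr, pow_succ]; ring
  have hanti : Antitone rr := antitone_nat_of_succ_le fun j => by rw [hrrs]; linarith [hrr0 j]
  have hrr1 : ∀ j, rr j ≤ r0 := fun j => by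
    have := hanti (Nat.zero_le j); simpa [hrr] using this
  refine ⟨rr J, hrr0 J, (hrr1 J).trans hr01, ?_⟩
  intro L h a b hL hL1 S
  have hsub : ∀ j, Metric.ball (0 : EuclideanSpace ℝ (Fin n)) (rr j) ⊆ Metric.ball 0 1 := fun j =>
    Metric.ball_subset_ball ((hrr1 j).trans hr01)
  set Sj : ℕ → (Fin n → ℝ) → ℝ := fun j ξ => sSup (wf h c ξ '' Metric.ball 0 (rr j)) with hSj
  have hbb : ∀ j, ∀ ξ ∈ N, BddAbove (wf h c ξ '' Metric.ball 0 (rr j)) := by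
    intro j ξ hξ
    refine ⟨W, ?_⟩
    rintro _ ⟨x, hx, rfl⟩
    exact (abs_le.1 (hbd L 0 1 h a b S x (hsub j hx) ξ hξ)).2
  have hne : ∀ j ξ, (wf h c ξ '' Metric.ball (0 : EuclideanSpace ℝ (Fin n)) (rr j)).Nonempty := fun j ξ =>
    ⟨_, Set.mem_image_of_mem _ (Metric.mem_ball_self (hrr0 j))⟩
  have hSle : ∀ j, ∀ ξ ∈ N, ∀ x ∈ Metric.ball (0 : EuclideanSpace ℝ (Fin n)) (rr j), wf h c ξ x ≤ Sj j ξ :=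
    fun j ξ hξ x hx => le_csSup (hbb j ξ hξ) (Set.mem_image_of_mem _ hx)
  -- a good scale exists
  have hgood : ∃ j ≤ J, ∀ ξ ∈ N, ∃ y ∈ Metric.ball (0 : EuclideanSpace ℝ (Fin n)) (rr (j+1)),
      Sj j ξ - δ ≤ wf h c ξ y := by
    by_contra hcon
    push Not at hcon
    have hmono : ∀ j, ∀ ξ ∈ N, Sj (j+1) ξ ≤ Sj j ξ := fun j ξ hξ =>
      csSup_le_csSup (hbb j ξ hξ) (hne _ _) (Set.image_mono (Metric.ball_subset_ball (hanti (Nat.le_succ j))))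
    have hstep : ∀ j ≤ J, ∑ ξ ∈ N, Sj (j+1) ξ ≤ ∑ ξ ∈ N, Sj j ξ - δ := by
      intro j hj
      obtain ⟨ξ, hξ, hy⟩ := hcon j hj
      have h1 : Sj (j+1) ξ ≤ Sj j ξ - δ := by
        refine csSup_le (hne _ _) ?_
        rintro _ ⟨x, hx, rfl⟩
        exact (hy x hx).le
      rw [← Finset.add_sum_erase N _ hξ, ← Finset.add_sum_erase N (fun ξ => Sj j ξ) hξ]
      have h2 := Finset.sum_le_sum fun ζ (hζ : ζ ∈ N.erase ξ) => hmono j ζ (Finset.mem_of_mem_erase hζ)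
      linarith
    have hind : ∀ j ≤ J + 1, ∑ ξ ∈ N, Sj j ξ ≤ ∑ ξ ∈ N, Sj 0 ξ - j * δ := by
      intro j
      induction j with
      | zero => intro _; simp
      | succ k ih =>
        intro hk
        have h1 := ih (by omega)
        have h2 := hstep k (by omega)
        push_cast
        linarith
    have h1 := hind J (by omega)
    have h2 : ∑ ξ ∈ N, Sj 0 ξ ≤ N.card * W := by
      refine (Finset.sum_le_sum (g := fun _ => W) fun ξ hξ => csSup_le (hne _ _) ?_).trans (by simp)
      rintro _ ⟨x, hx, rfl⟩
      exact (abs_le.1 (hbd L 0 1 h a b S x (hsub 0 hx) ξ hξ)).2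
    have h3 : -(N.card * W) ≤ ∑ ξ ∈ N, Sj J ξ := by
      refine le_trans (by simp) (Finset.sum_le_sum (f := fun _ => -W) fun ξ hξ => ?_)
      exact (abs_le.1 (hbd L 0 1 h a b S 0 (hsub J (Metric.mem_ball_self (hrr0 J))) ξ hξ)).1.trans
        (hSle J ξ hξ 0 (Metric.mem_ball_self (hrr0 J)))
    rw [div_lt_iff₀ hδ] at hJ
    linarith
  obtain ⟨j, hj, hy⟩ := hgood
  have SS := S.rescale (hrr0 j) (hsub j)
  have hres := hone (L * rr j) _ _ _ (mul_nonneg hL (hrr0 j).le)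
    (by nlinarith [hrr1 j, hrr0 j]) SS (fun ξ hξ => ⟨Sj j ξ, fun x hx => by
      rw [wf_resc S.hh 0 (hrr0 j)]
      exact hSle j ξ hξ _ (mem_ball_affine (hrr0 j) le_rfl hx), by
      obtain ⟨y, hyb, hyS⟩ := hy ξ hξ
      refine ⟨(rr j)⁻¹ • y, ?_, ?_⟩
      · rw [mem_ball_zero_iff] at hyb ⊢
        rw [norm_smul, norm_inv, Real.norm_of_nonneg (hrr0 j).le, inv_mul_lt_iff₀ (hrr0 j), ← hrrs]
        exact hyb
      · rw [wf_resc S.hh 0 (hrr0 j), smul_smul, mul_inv_cancel₀ (hrr0 j).ne', one_smul, zero_add]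
        exact hyS⟩)
  have hback : ∀ x ∈ Metric.ball (0 : EuclideanSpace ℝ (Fin n)) (rr J),
      (rr j)⁻¹ • x ∈ Metric.ball (0 : EuclideanSpace ℝ (Fin n)) 1 ∧
      Hm (resc h 0 (rr j)) ((rr j)⁻¹ • x) = Hm h x := by
    intro x hx
    constructor
    · rw [mem_ball_zero_iff] at hx ⊢
      rw [norm_smul, norm_inv, Real.norm_of_nonneg (hrr0 j).le, inv_mul_lt_iff₀ (hrr0 j), mul_one]
      exact hx.trans_le (hanti hj)
    · rw [Hm_resc S.hh 0 (hrr0 j), smul_smul, mul_inv_cancel₀ (hrr0 j).ne', one_smul, zero_add]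
  intro x hx x' hx' i k
  have := hres _ (hback x hx).1 _ (hback x' hx').1 i k
  rwa [(hback x hx).2, (hback x' hx').2] at this
end PartC8

section PartD1
open Filter Topology MeasureTheory Matrix
open scoped ContDiff

section D1
variable {n : ℕ}
local notation "E" => EuclideanSpace ℝ (Fin n)

/-- averaging of `f` against the kernel `G` -/
noncomputable def IK (f G : E → ℝ) (y : E) (τ : ℝ) : ℝ := ∫ z, f (y + τ • z) * G z

/-- smooth kernels supported in the unit ball -/
structure IsKer (G : EuclideanSpace ℝ (Fin n) → ℝ) : Prop where
  sm : ContDiff ℝ ∞ G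
  su : tsupport G ⊆ Metric.closedBall 0 1

lemma IsKer.cpt {G : E → ℝ} (hG : IsKer G) : HasCompactSupport G :=
  (isCompact_closedBall (0:E) 1).of_isClosed_subset (isClosed_tsupport _) hG.su

lemma IsKer.pd {G : E → ℝ} (hG : IsKer G) (l : Fin n) : IsKer (pd l G) :=
  ⟨contDiff_pd hG.sm l, (tsupport_pd_subset G l).trans hG.su⟩

lemma IsKer.zero {G : E → ℝ} (hG : IsKer G) {z : E} (hz : 1 < ‖z‖) : G z = 0 := by
  by_contra h
  have := hG.su (subset_tsupport _ h)
  rw [mem_closedBall_zero_iff] at this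
  linarith

lemma IsKer.int_mul {G f : E → ℝ} (hG : IsKer G) (hf : Continuous f) : Integrable (fun z => f z * G z) :=
  Continuous.integrable_of_hasCompactSupport (hf.mul hG.sm.continuous) hG.cpt.mul_left

lemma IsKer.int {G : E → ℝ} (hG : IsKer G) : Integrable G :=
  Continuous.integrable_of_hasCompactSupport hG.sm.continuous hG.cpt

lemma IK_bound {f G : E → ℝ} (hG : IsKer G) {y : E} {τ S : ℝ}
    (h : ∀ z : E, ‖z‖ ≤ 1 → |f (y + τ • z)| ≤ S) : |IK f G y τ| ≤ S * ∫ z, |G z| := by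
  unfold IK
  rw [← integral_const_mul, ← Real.norm_eq_abs]
  refine norm_integral_le_of_norm_le (hG.int.abs.const_mul S) (Eventually.of_forall fun z => ?_)
  rw [Real.norm_eq_abs, abs_mul]
  rcases le_or_gt ‖z‖ 1 with hz | hz
  · exact mul_le_mul_of_nonneg_right (h z hz) (abs_nonneg _)
  · rw [hG.zero hz]; simp

lemma IK_ibp {f G : E → ℝ} (hf : ContDiff ℝ 1 f) (hG : IsKer G) (l : Fin n) (y : E) (τ : ℝ) :
    τ * IK (pd l f) G y τ = - IK f (pd l G) y τ := by
  unfold IK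
  have hF := contDiff_affine hf y τ
  have e : ∀ z, τ * (pd l f (y + τ • z) * G z) = pd l (fun z => f (y + τ • z)) z * G z := by
    intro z
    rw [pd_affine y τ z ((hf.differentiable one_ne_zero) _)]; ring
  rw [← integral_const_mul]
  simp_rw [e]
  have := integral_mul_fderiv_eq_neg_fderiv_mul_of_integrable (μ := (volume : Measure E))
    (f := fun z => f (y + τ • z)) (g := G) (v := EuclideanSpace.single l 1)
    (hG.int_mul (continuous_pd hF l)) ((hG.pd l).int_mul hF.continuous) (hG.int_mul hF.continuous)
    (fun x _ => (hF.differentiable one_ne_zero) x) (fun x _ => (hG.sm.differentiable (by norm_cast)) x)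
  have t : ∀ u v : ℝ, u = - v → v = - u := by intro u v h; linarith
  exact t _ _ this

lemma IK_deriv_gen {f G : E → ℝ} (hf : ContDiff ℝ 1 f) (hG : IsKer G) (p q : E → E) (hp : Continuous p)
    (hq : Continuous q) (s : ℝ) :
    HasDerivAt (fun s : ℝ => ∫ z, f (p z + s • q z) * G z) (∫ z, fderiv ℝ f (p z + s • q z) (q z) * G z) s := by
  have hc : Continuous fun w : ℝ × E => fderiv ℝ f (p w.2 + w.1 • q w.2) (q w.2) * G w.2 := by
    have h1 := hf.continuous_fderiv one_ne_zero
    have h2 := hG.sm.continuous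
    have h3 : Continuous fun w : ℝ × E => fderiv ℝ f (p w.2 + w.1 • q w.2) :=
      h1.comp (by fun_prop)
    exact (h3.clm_apply (by fun_prop)).mul (by fun_prop)
  obtain ⟨B, hB⟩ := ((isCompact_closedBall s 1).prod (isCompact_closedBall (0:E) 1)).exists_bound_of_continuousOn
    hc.continuousOn
  have hfc := hf.continuous
  refine (hasDerivAt_integral_of_dominated_loc_of_deriv_le (s := Metric.closedBall s 1)
    (bound := Set.indicator (Metric.closedBall (0:E) 1) (fun _ => B))
    (F := fun s z => f (p z + s • q z) * G z)
    (F' := fun s z => fderiv ℝ f (p z + s • q z) (q z) * G z) (Metric.closedBall_mem_nhds s one_pos)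
    (Eventually.of_forall fun t => ?_) (hG.int_mul (by fun_prop)) ?_ (Eventually.of_forall ?_) ?_ (Eventually.of_forall ?_)).2
  · exact (hG.int_mul (f := fun z => f (p z + t • q z)) (by fun_prop)).aestronglyMeasurable
  · exact (hc.comp (by fun_prop : Continuous fun z : E => ((s, z) : ℝ × E))).aestronglyMeasurable
  · intro z t ht
    by_cases hz : z ∈ Metric.closedBall (0:E) 1
    · rw [Set.indicator_of_mem hz]
      exact hB (t, z) ⟨ht, hz⟩
    · rw [Set.indicator_of_notMem hz]
      rw [mem_closedBall_zero_iff, not_le] at hz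
      rw [hG.zero hz]; simp
  · exact (integrable_indicator_iff measurableSet_closedBall).2
      (integrableOn_const (isCompact_closedBall (0:E) 1).measure_lt_top.ne)
  · intro z t ht
    have h1 : HasDerivAt (fun s : ℝ => p z + s • q z) (q z) t := by
      simpa using ((hasDerivAt_id t).smul_const (q z)).const_add (p z)
    have h2 := ((hf.differentiable one_ne_zero) (p z + t • q z)).hasFDerivAt.comp_hasDerivAt t h1
    exact h2.mul_const (G z)

lemma IK_deriv_tau {f G : E → ℝ} (hf : ContDiff ℝ 1 f) (hG : IsKer G) (y : E) (τ : ℝ) :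
    HasDerivAt (IK f G y) (∑ l, IK (pd l f) (fun z => z l * G z) y τ) τ := by
  have h := IK_deriv_gen hf hG (fun _ => y) (fun z => z) continuous_const continuous_id τ
  convert h using 1
  · rfl
  unfold IK
  rw [← integral_finsetSum]
  · refine integral_congr_ae (Eventually.of_forall fun z => ?_)
    simp only
    rw [clm_apply_eq_sum, Finset.sum_mul]
    refine Finset.sum_congr rfl fun l _ => ?_
    unfold pd; ring
  · intro l _
    have := hG.int_mul (f := fun z : E => pd l f (y + τ • z) * z l)
      (((continuous_pd hf l).comp (by fun_prop)).mul (by fun_prop))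
    refine this.congr (Eventually.of_forall fun z => ?_)
    simp only; ring

lemma IK_deriv_y {f G : E → ℝ} (hf : ContDiff ℝ 1 f) (hG : IsKer G) (y : E) (τ s : ℝ) :
    HasDerivAt (fun s : ℝ => IK f G (s • y) τ) (∑ l, y l * IK (pd l f) G (s • y) τ) s := by
  have h := IK_deriv_gen hf hG (fun z => τ • z) (fun _ => y) (by fun_prop) continuous_const s
  convert h using 1
  · ext s; unfold IK; simp_rw [add_comm]
  unfold IK
  simp_rw [← integral_const_mul]
  rw [← integral_finsetSum]
  · refine integral_congr_ae (Eventually.of_forall fun z => ?_)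
    simp only
    rw [clm_apply_eq_sum, Finset.sum_mul]
    refine Finset.sum_congr rfl fun l _ => ?_
    unfold pd; rw [add_comm]; ring
  · intro l _
    exact (hG.int_mul (f := fun z : E => pd l f (s • y + τ • z))
      ((continuous_pd hf l).comp (by fun_prop))).const_mul _

lemma exists_ker (hn : 0 < n) : ∃ k ρ : E → ℝ, IsKer k ∧ IsKer ρ ∧ (∀ l z, pd l k z = -(z l * ρ z)) ∧
    ∫ z, ρ z = 1 := by
  have hσ : ContDiff ℝ ∞ Real.smoothTransition := Real.smoothTransition.contDiff
  have hσ' : ContDiff ℝ ∞ (deriv Real.smoothTransition) := by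
    have := (contDiff_infty_iff_deriv (f := Real.smoothTransition)).1 hσ
    exact this.2
  have hq : ContDiff ℝ ∞ (fun z : E => 1 - ‖z‖^2) := contDiff_const.sub (contDiff_norm_sq ℝ)
  have hsu : ∀ g : ℝ → ℝ, (∀ s < 0, g s = 0) → tsupport (fun z : E => g (1 - ‖z‖^2)) ⊆ Metric.closedBall 0 1 := by
    intro g hg
    refine closure_minimal (fun z hz => ?_) Metric.isClosed_closedBall
    rw [mem_closedBall_zero_iff]
    by_contra hc
    push Not at hc
    exact hz (hg _ (by nlinarith))
  have hd0 : ∀ s < 0, deriv Real.smoothTransition s = 0 := by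
    intro s hs
    have : Real.smoothTransition =ᶠ[𝓝 s] fun _ => 0 := by
      filter_upwards [Iio_mem_nhds hs] with t ht
      exact Real.smoothTransition.zero_of_nonpos (le_of_lt ht)
    rw [this.deriv_eq]; simp
  have hmono : Monotone Real.smoothTransition := Real.smoothTransition.monotone
  have hd : ∀ s, 0 ≤ deriv Real.smoothTransition s := fun s => hmono.deriv_nonneg
  have hρ0 : IsKer (fun z : E => deriv Real.smoothTransition (1 - ‖z‖^2)) := ⟨hσ'.comp hq, hsu _ hd0⟩
  obtain ⟨c, hc, hcs⟩ := exists_deriv_eq_slope Real.smoothTransition zero_lt_one hσ.continuous.continuousOn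
    (hσ.differentiable (by norm_cast)).differentiableOn
  have hpos : 0 < ∫ z : E, deriv Real.smoothTransition (1 - ‖z‖^2) := by
    refine Continuous.integral_pos_of_hasCompactSupport_nonneg_nonzero (x := EuclideanSpace.single ⟨0, hn⟩ (√(1 - c)))
      hρ0.sm.continuous hρ0.cpt (fun z => hd _) ?_
    have : (1 - ‖(EuclideanSpace.single (⟨0, hn⟩ : Fin n) (√(1 - c)) : E)‖^2) = c := by
      simp [Real.sq_sqrt (by linarith [hc.2] : 0 ≤ 1 - c)]
    rw [this, hcs]
    simp
  obtain ⟨I, hI⟩ : ∃ I : ℝ, I = ∫ z : E, deriv Real.smoothTransition (1 - ‖z‖^2) := ⟨_, rfl⟩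
  rw [← hI] at hpos
  refine ⟨fun z => (2*I)⁻¹ * Real.smoothTransition (1 - ‖z‖^2), fun z => I⁻¹ * deriv Real.smoothTransition (1 - ‖z‖^2), ?_, ?_, ?_, ?_⟩
  · exact ⟨contDiff_const.mul (hσ.comp hq), hsu (fun s => (2*I)⁻¹ * Real.smoothTransition s) fun s hs => by
      rw [Real.smoothTransition.zero_of_nonpos hs.le, mul_zero]⟩
  · exact ⟨contDiff_const.mul (hσ'.comp hq), hsu (fun s => I⁻¹ * deriv Real.smoothTransition s) fun s hs => by
      rw [hd0 s hs, mul_zero]⟩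
  · intro l z
    have h1 : HasFDerivAt (fun z : E => 1 - ‖z‖^2) (-(2 • innerSL ℝ z)) z := by
      simpa using ((hasStrictFDerivAt_norm_sq z).hasFDerivAt).const_sub 1
    have h2 : HasFDerivAt (fun z : E => (2*I)⁻¹ * Real.smoothTransition (1 - ‖z‖^2)) _ z :=
      (((hσ.differentiable (by norm_cast)) (1 - ‖z‖^2)).hasDerivAt.comp_hasFDerivAt z h1).const_mul (2*I)⁻¹
    rw [pd_eq_of_hasFDerivAt h2]
    have h3 : (innerSL ℝ z) (EuclideanSpace.single l 1) = z l := by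
      simp [EuclideanSpace.inner_single_right]
    simp only [_root_.smul_apply, _root_.neg_apply, h3, smul_eq_mul, nsmul_eq_mul]
    have h4 : ((2:ℕ):ℝ) = 2 := by norm_num
    rw [h4]
    field_simp
  · rw [integral_const_mul, ← hI]; field_simp

end D1
end PartD1

section PartD2
open Filter Topology MeasureTheory Matrix
open scoped ContDiff

section D2
variable {n : ℕ}
local notation "E" => EuclideanSpace ℝ (Fin n)

/-- Laplacian -/
noncomputable def lapl (u : E → ℝ) : E → ℝ := fun x => ∑ l, pd l (pd l u) x

lemma contDiff_lapl {u : E → ℝ} (hu : ContDiff ℝ ∞ u) : ContDiff ℝ ∞ (lapl u) :=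
  ContDiff.sum fun l _ => contDiff_pd (contDiff_pd hu l) l

lemma pd_sum_fun {ι : Type*} (s : Finset ι) {f : ι → E → ℝ} (hf : ∀ i ∈ s, Differentiable ℝ (f i)) (l : Fin n) (x : E) :
    pd l (fun y => ∑ i ∈ s, f i y) x = ∑ i ∈ s, pd l (f i) x := by
  have := pd_eq_of_hasFDerivAt (HasFDerivAt.fun_sum (u := s) fun i hi => (hf i hi x).hasFDerivAt) l
  rw [this]; simp [pd, _root_.sum_apply]

lemma pd_lapl {u : E → ℝ} (hu : ContDiff ℝ ∞ u) (j : Fin n) : pd j (lapl u) = lapl (pd j u) := by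
  ext x
  unfold lapl
  rw [pd_sum_fun _ (fun l _ => (contDiff_pd (contDiff_pd hu l) l).differentiable (by norm_cast))]
  refine Finset.sum_congr rfl fun l _ => ?_
  rw [pd_comm (contDiff_pd hu l) j l, pd_comm hu j l]

lemma cd1 {f : E → ℝ} (hf : ContDiff ℝ ∞ f) : ContDiff ℝ 1 f := hf.of_le (by norm_cast)

/-- the derivative of the mean of a second derivative in the scale -/
lemma IK_scale {u k ρ : E → ℝ} (hu : ContDiff ℝ ∞ u) (hk : IsKer k) (hρ : IsKer ρ)
    (hkρ : ∀ l z, pd l k z = -(z l * ρ z)) (i j : Fin n) (y : E) {τ : ℝ} (hτ : 0 < τ) :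
    HasDerivAt (IK (pd i (pd j u)) ρ y) (- IK (pd j (lapl u)) (pd i k) y τ) τ := by
  have h := IK_deriv_tau (cd1 (contDiff_pd (contDiff_pd hu j) i)) hρ y τ
  convert h using 1
  have e1 : ∀ l, IK (pd l (pd i (pd j u))) (fun z => z l * ρ z) y τ = - IK (pd l (pd l (pd j u))) (pd i k) y τ := by
    intro l
    have h0 : IK (pd l (pd i (pd j u))) (fun z => z l * ρ z) y τ = - IK (pd i (pd l (pd j u))) (pd l k) y τ := by
      rw [pd_comm (contDiff_pd hu j) l i]
      unfold IK
      rw [← integral_neg]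
      congr 1; ext z; rw [hkρ]; ring
    have h1 := IK_ibp (cd1 (contDiff_pd (contDiff_pd hu j) l)) (hk.pd l) i y τ
    have h2 := IK_ibp (cd1 (contDiff_pd (contDiff_pd hu j) l)) (hk.pd i) l y τ
    rw [pd_comm hk.sm i l, ← h2] at h1
    rw [h0, mul_left_cancel₀ hτ.ne' h1]
  simp_rw [e1, pd_lapl hu]
  rw [Finset.sum_neg_distrib]
  congr 1
  unfold IK lapl
  rw [← integral_finsetSum]
  · congr 1; ext z; rw [Finset.sum_mul]
  · intro l _
    exact (hk.pd i).int_mul (f := fun z : E => pd l (pd l (pd j u)) (y + τ • z))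
      ((contDiff_pd (contDiff_pd (contDiff_pd hu j) l) l).continuous.comp (by fun_prop))

lemma pd_sub_const {f : E → ℝ} (c : ℝ) (l : Fin n) : pd l (fun y => f y - c) = pd l f := by
  ext x; unfold pd; rw [fderiv_sub_const]

lemma IK_lapl {f k : E → ℝ} (hf : ContDiff ℝ ∞ f) (hk : IsKer k) (i j : Fin n) (y : E) {τ H α : ℝ} (hτ : 0 < τ)
    (hα : 0 < α) (hH : 0 ≤ H) (h : ∀ z : E, ‖z‖ ≤ 1 → |f (y + τ • z) - f y| ≤ H * ‖τ • z‖^α) :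
    |IK (pd j f) (pd i k) y τ| ≤ H * (∫ z, |pd j (pd i k) z|) * τ^(α-1) := by
  have h1 := IK_ibp (cd1 (hf.sub (contDiff_const (c := f y)))) (hk.pd i) j y τ
  rw [show (fun x => f x - f y) = (fun x => f x - f y) from rfl, pd_sub_const] at h1
  have h2 : |IK (fun x => f x - f y) (pd j (pd i k)) y τ| ≤ (H * τ^α) * ∫ z, |pd j (pd i k) z| := by
    refine IK_bound ((hk.pd i).pd j) fun z hz => (h z hz).trans ?_
    refine mul_le_mul_of_nonneg_left (Real.rpow_le_rpow (norm_nonneg _) ?_ hα.le) hH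
    rw [norm_smul, Real.norm_of_nonneg hτ.le]
    exact mul_le_of_le_one_right hτ.le hz
  rw [← abs_neg, ← h1, abs_mul, abs_of_pos hτ] at h2
  rw [Real.rpow_sub_one hτ.ne', ← mul_div_assoc, le_div_iff₀ hτ]
  linarith

lemma IK_lapl2 {f k : E → ℝ} (hf : ContDiff ℝ ∞ f) (hk : IsKer k) (i j l : Fin n) (y : E) {τ H α : ℝ} (hτ : 0 < τ)
    (hα : 0 < α) (hH : 0 ≤ H) (h : ∀ z : E, ‖z‖ ≤ 1 → |f (y + τ • z) - f y| ≤ H * ‖τ • z‖^α) :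
    |IK (pd j (pd l f)) (pd i k) y τ| ≤ H * (∫ z, |pd l (pd j (pd i k)) z|) * τ^(α-2) := by
  have h1 := IK_ibp (cd1 (contDiff_pd hf l)) (hk.pd i) j y τ
  have h3 := IK_lapl hf (hk.pd i) j l y hτ hα hH h
  rw [← abs_neg, ← h1, abs_mul, abs_of_pos hτ] at h3
  have e : τ^(α-1) = τ^(α-2) * τ := by
    rw [← Real.rpow_add_one hτ.ne']; ring_nf
  rw [e] at h3
  refine le_of_mul_le_mul_left ?_ hτ
  linarith

lemma ode_bd {f f' : ℝ → ℝ} {a b c β : ℝ} (ha : 0 ≤ a) (hab : a ≤ b) (hβ : β ≠ 0) (hg : 0 < β ∨ 0 < a)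
    (hc : ContinuousOn f (Set.Icc a b)) (hd : ∀ τ ∈ Set.Ioo a b, HasDerivAt f (f' τ) τ)
    (hb : ∀ τ ∈ Set.Ioo a b, |f' τ| ≤ c * τ^(β-1)) : |f b - f a| ≤ c * ((b^β - a^β)/β) := by
  have hp : ContinuousOn (fun τ : ℝ => c/β * τ^β) (Set.Icc a b) := by
    refine continuousOn_const.mul (continuousOn_id.rpow_const fun x hx => ?_)
    rcases hg with h | h
    · right; exact h.le
    · left; exact (lt_of_lt_of_le h hx.1).ne'
  have hpd : ∀ τ ∈ Set.Ioo a b, HasDerivAt (fun τ : ℝ => c/β * τ^β) (c * τ^(β-1)) τ := by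
    intro τ hτ
    have := (Real.hasDerivAt_rpow_const (p := β) (Or.inl (lt_of_le_of_lt ha hτ.1).ne')).const_mul (c/β)
    rw [← mul_assoc, div_mul_cancel₀ _ hβ] at this
    exact this
  have m1 : AntitoneOn (fun τ => f τ - c/β * τ^β) (Set.Icc a b) := by
    refine antitoneOn_of_deriv_nonpos (convex_Icc a b) (hc.sub hp) ?_ ?_ <;> rw [interior_Icc] <;> intro τ hτ
    · exact ((hd τ hτ).sub (hpd τ hτ)).differentiableAt.differentiableWithinAt
    · have := ((hd τ hτ).sub (hpd τ hτ)).deriv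
      rw [show (fun τ => f τ - c/β * τ^β) = f - (fun τ => c/β * τ^β) from rfl, this]
      linarith [(abs_le.1 (hb τ hτ)).2]
  have m2 : MonotoneOn (fun τ => f τ + c/β * τ^β) (Set.Icc a b) := by
    refine monotoneOn_of_deriv_nonneg (convex_Icc a b) (hc.add hp) ?_ ?_ <;> rw [interior_Icc] <;> intro τ hτ
    · exact ((hd τ hτ).add (hpd τ hτ)).differentiableAt.differentiableWithinAt
    · have := ((hd τ hτ).add (hpd τ hτ)).deriv
      rw [show (fun τ => f τ + c/β * τ^β) = f + (fun τ => c/β * τ^β) from rfl, this]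
      linarith [(abs_le.1 (hb τ hτ)).1]
  have h1 := m1 (Set.left_mem_Icc.2 hab) (Set.right_mem_Icc.2 hab) hab
  have h2 := m2 (Set.left_mem_Icc.2 hab) (Set.right_mem_Icc.2 hab) hab
  simp only at h1 h2
  have e : c * ((b^β - a^β)/β) = c/β*b^β - c/β*a^β := by ring
  rw [e, abs_le]
  constructor <;> linarith

set_option maxHeartbeats 1000000 in
lemma schauder (n : ℕ) (hn : 0 < n) (α : ℝ) (hα : 0 < α) (hα1 : α < 1) : ∃ C, 0 ≤ C ∧
    ∀ (u : EuclideanSpace ℝ (Fin n) → ℝ) (t H K : ℝ), ContDiff ℝ ∞ u → 0 < t → 0 ≤ H → 0 ≤ K →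
    (∀ z ∈ Metric.ball (0 : EuclideanSpace ℝ (Fin n)) t, ∀ z' ∈ Metric.ball (0 : EuclideanSpace ℝ (Fin n)) t,
      |lapl u z - lapl u z'| ≤ H * ‖z - z'‖^α) →
    (∀ z ∈ Metric.ball (0 : EuclideanSpace ℝ (Fin n)) t, ∀ i j, |pd i (pd j u) z| ≤ K) →
    ∀ y : EuclideanSpace ℝ (Fin n), ‖y‖ ≤ t/4 → ∀ i j,
      |pd i (pd j u) y - pd i (pd j u) 0| ≤ C * (H + K * t^(-α)) * ‖y‖^α := by
  obtain ⟨k, ρ, hk, hρ, hkρ, hρ1⟩ := exists_ker (n := n) hn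
  obtain ⟨D1, hD1, hD1b⟩ : ∃ D, 0 ≤ D ∧ ∀ i j, ∫ z, |pd j (pd i k) z| ≤ D := by
    refine ⟨∑ i, ∑ j, ∫ z, |pd j (pd i k) z|, ?_, fun i j => ?_⟩
    · positivity
    · refine le_trans ?_ (Finset.single_le_sum (f := fun i => ∑ j, ∫ z, |pd j (pd i k) z|) (fun i _ => by positivity) (Finset.mem_univ i))
      exact Finset.single_le_sum (f := fun j => ∫ z, |pd j (pd i k) z|) (fun i _ => by positivity) (Finset.mem_univ j)
  obtain ⟨D2, hD2, hD2b⟩ : ∃ D, 0 ≤ D ∧ ∀ i j l, ∫ z, |pd l (pd j (pd i k)) z| ≤ D := by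
    refine ⟨∑ i, ∑ j, ∑ l, ∫ z, |pd l (pd j (pd i k)) z|, ?_, fun i j l => ?_⟩
    · positivity
    · refine le_trans ?_ (Finset.single_le_sum (f := fun i => ∑ j, ∑ l, ∫ z, |pd l (pd j (pd i k)) z|) (fun i _ => by positivity) (Finset.mem_univ i))
      refine le_trans ?_ (Finset.single_le_sum (f := fun j => ∑ l, ∫ z, |pd l (pd j (pd i k)) z|) (fun i _ => by positivity) (Finset.mem_univ j))
      exact Finset.single_le_sum (f := fun l => ∫ z, |pd l (pd j (pd i k)) z|) (fun i _ => by positivity) (Finset.mem_univ l)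
  obtain ⟨D3, hD3, hD3b⟩ : ∃ D, 0 ≤ D ∧ ∀ l, ∫ z, |pd l ρ z| ≤ D :=
    ⟨∑ l, ∫ z, |pd l ρ z|, by positivity, fun l =>
      Finset.single_le_sum (f := fun l => ∫ z, |pd l ρ z|) (fun i _ => by positivity) (Finset.mem_univ l)⟩
  refine ⟨2 * D1 / α + n * (2 * D3 + D2 / (1 - α)), by have : 0 < 1 - α := by linarith
                                                       positivity, ?_⟩
  intro u t H K hu ht hH hK hlap hbd y hy i j
  have hα' : 0 < 1 - α := by linarith
  by_cases hy0 : y = 0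
  · subst hy0; simp; positivity
  have hyp : 0 < ‖y‖ := norm_pos_iff.2 hy0
  -- Hölder hypothesis
  have hmem : ∀ y' : EuclideanSpace ℝ (Fin n), ‖y'‖ ≤ t/4 → ∀ τ, 0 ≤ τ → τ ≤ t/2 → ∀ z : EuclideanSpace ℝ (Fin n), ‖z‖ ≤ 1 →
      y' + τ • z ∈ Metric.ball (0 : EuclideanSpace ℝ (Fin n)) t := by
    intro y' hy' τ h0 h1 z hz
    rw [mem_ball_zero_iff]
    have := norm_add_le y' (τ • z)
    rw [norm_smul, Real.norm_of_nonneg h0] at this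
    nlinarith
  have hhol : ∀ y' : EuclideanSpace ℝ (Fin n), ‖y'‖ ≤ t/4 → ∀ τ, 0 ≤ τ → τ ≤ t/2 → ∀ z : EuclideanSpace ℝ (Fin n), ‖z‖ ≤ 1 →
      |lapl u (y' + τ • z) - lapl u y'| ≤ H * ‖τ • z‖^α := by
    intro y' hy' τ h0 h1 z hz
    have := hlap _ (hmem y' hy' τ h0 h1 z hz) y' (by rw [mem_ball_zero_iff]; linarith)
    simpa using this
  have hLs := contDiff_lapl hu
  have hw := contDiff_pd (contDiff_pd hu j) i
  -- step 1
  have s1 : ∀ y' : EuclideanSpace ℝ (Fin n), ‖y'‖ ≤ t/4 → |IK (pd i (pd j u)) ρ y' ‖y‖ - pd i (pd j u) y'| ≤ H * D1 * (‖y‖^α/α) := by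
    intro y' hy'
    have h0 : IK (pd i (pd j u)) ρ y' 0 = pd i (pd j u) y' := by
      unfold IK; simp [integral_const_mul, hρ1]
    have := ode_bd (f := IK (pd i (pd j u)) ρ y') (f' := fun τ => - IK (pd j (lapl u)) (pd i k) y' τ)
      (a := 0) (b := ‖y‖) (c := H * D1) (β := α) le_rfl hyp.le hα.ne' (Or.inl hα)
      (fun τ _ => (IK_deriv_tau (cd1 hw) hρ y' τ).continuousAt.continuousWithinAt)
      (fun τ hτ => IK_scale hu hk hρ hkρ i j y' hτ.1) (fun τ hτ => by
        rw [abs_neg]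
        refine (IK_lapl hLs hk i j y' hτ.1 hα hH (hhol y' hy' τ hτ.1.le (by linarith [hτ.2]))).trans ?_
        have := hD1b i j
        have := Real.rpow_nonneg hτ.1.le (α-1)
        gcongr)
    rw [h0, Real.zero_rpow hα.ne', sub_zero] at this
    exact this
  -- step 2
  have s2 : ∀ y' : EuclideanSpace ℝ (Fin n), ‖y'‖ ≤ t/4 → ∀ l, |IK (pd l (pd i (pd j u))) ρ y' ‖y‖| ≤
      2 * D3 * K / t + H * D2 * (‖y‖^(α-1)/(1-α)) := by
    intro y' hy' l
    have e1 : pd l (pd i (pd j u)) = pd i (pd j (pd l u)) := by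
      rw [pd_comm (contDiff_pd hu j) l i, pd_comm hu l j]
    have hul := contDiff_pd hu l
    have h1 : |IK (pd l (pd i (pd j u))) ρ y' (t/2)| ≤ 2 * D3 * K / t := by
      have h1 := IK_ibp (cd1 hw) hρ l y' (t/2)
      have h2 : |IK (pd i (pd j u)) (pd l ρ) y' (t/2)| ≤ K * ∫ z, |pd l ρ z| :=
        IK_bound (hρ.pd l) fun z hz => hbd _ (hmem y' hy' _ (by positivity) le_rfl z hz) i j
      rw [← abs_neg, ← h1, abs_mul, abs_of_pos (by positivity)] at h2
      rw [le_div_iff₀ ht]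
      have := mul_le_mul_of_nonneg_left (hD3b l) hK
      linarith
    have h2 := ode_bd (f := IK (pd l (pd i (pd j u))) ρ y') (f' := fun τ => - IK (pd j (lapl (pd l u))) (pd i k) y' τ)
      (a := ‖y‖) (b := t/2) (c := H * D2) (β := α-1) hyp.le (by linarith) (by linarith) (Or.inr hyp)
      (fun τ _ => (IK_deriv_tau (cd1 (contDiff_pd hw l)) hρ y' τ).continuousAt.continuousWithinAt)
      (fun τ hτ => by
        rw [e1]; exact IK_scale hul hk hρ hkρ i j y' (hyp.trans hτ.1)) (fun τ hτ => by
        have hτ0 : 0 < τ := hyp.trans hτ.1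
        rw [abs_neg, ← pd_lapl hu]
        refine (IK_lapl2 hLs hk i j l y' hτ0 hα hH (hhol y' hy' τ hτ0.le hτ.2.le)).trans ?_
        have := hD2b i j l
        have := Real.rpow_nonneg hτ0.le (α-2)
        rw [show α - 1 - 1 = α - 2 by ring]
        gcongr)
    have h3 : ((t/2)^(α-1) - ‖y‖^(α-1))/(α-1) ≤ ‖y‖^(α-1)/(1-α) := by
      rw [← neg_div_neg_eq, neg_sub, neg_sub]
      have : 0 ≤ (t/2)^(α-1) := by positivity
      gcongr
      linarith
    have h4 := mul_le_mul_of_nonneg_left h3 (mul_nonneg hH hD2)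
    have := abs_sub_abs_le_abs_sub (IK (pd l (pd i (pd j u))) ρ y' ‖y‖) (IK (pd l (pd i (pd j u))) ρ y' (t/2))
    rw [abs_sub_comm] at this
    linarith
  -- step 3
  have s3 : |IK (pd i (pd j u)) ρ y ‖y‖ - IK (pd i (pd j u)) ρ 0 ‖y‖| ≤
      n * (‖y‖ * (2 * D3 * K / t + H * D2 * (‖y‖^(α-1)/(1-α)))) := by
    have := Convex.norm_image_sub_le_of_norm_deriv_le (f := fun s : ℝ => IK (pd i (pd j u)) ρ (s • y) ‖y‖)
      (s := Set.Icc 0 1) (x := 0) (y := 1) (C := n * (‖y‖ * (2 * D3 * K / t + H * D2 * (‖y‖^(α-1)/(1-α)))))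
      (fun s _ => (IK_deriv_y (cd1 hw) hρ y ‖y‖ s).differentiableAt) (fun s hs => by
        rw [(IK_deriv_y (cd1 hw) hρ y ‖y‖ s).deriv, Real.norm_eq_abs]
        refine abs_sum_mul_le' _ _ _ _ (fun l => ?_) (fun l => ?_)
        · rw [← Real.norm_eq_abs]; exact PiLp.norm_apply_le y l
        · refine s2 _ ?_ l
          rw [norm_smul, Real.norm_of_nonneg hs.1]
          nlinarith [hs.2]) (convex_Icc 0 1) (by simp) (by simp)
    simpa using this
  have f1 : ‖y‖ * ‖y‖^(α-1) = ‖y‖^α := by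
    rw [mul_comm, ← Real.rpow_add_one hyp.ne']; ring_nf
  have f2 : ‖y‖ / t ≤ t^(-α) * ‖y‖^α := by
    have : ‖y‖/t ≤ (‖y‖/t)^α := by
      have := Real.rpow_le_rpow_of_exponent_ge (x := ‖y‖/t) (by positivity) (by rw [div_le_one ht]; linarith) hα1.le
      simpa using this
    rw [Real.div_rpow hyp.le ht.le] at this
    rw [Real.rpow_neg ht.le, inv_mul_eq_div]; exact this
  have a1 := s1 y hy
  have a2 := s1 0 (by simp; positivity)
  have e3 : (n:ℝ) * (‖y‖ * (2 * D3 * K / t + H * D2 * (‖y‖^(α-1)/(1-α)))) =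
     n * (2 * D3 * K * (‖y‖/t) + D2 / (1-α) * H * ‖y‖^α) := by
    rw [← f1]; field_simp
  rw [e3] at s3
  have f3 := mul_le_mul_of_nonneg_left f2 (by positivity : 0 ≤ n * (2 * D3 * K))
  have f4 : |pd i (pd j u) y - pd i (pd j u) 0| ≤ H * D1 * (‖y‖^α/α) + n * (2 * D3 * K * (‖y‖/t) + D2 / (1-α) * H * ‖y‖^α) + H * D1 * (‖y‖^α/α) := by
    rw [abs_le] at *
    constructor <;> linarith [a1.1, a1.2, a2.1, a2.2, s3.1, s3.2]
  refine f4.trans ?_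
  have f5 : (2 * D1 / α + n * (2 * D3 + D2 / (1 - α))) * (H + K * t^(-α)) * ‖y‖^α
    = H * D1 * (‖y‖^α/α) + H * D1 * (‖y‖^α/α) + n * (2 * D3 * K) * (t^(-α)*‖y‖^α) + n * (D2/(1-α)*H*‖y‖^α)
      + (2 * D1 / α * (K * t^(-α)) * ‖y‖^α + n * (2 * D3) * H * ‖y‖^α + n * (D2/(1-α)) * (K * t^(-α)) * ‖y‖^α) := by ring
  rw [f5]
  have : 0 ≤ 2 * D1 / α * (K * t^(-α)) * ‖y‖^α + n * (2 * D3) * H * ‖y‖^α + n * (D2/(1-α)) * (K * t^(-α)) * ‖y‖^α := by positivity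
  linarith

end D2
end PartD2

section PartD3
open Filter Topology MeasureTheory Matrix
open scoped ContDiff

lemma trace_mul_bd {n : ℕ} {M X : Matrix (Fin n) (Fin n) ℝ} {m x : ℝ} (hM : ∀ i j, |M i j| ≤ m)
    (hX : ∀ i j, |X i j| ≤ x) : |(M * X).trace| ≤ n * (n * (m * x)) := by
  simp only [Matrix.trace, Matrix.diag_apply, Matrix.mul_apply]
  exact abs_sum_le' _ _ fun i => abs_sum_mul_le' _ _ _ _ (fun j => hM i j) (fun j => hX j i)

lemma trace_mul_symm {n : ℕ} {M X : Matrix (Fin n) (Fin n) ℝ} (hX : Xᵀ = X) :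
    ∑ i, ∑ j, M i j * X i j = (M * X).trace := by
  simp only [Matrix.trace, Matrix.diag_apply, Matrix.mul_apply]
  refine Finset.sum_congr rfl fun i _ => Finset.sum_congr rfl fun j _ => ?_
  rw [← Matrix.transpose_apply X, hX]

lemma det_freeze (n : ℕ) (K : ℝ) (hK : 0 ≤ K) : ∃ C, 0 ≤ C ∧ ∀ (A0 A A' : Matrix (Fin n) (Fin n) ℝ) (ε δ : ℝ),
    0 ≤ ε → 0 ≤ δ → (∀ i j, |A0 i j| ≤ K) → (∀ i j, |A i j| ≤ K) → (∀ i j, |A' i j| ≤ K) →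
    (∀ i j, |A i j - A0 i j| ≤ ε) → (∀ i j, |A' i j - A0 i j| ≤ ε) → (∀ i j, |A i j - A' i j| ≤ δ) →
    |A.det - A'.det - (A0.adjugate * (A - A')).trace| ≤ C * (ε * δ) := by
  obtain ⟨C, hC0, hC⟩ := adj_lip n K hK
  refine ⟨n * (n * C), by positivity, fun A0 A A' ε δ hε hδ h0 hA hA' h1 h2 h3 => ?_⟩
  have conv : ∀ (u v t c : ℝ), |u| ≤ c → |v| ≤ c → t ∈ Set.Icc (0:ℝ) 1 → |(1 - t) * u + t * v| ≤ c := by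
    intro u v t c hu hv ht
    have a1 := abs_le.1 hu
    have a2 := abs_le.1 hv
    rw [abs_le]
    constructor <;> nlinarith [ht.1, ht.2]
  have hd : ∀ t : ℝ, HasDerivAt (fun t : ℝ => (A' + t • (A - A')).det - t * (A0.adjugate * (A - A')).trace)
      (((A' + t • (A - A')).adjugate * (A - A')).trace - (A0.adjugate * (A - A')).trace) t := by
    intro t
    have := (det_line_hasDerivAt A' (A - A') t).sub ((hasDerivAt_id t).mul_const (A0.adjugate * (A - A')).trace)
    rw [trace_adj_mul (A' + t • (A - A'))]
    rw [one_mul] at this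
    exact this
  have := Convex.norm_image_sub_le_of_norm_deriv_le
    (f := fun t : ℝ => (A' + t • (A - A')).det - t * (A0.adjugate * (A - A')).trace)
    (s := Set.Icc 0 1) (x := 0) (y := 1) (C := n * (n * C) * (ε * δ)) (fun t _ => (hd t).differentiableAt)
    (fun t ht => by
      rw [(hd t).deriv, ← Matrix.trace_sub, ← Matrix.sub_mul, Real.norm_eq_abs]
      have e : ∀ i j, (A' + t • (A - A')) i j = (1 - t) * A' i j + t * A i j := by
        intro i j; simp; ring
      have := trace_mul_bd (M := (A' + t • (A - A')).adjugate - A0.adjugate) (X := A - A') (m := C * ε) (x := δ)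
        (fun i j => (hC _ _ (fun i j => by rw [e]; exact conv _ _ _ _ (hA' i j) (hA i j) ht) h0 i j).2 ε hε
          (fun i j => by
            rw [e, show (1 - t) * A' i j + t * A i j - A0 i j = (1-t) * (A' i j - A0 i j) + t * (A i j - A0 i j) by ring]
            exact conv _ _ _ _ (h2 i j) (h1 i j) ht)) h3
      linarith) (convex_Icc 0 1) (by simp) (by simp)
  simp only [Real.norm_eq_abs] at this
  have e2 : A' + (1:ℝ) • (A - A') = A := by rw [one_smul]; abel
  rw [e2] at this
  simp only [zero_smul, add_zero, zero_mul, sub_zero, one_mul, abs_one, mul_one] at this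
  rw [show A.det - A'.det - (A0.adjugate * (A - A')).trace = A.det - (A0.adjugate * (A - A')).trace - A'.det by ring]
  exact this

set_option maxHeartbeats 1000000 in
lemma g_est (n : ℕ) (lam M' K : ℝ) (hM' : 0 < M') (hK : 0 ≤ K) : ∃ C, 0 ≤ C ∧
    ∀ (L ε ρ : ℝ) (h : EuclideanSpace ℝ (Fin n) → ℝ) (a : EuclideanSpace ℝ (Fin n) → Matrix (Fin n) (Fin n) ℝ)
      (b : EuclideanSpace ℝ (Fin n) → ℝ), 0 ≤ L → L ≤ 1 → Sol n lam M' K L 0 1 h a b → 0 < ρ → ρ ≤ 1 → ρ ≤ ε →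
      (∀ x ∈ Metric.ball (0 : EuclideanSpace ℝ (Fin n)) ρ, ∀ x' ∈ Metric.ball (0 : EuclideanSpace ℝ (Fin n)) ρ,
        ∀ i j, |Hm h x i j - Hm h x' i j| ≤ ε) →
      ∀ x ∈ Metric.ball (0 : EuclideanSpace ℝ (Fin n)) ρ, ∀ x' ∈ Metric.ball (0 : EuclideanSpace ℝ (Fin n)) ρ,
      ∀ δ, 0 ≤ δ → (∀ i j, |Hm h x i j - Hm h x' i j| ≤ δ) →
        |(Fm h a b 0 * Hm h x).trace - (Fm h a b 0 * Hm h x').trace| ≤ C * (ε * δ + ‖x - x'‖) := by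
  obtain ⟨C1, hC1, hf⟩ := det_freeze n K hK
  obtain ⟨C2, hC2, hdl⟩ := det_lip n K hK
  refine ⟨n * (n * n) + M' * C1 + n * C2 + (n * (n * (n * K)) + n * C2), by positivity, ?_⟩
  intro L ε ρ h a b hL0 hL1 S hρ hρ1 hρε hmod x hx x' hx' δ hδ hd
  have hε : 0 < ε := lt_of_lt_of_le hρ hρε
  have sub : ∀ y, y ∈ Metric.ball (0 : EuclideanSpace ℝ (Fin n)) ρ → y ∈ Metric.ball (0 : EuclideanSpace ℝ (Fin n)) 1 :=
    fun y hy => Metric.ball_subset_ball hρ1 hy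
  have h0 : (0 : EuclideanSpace ℝ (Fin n)) ∈ Metric.ball (0 : EuclideanSpace ℝ (Fin n)) ρ := by simpa using hρ
  have lipc : ∀ (f : EuclideanSpace ℝ (Fin n) → ℝ), ContDiff ℝ 1 f →
      (∀ x ∈ Metric.ball (0 : EuclideanSpace ℝ (Fin n)) 1, ∀ k, |pd k f x| ≤ L) →
      ∀ y ∈ Metric.ball (0 : EuclideanSpace ℝ (Fin n)) ρ, ∀ y' ∈ Metric.ball (0 : EuclideanSpace ℝ (Fin n)) ρ,
      |f y - f y'| ≤ n * ‖y - y'‖ := by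
    intro f hf hb y hy y' hy'
    refine (lip_of_pd hf hL0 hb (sub y' hy') (sub y hy)).trans ?_
    have : (n:ℝ) * L ≤ n := mul_le_of_le_one_right (by positivity) hL1
    gcongr
  have ea := fun i j => lipc _ (S.ha i j) (fun x hx k => S.da x hx k i j)
  have eb := lipc _ S.hb S.db
  have nx : ‖x‖ ≤ ε := by
    rw [mem_ball_zero_iff] at hx; linarith
  have q1 := S.eqn x (sub x hx)
  have q2 := S.eqn x' (sub x' hx')
  rw [trace_mul_symm (Hm_symm S.hh _)] at q1 q2
  have t1 : |((a 0 - a x) * (Hm h x - Hm h x')).trace| ≤ n * (n * ((n * ε) * δ)) :=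
    trace_mul_bd (fun i j => by
      have := ea i j 0 h0 x hx
      rw [zero_sub, norm_neg] at this
      refine this.trans ?_
      gcongr) hd
  have t2 : |((a x - a x') * Hm h x').trace| ≤ n * (n * ((n * ‖x - x'‖) * K)) :=
    trace_mul_bd (fun i j => ea i j x hx x' hx') (S.hbd x' (sub x' hx'))
  have dd := (hdl _ _ (S.hbd x (sub x hx)) (S.hbd x' (sub x' hx'))).2 δ hδ hd
  have db := (hdl _ _ (S.hbd x' (sub x' hx')) (S.hbd x' (sub x' hx'))).1
  have t3 : |(b 0 - b x) * ((Hm h x).det - (Hm h x').det)| ≤ (n * ε) * (C2 * δ) := by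
    refine abs_mul_le' ?_ dd
    have := eb 0 h0 x hx
    rw [zero_sub, norm_neg] at this
    refine this.trans ?_
    gcongr
  have t4 : |(b x' - b x) * (Hm h x').det| ≤ (n * ‖x - x'‖) * C2 := by
    refine abs_mul_le' ?_ db
    rw [abs_sub_comm]
    exact eb x hx x' hx'
  have t5 : |b 0 * ((Hm h x).det - (Hm h x').det - ((Hm h 0).adjugate * (Hm h x - Hm h x')).trace)| ≤ M' * (C1 * (ε * δ)) := by
    refine abs_mul_le' ?_ (hf _ _ _ ε δ hε.le hδ (S.hbd 0 (sub 0 h0)) (S.hbd x (sub x hx)) (S.hbd x' (sub x' hx'))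
      (hmod x hx 0 h0) (hmod x' hx' 0 h0) hd)
    rw [abs_of_nonneg (S.b0 0 (sub 0 h0))]
    exact S.bbd 0 (sub 0 h0)
  have key : (Fm h a b 0 * Hm h x).trace - (Fm h a b 0 * Hm h x').trace =
      ((a 0 - a x) * (Hm h x - Hm h x')).trace - ((a x - a x') * Hm h x').trace
      + (b 0 - b x) * ((Hm h x).det - (Hm h x').det) + (b x' - b x) * (Hm h x').det
      - b 0 * ((Hm h x).det - (Hm h x').det - ((Hm h 0).adjugate * (Hm h x - Hm h x')).trace) := by
    unfold Fm
    simp only [Matrix.add_mul, Matrix.sub_mul, Matrix.mul_sub, Matrix.trace_add, Matrix.trace_sub, Matrix.smul_mul,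
      Matrix.trace_smul, smul_eq_mul]
    linear_combination q1 - q2
  rw [key]
  have fin : ∀ p q r s u : ℝ, |p - q + r + s - u| ≤ |p| + |q| + |r| + |s| + |u| := by
    intro p q r s u
    have a1 := abs_sub (p - q + r + s) u
    have a2 := abs_add_le (p - q + r) s
    have a3 := abs_add_le (p - q) r
    have a4 := abs_sub p q
    linarith
  refine (fin _ _ _ _ _).trans ?_
  have n1 : 0 ≤ ‖x - x'‖ := norm_nonneg _
  have n2 : 0 ≤ ε * δ := by positivity
  have hn : (0:ℝ) ≤ n := by positivity
  have z1 : 0 ≤ (n * (n * n) + M' * C1 + n * C2) * ‖x - x'‖ := by positivity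
  have z2 : 0 ≤ (n * (n * (n * K)) + n * C2) * (ε * δ) := by positivity
  nlinarith

section D3
variable {n : ℕ}
local notation "E" => EuclideanSpace ℝ (Fin n)

/-- linear map of a matrix -/
noncomputable def TL (S : Matrix (Fin n) (Fin n) ℝ) : E →L[ℝ] E :=
  LinearMap.toContinuousLinearMap (Matrix.toEuclideanLin S)

lemma TL_apply (S : Matrix (Fin n) (Fin n) ℝ) (z : E) (i : Fin n) : TL S z i = ∑ j, S i j * z j := by
  simp [TL, Matrix.mulVec, dotProduct]

lemma pd_TL {f : E → ℝ} (hf : ContDiff ℝ 1 f) (S : Matrix (Fin n) (Fin n) ℝ) (k : Fin n) (z : E) :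
    pd k (fun z => f (TL S z)) z = ∑ i, S i k * pd i f (TL S z) := by
  have h := ((hf.differentiable one_ne_zero) (TL S z)).hasFDerivAt.comp z (TL S).hasFDerivAt
  have h' : HasFDerivAt (fun z => f (TL S z)) _ z := h
  rw [pd_eq_of_hasFDerivAt h', ContinuousLinearMap.comp_apply, clm_apply_eq_sum]
  refine Finset.sum_congr rfl fun i _ => ?_
  rw [TL_apply]
  simp [pd]

lemma Hm_TL {h : E → ℝ} (hh : ContDiff ℝ ∞ h) (S : Matrix (Fin n) (Fin n) ℝ) (z : E) :
    Hm (fun z => h (TL S z)) z = Sᵀ * Hm h (TL S z) * S := by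
  ext l k
  have e : pd k (fun z => h (TL S z)) = fun z => ∑ i, S i k * pd i h (TL S z) := by
    ext z; exact pd_TL (cd1 hh) S k z
  have hc : ∀ i, ContDiff ℝ ∞ (fun z : E => pd i h (TL S z)) := fun i =>
    (contDiff_pd hh i).comp (TL S).contDiff
  simp only [Hm, Matrix.of_apply, e]
  rw [pd_sum_fun _ (fun i _ => (contDiff_const.mul (hc i)).differentiable (n := ∞) (by norm_cast))]
  rw [Matrix.mul_apply]
  refine Finset.sum_congr rfl fun i _ => ?_
  rw [pd_const_mul _ ((hc i).differentiable (by norm_cast) z), pd_TL (cd1 (contDiff_pd hh i)), Matrix.mul_apply]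
  simp only [Matrix.transpose_apply, Matrix.of_apply]
  ring

lemma norm_TL_le (S : Matrix (Fin n) (Fin n) ℝ) (z : E) : ‖TL S z‖ ≤ √(fsq S) * ‖z‖ := by
  rw [EuclideanSpace.norm_eq, EuclideanSpace.norm_eq, ← Real.sqrt_mul (fsq_nonneg S)]
  refine Real.sqrt_le_sqrt ?_
  unfold fsq
  rw [Finset.sum_mul]
  refine Finset.sum_le_sum fun i _ => ?_
  rw [TL_apply, Real.norm_eq_abs, sq_abs]
  simp_rw [Real.norm_eq_abs, sq_abs]
  exact Finset.sum_mul_sq_le_sq_mul_sq _ _ _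

end D3
end PartD3

section PartD4
open Filter Topology MeasureTheory Matrix
open scoped ContDiff

lemma unsandwich {n : ℕ} {R D : Matrix (Fin n) (Fin n) ℝ} {lam x : ℝ} (hlam : 0 < lam) (hx : 0 ≤ x)
    (hF : ∀ v : Fin n → ℝ, lam * (v ⬝ᵥ v) ≤ v ⬝ᵥ ((Rᵀ * R) *ᵥ v)) (hD : Dᵀ = D)
    (h : ∀ i j, |(R * D * Rᵀ) i j| ≤ x) (i j : Fin n) : |D i j| ≤ n * x / lam := by
  have hs : (Rᵀ * R)ᵀ = Rᵀ * R := by simp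
  have hp := (posDef_of_quad hs hlam hF).posSemidef
  have h1 : fsq (R * D * Rᵀ) = ((Rᵀ * R) * (D * (Rᵀ * R) * D)).trace := by
    rw [fsq_eq_trace, Matrix.transpose_mul, Matrix.transpose_mul, Matrix.transpose_transpose, hD, Matrix.trace_mul_comm]
    rw [show R * (D * Rᵀ) * (R * D * Rᵀ) = R * (D * (Rᵀ * R) * D * Rᵀ) by simp only [Matrix.mul_assoc],
      Matrix.trace_mul_comm R, Matrix.mul_assoc _ Rᵀ R, Matrix.trace_mul_comm]
  have h2 := trace_mul_ge hF (sandwich_psd hp hD)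
  have h3 : (D * (Rᵀ * R) * D).trace = ((Rᵀ * R) * (D * D)).trace := by
    rw [Matrix.mul_assoc, Matrix.trace_mul_comm, Matrix.mul_assoc]
  have hDD : (D * D).PosSemidef := by
    have := Matrix.posSemidef_conjTranspose_mul_self D
    rwa [Matrix.conjTranspose_eq_transpose_of_trivial, hD] at this
  have h4 := trace_mul_ge hF hDD
  have h5 : fsq D = (D * D).trace := by rw [fsq_eq_trace, hD]
  have h6 : fsq (R * D * Rᵀ) ≤ n * (n * x^2) := by
    unfold fsq
    refine (Finset.sum_le_card_nsmul _ _ (n * x^2) fun i _ => ?_).trans (by simp)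
    refine (Finset.sum_le_card_nsmul _ _ (x^2) fun j _ => ?_).trans (by simp)
    exact sq_le_sq.2 (by rw [abs_of_nonneg hx]; exact h i j)
  have h7 : lam^2 * fsq D ≤ (n * x)^2 := by
    rw [h5]
    rw [h3] at h2
    nlinarith
  refine (abs_entry_le_sqrt_fsq D i j).trans ?_
  refine Real.sqrt_le_iff.2 ⟨by positivity, ?_⟩
  rw [div_pow, le_div_iff₀ (by positivity)]
  linarith

lemma solve_TL {n : ℕ} {R : Matrix (Fin n) (Fin n) ℝ} {lam : ℝ} (hlam : 0 < lam)
    (hF : ∀ v : Fin n → ℝ, lam * (v ⬝ᵥ v) ≤ v ⬝ᵥ ((Rᵀ * R) *ᵥ v)) (y : EuclideanSpace ℝ (Fin n)) :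
    ∃ z : EuclideanSpace ℝ (Fin n), TL Rᵀ z = y ∧ ‖z‖ ≤ (√lam)⁻¹ * ‖y‖ := by
  have hs : (Rᵀ * R)ᵀ = Rᵀ * R := by simp
  have hp := posDef_of_quad hs hlam hF
  have hu := (Matrix.isUnit_iff_isUnit_det _).1 hp.isUnit
  obtain ⟨v, hv⟩ : ∃ v : Fin n → ℝ, (Rᵀ * R) *ᵥ v = y.ofLp :=
    ⟨(Rᵀ * R)⁻¹ *ᵥ y.ofLp, by rw [Matrix.mulVec_mulVec, Matrix.mul_nonsing_inv _ hu, Matrix.one_mulVec]⟩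
  refine ⟨WithLp.toLp 2 (R *ᵥ v), ?_, ?_⟩
  · ext i
    rw [TL_apply, ← hv, ← Matrix.mulVec_mulVec]
    rfl
  · have n1 : ‖(WithLp.toLp 2 (R *ᵥ v) : EuclideanSpace ℝ (Fin n))‖^2 = v ⬝ᵥ y.ofLp := by
      rw [EuclideanSpace.norm_sq_eq, ← hv, ← Matrix.mulVec_mulVec, Matrix.dotProduct_mulVec, Matrix.vecMul_transpose]
      simp [dotProduct, sq]
    have n2 : ‖y‖^2 = y.ofLp ⬝ᵥ y.ofLp := by
      rw [EuclideanSpace.norm_sq_eq]; simp [dotProduct, sq]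
    have h1 := hF v
    rw [hv] at h1
    have h2 : (v ⬝ᵥ y.ofLp)^2 ≤ (v ⬝ᵥ v) * (y.ofLp ⬝ᵥ y.ofLp) := by
      have := Finset.sum_mul_sq_le_sq_mul_sq Finset.univ v y.ofLp
      simpa [dotProduct, sq] using this
    have hvv : 0 ≤ v ⬝ᵥ v := dot_self_nonneg v
    have hvy : 0 ≤ v ⬝ᵥ y.ofLp := by rw [← n1]; positivity
    have h3 : v ⬝ᵥ y.ofLp ≤ ‖y‖^2 / lam := by
      rw [le_div_iff₀ hlam]
      rw [← n2] at h2
      rcases eq_or_lt_of_le hvy with h | h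
      · rw [← h]; simp
      · nlinarith [sq_nonneg ‖y‖]
    rw [← n1] at h3
    refine le_of_sq_le_sq ?_ (by positivity)
    rw [mul_pow, inv_pow, Real.sq_sqrt hlam.le, inv_mul_eq_div]
    exact h3

/-- modulus of continuity hypothesis -/
def ModH (n : ℕ) (lam M' K : ℝ) : Prop := ∀ ε, 0 < ε → ∃ ρ, 0 < ρ ∧ ρ ≤ 1 ∧ ∀ (L : ℝ)
  (h : EuclideanSpace ℝ (Fin n) → ℝ) (a : EuclideanSpace ℝ (Fin n) → Matrix (Fin n) (Fin n) ℝ)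
      (b : EuclideanSpace ℝ (Fin n) → ℝ), 0 ≤ L → L ≤ 1 → Sol n lam M' K L 0 1 h a b →
      ∀ x ∈ Metric.ball (0 : EuclideanSpace ℝ (Fin n)) ρ, ∀ x' ∈ Metric.ball (0 : EuclideanSpace ℝ (Fin n)) ρ,
      ∀ i j, |Hm h x i j - Hm h x' i j| ≤ ε

set_option maxHeartbeats 2000000 in
lemma hstep (n : ℕ) (hn : 0 < n) (lam M' K α : ℝ) (hlam : 0 < lam) (hM' : 0 < M') (hK : 0 ≤ K) (hα : 0 < α) (hα1 : α < 1)
    (hmod : ModH n lam M' K) (η : ℝ) (hη : 0 < η) : ∃ C μ, 0 ≤ C ∧ 0 < μ ∧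
    ∀ (L N : ℝ)
    (h : EuclideanSpace ℝ (Fin n) → ℝ) (a : EuclideanSpace ℝ (Fin n) → Matrix (Fin n) (Fin n) ℝ)
      (b : EuclideanSpace ℝ (Fin n) → ℝ), 0 ≤ L → L ≤ 1 → Sol n lam M' K L 0 1 h a b → 0 ≤ N →
      (∀ x ∈ Metric.ball (0 : EuclideanSpace ℝ (Fin n)) (1/2), ∀ x' ∈ Metric.ball (0 : EuclideanSpace ℝ (Fin n)) (1/2),
      ∀ i j, |Hm h x i j - Hm h x' i j| ≤ N * ‖x - x'‖^α) →
      ∀ y : EuclideanSpace ℝ (Fin n), ‖y‖ ≤ μ → ∀ i j, |Hm h y i j - Hm h 0 i j| ≤ (η * N + C) * ‖y‖^α := by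
  obtain ⟨Cs, hCs, hsch⟩ := schauder n hn α hα hα1
  obtain ⟨Cg, hCg, hg⟩ := g_est n lam M' K hM' hK
  obtain ⟨Ca, hCa, hadj⟩ := adj_lip n K hK
  obtain ⟨c, hcd⟩ : ∃ c : ℝ, c = 1 + √(n * (M' + M' * Ca)) := ⟨_, rfl⟩
  have hc1 : 1 ≤ c := by rw [hcd]; linarith [Real.sqrt_nonneg (n * (M' + M' * Ca))]
  have hc0 : 0 < c := by linarith
  have hsl : 0 < √lam := Real.sqrt_pos.2 hlam
  obtain ⟨B, hBd⟩ : ∃ B : ℝ, B = n * Cs / lam * ((√lam)⁻¹^α) := ⟨_, rfl⟩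
  have hB : 0 ≤ B := by rw [hBd]; positivity
  obtain ⟨ε, hεd⟩ : ∃ ε : ℝ, ε = η / (1 + B * Cg * c) := ⟨_, rfl⟩
  have hε : 0 < ε := by rw [hεd]; positivity
  have hεB : B * (Cg * c) * ε ≤ η := by
    rw [hεd, mul_div_assoc', div_le_iff₀ (by positivity)]
    nlinarith
  obtain ⟨ρ', hρ0', hρ1', hmod'⟩ := hmod ε hε
  obtain ⟨ρ, hρd⟩ : ∃ ρ : ℝ, ρ = min ρ' (min ε (1/2)) := ⟨_, rfl⟩
  have hρ : 0 < ρ := by rw [hρd]; positivity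
  have hρρ' : ρ ≤ ρ' := by rw [hρd]; exact min_le_left _ _
  have hρε : ρ ≤ ε := by rw [hρd]; exact (min_le_right _ _).trans (min_le_left _ _)
  have hρh : ρ ≤ 1/2 := by rw [hρd]; exact (min_le_right _ _).trans (min_le_right _ _)
  obtain ⟨t, htd⟩ : ∃ t : ℝ, t = ρ / c := ⟨_, rfl⟩
  have ht : 0 < t := by rw [htd]; positivity
  have htc : c * t = ρ := by rw [htd]; field_simp
  obtain ⟨Ku, hKud⟩ : ∃ Ku : ℝ, Ku = n * (n * (c * K) * c) := ⟨_, rfl⟩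
  have hKu : 0 ≤ Ku := by rw [hKud]; positivity
  refine ⟨B * (Cg * c + Ku * t^(-α)), √lam * (t/4), by positivity, by positivity, ?_⟩
  intro L N h a b hL0 hL1 S hN hhol y hy i j
  have h01 : (0 : EuclideanSpace ℝ (Fin n)) ∈ Metric.ball (0 : EuclideanSpace ℝ (Fin n)) 1 := by simp
  have hsF := Fm_symm (b := b) S.hh S.asymm (0 : EuclideanSpace ℝ (Fin n))
  have hFc := fun v => Fm_coe S h01 v
  obtain ⟨R, hR⟩ := psd_factor (posDef_of_quad hsF hlam hFc).posSemidef
  rw [hR] at hFc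
  have hfs : √(fsq Rᵀ) ≤ c := by
    have e : fsq Rᵀ = (Fm h a b 0).trace := by rw [fsq_eq_trace, Matrix.transpose_transpose, ← hR]
    have e2 : (Fm h a b 0).trace ≤ n * (M' + M' * Ca) := by
      refine (le_abs_self _).trans (abs_sum_le' _ _ fun i => ?_)
      unfold Fm
      simp only [Matrix.diag_apply, Matrix.add_apply, Matrix.smul_apply, smul_eq_mul]
      refine (abs_add_le _ _).trans (add_le_add (S.abd 0 h01 i i) (abs_mul_le' ?_ (hadj _ _ (S.hbd 0 h01) (S.hbd 0 h01) i i).1))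
      rw [abs_of_nonneg (S.b0 0 h01)]; exact S.bbd 0 h01
    rw [e]
    have := Real.sqrt_le_sqrt e2
    rw [hcd]; linarith
  have hTn : ∀ z : EuclideanSpace ℝ (Fin n), ‖TL Rᵀ z‖ ≤ c * ‖z‖ := fun z =>
    (norm_TL_le Rᵀ z).trans (mul_le_mul_of_nonneg_right hfs (norm_nonneg _))
  have hRe : ∀ i j, |R i j| ≤ c := fun i j => (abs_entry_le_sqrt_fsq Rᵀ j i).trans hfs
  have hball : ∀ z ∈ Metric.ball (0 : EuclideanSpace ℝ (Fin n)) t, TL Rᵀ z ∈ Metric.ball (0 : EuclideanSpace ℝ (Fin n)) ρ := by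
    intro z hz
    rw [mem_ball_zero_iff] at hz ⊢
    calc ‖TL Rᵀ z‖ ≤ c * ‖z‖ := hTn z
      _ < c * t := by gcongr
      _ = ρ := htc
  have hHu : ∀ z, Hm (fun z => h (TL Rᵀ z)) z = R * Hm h (TL Rᵀ z) * Rᵀ := by
    intro z; rw [Hm_TL S.hh, Matrix.transpose_transpose]
  have hlap : ∀ z, lapl (fun z => h (TL Rᵀ z)) z = (Fm h a b 0 * Hm h (TL Rᵀ z)).trace := by
    intro z
    have : lapl (fun z => h (TL Rᵀ z)) z = (Hm (fun z => h (TL Rᵀ z)) z).trace := rfl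
    rw [this, hHu, Matrix.trace_mul_comm, hR, ← Matrix.mul_assoc]
  have husm : ContDiff ℝ ∞ (fun z => h (TL Rᵀ z)) := S.hh.comp (TL Rᵀ).contDiff
  obtain ⟨z, hz, hzn⟩ := solve_TL hlam hFc y
  have hzt : ‖z‖ ≤ t/4 := by
    refine hzn.trans ?_
    rw [inv_mul_le_iff₀ hsl]; exact hy
  have b12 : ∀ x, x ∈ Metric.ball (0 : EuclideanSpace ℝ (Fin n)) ρ → x ∈ Metric.ball (0 : EuclideanSpace ℝ (Fin n)) (1/2) :=
    fun x hx => Metric.ball_subset_ball hρh hx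
  have b1 : ∀ x, x ∈ Metric.ball (0 : EuclideanSpace ℝ (Fin n)) ρ → x ∈ Metric.ball (0 : EuclideanSpace ℝ (Fin n)) 1 :=
    fun x hx => Metric.ball_subset_ball (by linarith) hx
  have hmodρ : ∀ x ∈ Metric.ball (0 : EuclideanSpace ℝ (Fin n)) ρ, ∀ x' ∈ Metric.ball (0 : EuclideanSpace ℝ (Fin n)) ρ,
      ∀ i j, |Hm h x i j - Hm h x' i j| ≤ ε := fun x hx x' hx' =>
    hmod' L h a b hL0 hL1 S x (Metric.ball_subset_ball hρρ' hx) x' (Metric.ball_subset_ball hρρ' hx')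
  have main := hsch (fun z => h (TL Rᵀ z)) t (Cg * c * (ε * N + 1)) Ku husm ht (by positivity) hKu
    (fun z hz z' hz' => by
      rw [hlap, hlap]
      have hd : TL Rᵀ z - TL Rᵀ z' = TL Rᵀ (z - z') := by rw [map_sub]
      have hnn : ‖TL Rᵀ z - TL Rᵀ z'‖ ≤ c * ‖z - z'‖ := by rw [hd]; exact hTn _
      have hzz : c * ‖z - z'‖ ≤ c * ‖z - z'‖^α := by
        refine mul_le_mul_of_nonneg_left ?_ hc0.le
        have hle : ‖z - z'‖ ≤ 1 := by
          rw [mem_ball_zero_iff] at hz hz'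
          have := norm_sub_le z z'
          have : t ≤ 1/2 := by rw [htd, div_le_iff₀ hc0]; nlinarith
          linarith
        have := Real.rpow_le_rpow_of_exponent_ge' (norm_nonneg (z - z')) hle hα.le hα1.le
        simpa using this
      have hzp : ‖TL Rᵀ z - TL Rᵀ z'‖^α ≤ c * ‖z - z'‖^α := by
        refine (Real.rpow_le_rpow (norm_nonneg _) hnn hα.le).trans ?_
        rw [Real.mul_rpow hc0.le (norm_nonneg _)]
        refine mul_le_mul_of_nonneg_right ?_ (by positivity)
        have := Real.rpow_le_rpow_of_exponent_le hc1 hα1.le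
        simpa using this
      refine (hg L ε ρ h a b hL0 hL1 S hρ (by linarith) hρε hmodρ _ (hball z hz) _ (hball z' hz')
        (N * ‖TL Rᵀ z - TL Rᵀ z'‖^α) (by positivity) (hhol _ (b12 _ (hball z hz)) _ (b12 _ (hball z' hz')))).trans ?_
      have k1 : ε * (N * ‖TL Rᵀ z - TL Rᵀ z'‖^α) ≤ ε * (N * (c * ‖z - z'‖^α)) := by gcongr
      have : Cg * c * (ε * N + 1) * ‖z - z'‖^α = Cg * (ε * (N * (c * ‖z - z'‖^α)) + c * ‖z - z'‖^α) := by ring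
      rw [this]
      refine mul_le_mul_of_nonneg_left ?_ hCg
      linarith)
    (fun z hz i j => by
      have : pd i (pd j fun z => h (TL Rᵀ z)) z = (Hm (fun z => h (TL Rᵀ z)) z) i j := rfl
      rw [this, hHu, hKud, Matrix.mul_apply]
      refine abs_sum_mul_le' _ _ _ _ (fun k => ?_) (fun k => hRe _ _)
      rw [Matrix.mul_apply]
      exact abs_sum_mul_le' _ _ _ _ (fun k => hRe _ _) (fun l => S.hbd _ (b1 _ (hball z hz)) _ _)) z hzt
  obtain ⟨X, hXd⟩ : ∃ X : ℝ, X = Cs * (Cg * c * (ε * N + 1) + Ku * t^(-α)) * ‖z‖^α := ⟨_, rfl⟩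
  have hX : 0 ≤ X := by rw [hXd]; positivity
  have un := unsandwich (R := R) (D := Hm h y - Hm h 0) (x := X) hlam hX hFc
    (by rw [Matrix.transpose_sub, Hm_symm S.hh, Hm_symm S.hh]) (fun i j => by
      have e : R * (Hm h y - Hm h 0) * Rᵀ = Hm (fun z => h (TL Rᵀ z)) z - Hm (fun z => h (TL Rᵀ z)) 0 := by
        rw [hHu, hHu, hz, map_zero, Matrix.mul_sub, Matrix.sub_mul]
      rw [e, hXd]
      exact main i j) i j
  rw [Matrix.sub_apply] at un
  refine un.trans ?_
  have hza : ‖z‖^α ≤ (√lam)⁻¹^α * ‖y‖^α := by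
    refine (Real.rpow_le_rpow (norm_nonneg _) hzn hα.le).trans ?_
    rw [Real.mul_rpow (by positivity) (norm_nonneg _)]
  have hP : 0 ≤ Cg * c * (ε * N + 1) + Ku * t^(-α) := by positivity
  calc n * X / lam = n * Cs / lam * (Cg * c * (ε * N + 1) + Ku * t^(-α)) * ‖z‖^α := by rw [hXd]; ring
    _ ≤ n * Cs / lam * (Cg * c * (ε * N + 1) + Ku * t^(-α)) * ((√lam)⁻¹^α * ‖y‖^α) := by gcongr
    _ = B * (Cg * c * (ε * N + 1) + Ku * t^(-α)) * ‖y‖^α := by rw [hBd]; ring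
    _ ≤ _ := by
      refine mul_le_mul_of_nonneg_right ?_ (by positivity)
      nlinarith
end PartD4

section PartD5
open Filter Topology MeasureTheory Matrix
open scoped ContDiff

lemma modH_all (n : ℕ) (hn : 0 < n) (lam M' K : ℝ) (hlam : 0 < lam) (hM' : 0 < M') (hK : 0 ≤ K) : ModH n lam M' K := by
  intro ε hε
  rcases Nat.lt_or_ge n 2 with h2 | h2
  · obtain rfl : n = 1 := by omega
    refine ⟨min 1 (ε / (4 * K^2 + 1)), by positivity, min_le_left _ _, ?_⟩
    intro L h a b hL0 hL1 S x hx x' hx' i j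
    have hi : i = 0 := Subsingleton.elim _ _
    have hj : j = 0 := Subsingleton.elim _ _
    subst hi hj
    have sub := Metric.ball_subset_ball (x := (0 : EuclideanSpace ℝ (Fin 1))) (min_le_left 1 (ε / (4 * K^2 + 1)))
    have q1 := S.eqn x (sub hx)
    have q2 := S.eqn x' (sub hx')
    simp only [Fin.sum_univ_one, Matrix.det_unique, Fin.default_eq_zero] at q1 q2
    have l1 := lip_of_pd (S.ha 0 0) hL0 (fun x hx k => S.da x hx k 0 0) (sub hx') (sub hx)
    have l2 := lip_of_pd S.hb hL0 S.db (sub hx') (sub hx)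
    have e : Hm h x 0 0 - Hm h x' 0 0 = -(((a x 0 0 - a x' 0 0) + (b x - b x')) * (Hm h x 0 0 * Hm h x' 0 0)) := by
      linear_combination (Hm h x' 0 0) * q1 - Hm h x 0 0 * q2
    have l3 : |(a x 0 0 - a x' 0 0) + (b x - b x')| ≤ 2 * ‖x - x'‖ := by
      refine (abs_add_le _ _).trans ?_
      have : L * ‖x - x'‖ ≤ ‖x - x'‖ := mul_le_of_le_one_left (norm_nonneg _) hL1
      simp only [Nat.cast_one, one_mul] at l1 l2
      linarith
    rw [e, abs_neg]
    refine (abs_mul_le' l3 (abs_mul_le' (S.hbd x (sub hx) 0 0) (S.hbd x' (sub hx') 0 0))).trans ?_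
    have d : ‖x - x'‖ ≤ 2 * (ε / (4 * K^2 + 1)) := by
      rw [mem_ball_zero_iff] at hx hx'
      have := norm_sub_le x x'
      have := min_le_right 1 (ε / (4 * K^2 + 1))
      linarith
    calc 2 * ‖x - x'‖ * (K * K) ≤ 2 * (2 * (ε / (4 * K^2 + 1))) * (K * K) := by gcongr
      _ = ε * ((4 * K^2) / (4 * K^2 + 1)) := by ring
      _ ≤ ε * 1 := by
        gcongr
        rw [div_le_one (by positivity)]; linarith
      _ = ε := mul_one _
  · exact Mod2 n h2 lam M' K hlam hM' hK ε hε

set_option maxHeartbeats 1000000 in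
lemma holder0 (n : ℕ) (hn : 0 < n) (lam M' K α : ℝ) (hlam : 0 < lam) (hM' : 0 < M') (hK : 0 ≤ K) (hα : 0 < α) (hα1 : α < 1) :
    ∃ C, 0 ≤ C ∧ ∀ (L : ℝ)
    (h : EuclideanSpace ℝ (Fin n) → ℝ) (a : EuclideanSpace ℝ (Fin n) → Matrix (Fin n) (Fin n) ℝ)
      (b : EuclideanSpace ℝ (Fin n) → ℝ), 0 ≤ L → L ≤ 1 → Sol n lam M' K L 0 1 h a b →
      ∀ y : EuclideanSpace ℝ (Fin n), ‖y‖ < 1/2 → ∀ i j, |Hm h y i j - Hm h 0 i j| ≤ C * ‖y‖^α := by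
  obtain ⟨C1, μ, hC1, hμ, hst⟩ := hstep n hn lam M' K α hlam hM' hK hα hα1 (modH_all n hn lam M' K hlam hM' hK) (1/4) (by norm_num)
  obtain ⟨C2, hC2d⟩ : ∃ C2 : ℝ, C2 = C1 + 2 * K * μ^(-α) := ⟨_, rfl⟩
  have hC2 : 0 ≤ C2 := by rw [hC2d]; positivity
  refine ⟨2 * (2 * C2 + 1), by positivity, ?_⟩
  intro L h a b hL0 hL1 S
  -- weighted Hölder property
  obtain ⟨V, hVd⟩ : ∃ V : ℝ → Prop, V = fun N => ∀ x ∈ Metric.ball (0 : EuclideanSpace ℝ (Fin n)) 1,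
    ∀ y ∈ Metric.ball (0 : EuclideanSpace ℝ (Fin n)) 1, ∀ d, 0 < d → d ≤ 1 - ‖x‖ → d ≤ 1 - ‖y‖ →
      ∀ i j, d^α * |Hm h y i j - Hm h x i j| ≤ N * ‖y - x‖^α := ⟨_, rfl⟩
  have hsm : ∀ i j, ContDiff ℝ ∞ (fun x => Hm h x i j) := fun i j => contDiff_pd (contDiff_pd S.hh j) i
  obtain ⟨N0, hN0, hV0⟩ : ∃ N0, 0 ≤ N0 ∧ V N0 := by
    have hb : ∀ p : Fin n × Fin n × Fin n, ∃ G, ∀ x ∈ Metric.closedBall (0 : EuclideanSpace ℝ (Fin n)) 1,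
        ‖pd p.1 (fun x => Hm h x p.2.1 p.2.2) x‖ ≤ G := fun p =>
      (isCompact_closedBall (0 : EuclideanSpace ℝ (Fin n)) 1).exists_bound_of_continuousOn
        (contDiff_pd (hsm p.2.1 p.2.2) p.1).continuous.continuousOn
    choose G hG using hb
    have hG0 : ∀ p, 0 ≤ G p := fun p => (norm_nonneg _).trans (hG p 0 (by simp))
    obtain ⟨Q, hQd⟩ : ∃ Q : ℝ, Q = ∑ p, G p := ⟨_, rfl⟩
    have hQ0 : 0 ≤ Q := by rw [hQd]; exact Finset.sum_nonneg fun p _ => hG0 p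
    refine ⟨n * Q * 2, by positivity, ?_⟩
    rw [hVd]
    intro x hx y hy d hd hdx hdy i j
    have l := lip_of_pd (cd1 (hsm i j)) hQ0 (fun x hx k => by
      rw [← Real.norm_eq_abs]
      refine (hG (k, i, j) x (Metric.ball_subset_closedBall hx)).trans ?_
      rw [hQd]
      exact Finset.single_le_sum (f := G) (fun p _ => hG0 p) (Finset.mem_univ _)) hx hy
    have hd1 : d^α ≤ 1 := Real.rpow_le_one hd.le (by linarith [norm_nonneg x]) hα.le
    have h2 : ‖y - x‖ ≤ 2 * ‖y - x‖^α := by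
      have hle : ‖y - x‖/2 ≤ 1 := by
        rw [mem_ball_zero_iff] at hx hy
        have := norm_sub_le y x
        linarith
      have h1 := Real.rpow_le_rpow_of_exponent_ge' (by positivity) hle hα.le hα1.le
      rw [Real.rpow_one] at h1
      have h3 : (‖y - x‖/2)^α ≤ ‖y - x‖^α := Real.rpow_le_rpow (by positivity) (by linarith [norm_nonneg (y - x)]) hα.le
      linarith
    calc d^α * |Hm h y i j - Hm h x i j| ≤ 1 * (n * Q * ‖y - x‖) := by gcongr
      _ ≤ 1 * (n * Q * (2 * ‖y - x‖^α)) := by gcongr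
      _ = _ := by ring
  have hVs : ∀ N, 0 ≤ N → V N → V (N/2 + C2) := by
    intro N hN hV
    rw [hVd] at hV ⊢
    intro x hx y hy d hd hdx hdy i j
    have hnx := norm_nonneg x
    have hd1 : d ≤ 1 := by linarith
    have hK2 : |Hm h y i j - Hm h x i j| ≤ 2 * K :=
      (abs_sub _ _).trans (by linarith [S.hbd x hx i j, S.hbd y hy i j])
    rcases le_or_gt ‖y - x‖ (μ * d) with hc | hc
    · have hsub : Metric.ball x d ⊆ Metric.ball (0 : EuclideanSpace ℝ (Fin n)) 1 :=
        Metric.ball_subset_ball' (by rw [dist_zero_right]; linarith)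
      have S' := S.rescale hd hsub
      have ee : x + d • (d⁻¹ • (y - x)) = y := by
        rw [smul_smul, mul_inv_cancel₀ hd.ne', one_smul]; abel
      have nz : ‖d⁻¹ • (y - x)‖ = d⁻¹ * ‖y - x‖ := by rw [norm_smul, Real.norm_of_nonneg (by positivity)]
      have := hst (L * d) (2 * N) _ _ _ (by positivity) (by nlinarith) S' (by positivity)
        (fun z hz z' hz' i j => by
          rw [Hm_resc S.hh x hd, Hm_resc S.hh x hd]
          rw [mem_ball_zero_iff] at hz hz'
          have nb : ∀ z : EuclideanSpace ℝ (Fin n), ‖z‖ < 1/2 → ‖x + d • z‖ ≤ 1 - d/2 := by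
            intro z hz
            refine (norm_add_le _ _).trans ?_
            rw [norm_smul, Real.norm_of_nonneg hd.le]
            nlinarith
          have hb1 := nb z hz
          have hb2 := nb z' hz'
          have := hV (x + d • z') (by rw [mem_ball_zero_iff]; linarith) (x + d • z) (by rw [mem_ball_zero_iff]; linarith)
            (d/2) (by positivity) (by linarith) (by linarith) i j
          have e1 : x + d • z - (x + d • z') = d • (z - z') := by rw [smul_sub]; abel
          rw [e1, norm_smul, Real.norm_of_nonneg hd.le, Real.mul_rpow hd.le (norm_nonneg _), Real.div_rpow hd.le (by norm_num)] at this
          have hdα : 0 < d^α := by positivity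
          have h2α : (2:ℝ)^α ≤ 2 := by
            have := Real.rpow_le_rpow_of_exponent_le (by norm_num : (1:ℝ) ≤ 2) hα1.le
            simpa using this
          have h2p : 0 < (2:ℝ)^α := by positivity
          rw [div_mul_eq_mul_div, div_le_iff₀ h2p] at this
          have h4 : d^α * |Hm h (x + d • z) i j - Hm h (x + d • z') i j| ≤ d^α * (2 * N * ‖z - z'‖^α) := by
            refine this.trans ?_
            have : N * (d^α * ‖z - z'‖^α) * 2^α ≤ N * (d^α * ‖z - z'‖^α) * 2 := by gcongr
            linarith
          exact le_of_mul_le_mul_left h4 hdα)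
        (d⁻¹ • (y - x)) (by rw [nz, inv_mul_le_iff₀ hd]; linarith) i j
      rw [Hm_resc S.hh x hd, Hm_resc S.hh x hd, ee, smul_zero, add_zero, nz,
        Real.mul_rpow (by positivity) (norm_nonneg _), Real.inv_rpow hd.le] at this
      have hdα : 0 < d^α := by positivity
      have h5 := mul_le_mul_of_nonneg_left this hdα.le
      have e6 : d^α * ((1/4 * (2*N) + C1) * ((d^α)⁻¹ * ‖y - x‖^α)) = (N/2 + C1) * ‖y - x‖^α := by
        field_simp; ring
      rw [e6] at h5
      refine h5.trans ?_
      have : C1 ≤ C2 := by rw [hC2d]; have : 0 ≤ 2 * K * μ^(-α) := by positivity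
                           linarith
      gcongr
    · have h1 : d^α ≤ μ^(-α) * ‖y - x‖^α := by
        have h2 : (μ * d)^α ≤ ‖y - x‖^α := Real.rpow_le_rpow (by positivity) hc.le hα.le
        rw [Real.mul_rpow hμ.le hd.le] at h2
        rw [Real.rpow_neg hμ.le, ← div_eq_inv_mul, le_div_iff₀ (by positivity)]
        linarith
      calc d^α * |Hm h y i j - Hm h x i j| ≤ (μ^(-α) * ‖y - x‖^α) * (2 * K) := by gcongr
        _ = (2 * K * μ^(-α)) * ‖y - x‖^α := by ring
        _ ≤ _ := by
          refine mul_le_mul_of_nonneg_right ?_ (by positivity)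
          rw [hC2d]; linarith
  have hit : ∀ k : ℕ, V ((1/2)^k * N0 + 2 * C2) := by
    intro k
    induction k with
    | zero =>
      rw [hVd] at hV0 ⊢
      intro x hx y hy d hd hdx hdy i j
      refine (hV0 x hx y hy d hd hdx hdy i j).trans (mul_le_mul_of_nonneg_right ?_ (by positivity))
      simp; linarith
    | succ k ih =>
      have := hVs _ (by positivity) ih
      rw [show ((1/2)^k * N0 + 2 * C2)/2 + C2 = (1/2)^(k+1) * N0 + 2 * C2 by ring] at this
      exact this
  obtain ⟨k, hk⟩ := exists_pow_lt_of_lt_one (show (0:ℝ) < 1/(N0+1) by positivity) (show (1/2 : ℝ) < 1 by norm_num)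
  have hkN : (1/2 : ℝ)^k * N0 ≤ 1 := by
    rw [lt_div_iff₀ (by positivity)] at hk
    nlinarith [pow_pos (show (0:ℝ) < 1/2 by norm_num) k]
  have hfin := hit k
  rw [hVd] at hfin
  intro y hy i j
  have := hfin 0 (by simp) y (by rw [mem_ball_zero_iff]; linarith) (1/2) (by norm_num) (by simp; norm_num) (by linarith) i j
  rw [sub_zero] at this
  have h2 : (1/2 : ℝ) ≤ (1/2)^α := by
    have := Real.rpow_le_rpow_of_exponent_ge (by norm_num : (0:ℝ) < 1/2) (by norm_num) hα1.le
    simpa using this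
  have h3 : 1/2 * |Hm h y i j - Hm h 0 i j| ≤ (1/2)^α * |Hm h y i j - Hm h 0 i j| := by gcongr
  have h4 : ((1/2)^k * N0 + 2 * C2) * ‖y‖^α ≤ (2 * C2 + 1) * ‖y‖^α :=
    mul_le_mul_of_nonneg_right (by linarith) (by positivity)
  linarith
end PartD5

section PartD6
open Filter Topology MeasureTheory Matrix
open scoped ContDiff

section
variable {n : ℕ}
local notation "E" => EuclideanSpace ℝ (Fin n)

lemma exists_global {h : E → ℝ} (hh : ContDiffOn ℝ ∞ h (Metric.ball 0 1)) :
    ∃ g : E → ℝ, ContDiff ℝ ∞ g ∧ ∀ x ∈ Metric.ball (0 : E) (7/8), g =ᶠ[𝓝 x] h := by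
  let χ : ContDiffBump (0 : E) := ⟨7/8, 15/16, by norm_num, by norm_num⟩
  refine ⟨fun x => χ x * h x, ?_, ?_⟩
  · rw [contDiff_iff_contDiffAt]
    intro x
    by_cases hx : x ∈ Metric.ball (0 : E) 1
    · exact χ.contDiff.contDiffAt.mul (hh.contDiffAt (Metric.isOpen_ball.mem_nhds hx))
    · have hx' : x ∈ (Metric.closedBall (0 : E) (15/16))ᶜ := by
        simp only [Set.mem_compl_iff, Metric.mem_closedBall, Metric.mem_ball] at hx ⊢
        intro h; exact hx (h.trans_lt (by norm_num))
      have : (fun x => χ x * h x) =ᶠ[𝓝 x] fun _ => 0 := by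
        filter_upwards [Metric.isClosed_closedBall.isOpen_compl.mem_nhds hx'] with y hy
        simp only [Set.mem_compl_iff, Metric.mem_closedBall, not_le] at hy
        rw [χ.zero_of_le_dist (by exact hy.le), zero_mul]
      exact contDiffAt_const.congr_of_eventuallyEq this
  · intro x hx
    filter_upwards [Metric.isOpen_ball.mem_nhds hx] with y hy
    rw [χ.one_of_mem_closedBall (Metric.ball_subset_closedBall hy), one_mul]

lemma quad_Hm {g : E → ℝ} (hg : ContDiff ℝ ∞ g) (x v w : E) :
    fderiv ℝ (fderiv ℝ g) x v w = ∑ i, ∑ j, v i * w j * Hm g x i j := by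
  have h1 : fderiv ℝ (fderiv ℝ g) x v w = ∑ i, v i * fderiv ℝ (fderiv ℝ g) x (EuclideanSpace.single i 1) w := by
    exact clm_apply_eq_sum ((fderiv ℝ (fderiv ℝ g) x).flip w) v
  rw [h1]
  refine Finset.sum_congr rfl fun i _ => ?_
  rw [clm_apply_eq_sum _ w, Finset.mul_sum]
  refine Finset.sum_congr rfl fun j _ => ?_
  simp only [Hm, Matrix.of_apply]
  rw [pd_pd_eq hg]; ring

lemma psd_of_convex {g : E → ℝ} (hg : ContDiff ℝ ∞ g) {r : ℝ} (hc : ConvexOn ℝ (Metric.ball 0 r) g)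
    {x : E} (hx : x ∈ Metric.ball (0 : E) r) : (Hm g x).PosSemidef := by
  refine Matrix.PosSemidef.of_dotProduct_mulVec_nonneg (by
    rw [Matrix.IsHermitian, Matrix.conjTranspose_eq_transpose_of_trivial]; exact Hm_symm hg x) fun v => ?_
  obtain ⟨w, hw⟩ : ∃ w : E, ∀ i, w i = v i := ⟨WithLp.toLp 2 v, fun i => rfl⟩
  have e : star v ⬝ᵥ Hm g x *ᵥ v = fderiv ℝ (fderiv ℝ g) x w w := by
    rw [quad_Hm hg]
    simp only [dotProduct, Matrix.mulVec, Finset.mul_sum, hw]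
    refine Finset.sum_congr rfl fun i _ => Finset.sum_congr rfl fun j _ => ?_
    simp only [Pi.star_apply, star_trivial]; ring
  rw [e]
  have hl : ∀ t : ℝ, HasDerivAt (fun t : ℝ => x + t • w) w t := by
    intro t
    have := ((hasDerivAt_id t).smul_const w).const_add x
    rw [one_smul] at this; exact this
  have d1 : ∀ t : ℝ, HasDerivAt (fun t : ℝ => g (x + t • w)) (fderiv ℝ g (x + t • w) w) t := fun t =>
    ((hg.differentiable (by simp)) (x + t • w)).hasFDerivAt.comp_hasDerivAt t (hl t)
  have hF : ContDiff ℝ 1 (fderiv ℝ g) := hg.fderiv_right (by norm_cast)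
  have d2 : HasDerivAt (fun t : ℝ => fderiv ℝ g (x + t • w) w) (fderiv ℝ (fderiv ℝ g) x w w) 0 := by
    have h1 := ((hF.differentiable one_ne_zero) (x + (0:ℝ) • w)).hasFDerivAt.comp_hasDerivAt (0:ℝ) (hl 0)
    have h2 := h1.clm_apply (hasDerivAt_const (0:ℝ) w)
    simp only [map_zero, add_zero, zero_smul] at h2
    exact h2
  obtain ⟨S, hS⟩ : ∃ S : Set ℝ, S = (fun t : ℝ => x + t • w) ⁻¹' Metric.ball 0 r := ⟨_, rfl⟩
  have hSo : IsOpen S := by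
    rw [hS]; exact Metric.isOpen_ball.preimage (by fun_prop)
  have h0 : (0:ℝ) ∈ S := by rw [hS]; simpa using hx
  have hcS : ConvexOn ℝ S (fun t : ℝ => g (x + t • w)) := by
    have := hc.comp_affineMap (AffineMap.lineMap x (x + w))
    have e : (AffineMap.lineMap x (x + w) : ℝ → E) = fun t : ℝ => x + t • w := by
      ext1 t; rw [AffineMap.lineMap_apply]; simp [add_comm]
    rw [e] at this
    rw [hS]; exact this
  have hm := hcS.monotoneOn_deriv (fun t _ => (d1 t).differentiableAt)
  have e2 : deriv (fun t : ℝ => g (x + t • w)) = fun t : ℝ => fderiv ℝ g (x + t • w) w := by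
    ext1 t; exact (d1 t).deriv
  rw [e2] at hm
  have := hm.derivWithin_nonneg (x := 0)
  rwa [derivWithin_of_isOpen hSo h0, d2.deriv] at this

lemma norm_D2_sub_le {g : E → ℝ} (hg : ContDiff ℝ ∞ g) {x y : E} {m : ℝ} (hm0 : 0 ≤ m)
    (hm : ∀ i j, |Hm g x i j - Hm g y i j| ≤ m) :
    ‖iteratedFDeriv ℝ 2 g x - iteratedFDeriv ℝ 2 g y‖ ≤ n^2 * m := by
  refine ContinuousMultilinearMap.opNorm_le_bound (by positivity) fun w => ?_
  rw [_root_.sub_apply, iteratedFDeriv_two_apply, iteratedFDeriv_two_apply, quad_Hm hg, quad_Hm hg, ← Finset.sum_sub_distrib, Fin.prod_univ_two, Real.norm_eq_abs]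
  calc _ ≤ ∑ i : Fin n, ∑ j : Fin n, ‖w 0‖ * ‖w 1‖ * m := by
        refine (Finset.abs_sum_le_sum_abs _ _).trans (Finset.sum_le_sum fun i _ => ?_)
        rw [← Finset.sum_sub_distrib]
        refine (Finset.abs_sum_le_sum_abs _ _).trans (Finset.sum_le_sum fun j _ => ?_)
        rw [← mul_sub, abs_mul, abs_mul]
        have h1 := PiLp.norm_apply_le (w 0) i
        have h2 := PiLp.norm_apply_le (w 1) j
        rw [Real.norm_eq_abs] at h1 h2
        have := hm i j
        gcongr
    _ = _ := by
        simp only [Finset.sum_const, Finset.card_univ, Fintype.card_fin, nsmul_eq_mul]; ring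

lemma norm_D2_le {g : E → ℝ} (hg : ContDiff ℝ ∞ g) {x : E} {m : ℝ} (hm0 : 0 ≤ m)
    (hm : ∀ i j, |Hm g x i j| ≤ m) :
    ‖iteratedFDeriv ℝ 2 g x‖ ≤ n^2 * m := by
  refine ContinuousMultilinearMap.opNorm_le_bound (by positivity) fun w => ?_
  rw [iteratedFDeriv_two_apply, quad_Hm hg, Fin.prod_univ_two, Real.norm_eq_abs]
  calc _ ≤ ∑ i : Fin n, ∑ j : Fin n, ‖w 0‖ * ‖w 1‖ * m := by
        refine (Finset.abs_sum_le_sum_abs _ _).trans (Finset.sum_le_sum fun i _ => ?_)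
        refine (Finset.abs_sum_le_sum_abs _ _).trans (Finset.sum_le_sum fun j _ => ?_)
        rw [abs_mul, abs_mul]
        have h1 := PiLp.norm_apply_le (w 0) i
        have h2 := PiLp.norm_apply_le (w 1) j
        rw [Real.norm_eq_abs] at h1 h2
        have := hm i j
        gcongr
    _ = _ := by
        simp only [Finset.sum_const, Finset.card_univ, Fintype.card_fin, nsmul_eq_mul]; ring

lemma gradient_apply (g : E → ℝ) (x : E) (j : Fin n) : gradient g x j = pd j g x := by
  have h := InnerProductSpace.toDual_symm_apply (𝕜 := ℝ) (x := EuclideanSpace.single j (1:ℝ)) (y := fderiv ℝ g x)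
  rw [EuclideanSpace.inner_single_right] at h
  rw [pd, ← h, gradient]
  simp only [one_mul, conj_trivial]

lemma contDiff_gradient {g : E → ℝ} (hg : ContDiff ℝ ∞ g) : ContDiff ℝ ∞ (gradient g) := by
  rw [contDiff_euclidean]
  intro j
  simp only [gradient_apply]
  exact contDiff_pd hg j

lemma pd_comp_gradient {g F : E → ℝ} (hg : ContDiff ℝ ∞ g) (hF : ContDiff ℝ 1 F) {M' K : ℝ} {x : E}
    (hK : ∀ i j, |Hm g x i j| ≤ K) (hM' : ‖fderiv ℝ F (gradient g x)‖ ≤ M') (k : Fin n) :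
    |pd k (fun y => F (gradient g y)) x| ≤ n * (K * M') := by
  have hG : DifferentiableAt ℝ (gradient g) x := (contDiff_gradient hg).differentiable (by simp) x
  have h1 := ((hF.differentiable one_ne_zero) (gradient g x)).hasFDerivAt.comp x hG.hasFDerivAt
  have h2 := pd_eq_of_hasFDerivAt h1 k
  have e : (F ∘ gradient g) = fun y => F (gradient g y) := rfl
  rw [e] at h2
  rw [h2, ContinuousLinearMap.comp_apply, clm_apply_eq_sum]
  have hc : ∀ j, (fderiv ℝ (gradient g) x (EuclideanSpace.single k 1)) j = Hm g x k j := by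
    intro j
    have h3 := (EuclideanSpace.proj j : E →L[ℝ] ℝ).hasFDerivAt.comp x hG.hasFDerivAt
    have h4 := pd_eq_of_hasFDerivAt h3 k
    have e2 : ((EuclideanSpace.proj j : E →L[ℝ] ℝ) ∘ gradient g) = pd j g := by
      ext y; exact gradient_apply g y j
    rw [e2] at h4
    exact h4.symm
  calc _ ≤ ∑ j : Fin n, K * M' := by
        refine (Finset.abs_sum_le_sum_abs _ _).trans (Finset.sum_le_sum fun j _ => ?_)
        rw [abs_mul, hc]
        have h5 := (abs_pd_le F (gradient g x) j).trans hM'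
        exact mul_le_mul (hK k j) h5 (abs_nonneg _) ((abs_nonneg _).trans (hK k j))
    _ = _ := by simp

lemma Hess_eq {g h : E → ℝ} (hg : ContDiff ℝ ∞ g) {x : E} (hgh : g =ᶠ[𝓝 x] h) :
    (Matrix.of fun i j => iteratedFDeriv ℝ 2 h x ![EuclideanSpace.single i 1, EuclideanSpace.single j 1]) = Hm g x := by
  ext i j
  rw [Matrix.of_apply, ← (hgh.iteratedFDeriv ℝ 2).eq_of_nhds, iteratedFDeriv_two_apply]
  simp only [Hm, Matrix.of_apply]
  rw [pd_pd_eq hg]; rfl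

end
end PartD6

open Filter Topology MeasureTheory Matrix
open scoped ContDiff

set_option maxHeartbeats 1000000 in
/-- Proposition 5.4: interior `C^{2,α}` estimates for the equation
`Σ_{ij} a_{ij}(∇h) ∂_i∂_j h + b(∇h) det(D²h) = 1` on the unit ball `B ⊆ ℝⁿ`, where the
coefficients `a_{ij}` (forming a symmetric matrix with `λ·Id < (a_{ij}) < Λ·Id`) and `b ≥ 0`
are `C^{1,α}` with norm at most `M'`, and `h` is a smooth convex solution with
`‖h‖_{C¹(B)} ≤ M`. The conclusion is `‖h‖_{C^{2,α}(B_{1/2})} ≤ C` with `C` depending only on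
`n, α, λ, Λ, M, M'`. -/
theorem statement18 (n : ℕ) (α lam Lam M M' : ℝ)
    (hα : α ∈ Set.Ioo (0 : ℝ) 1) (hlam : 0 < lam) (hLam : lam < Lam)
    (hM : 0 < M) (hM' : 0 < M') :
    ∃ C > 0, ∀ (a : EuclideanSpace ℝ (Fin n) → Matrix (Fin n) (Fin n) ℝ)
      (b : EuclideanSpace ℝ (Fin n) → ℝ) (h : EuclideanSpace ℝ (Fin n) → ℝ),
      (∀ p, (a p).IsSymm) →
      ContDiff ℝ 1 b →
      (∀ i j : Fin n, ContDiff ℝ 1 (fun p => a p i j)) →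
      (∀ p, |b p| ≤ M' ∧ ‖fderiv ℝ b p‖ ≤ M') →
      (∀ p q, ‖fderiv ℝ b p - fderiv ℝ b q‖ ≤ M' * ‖p - q‖ ^ α) →
      (∀ i j : Fin n, ∀ p, |a p i j| ≤ M' ∧ ‖fderiv ℝ (fun r => a r i j) p‖ ≤ M') →
      (∀ i j : Fin n, ∀ p q,
        ‖fderiv ℝ (fun r => a r i j) p - fderiv ℝ (fun r => a r i j) q‖ ≤ M' * ‖p - q‖ ^ α) →
      (∀ p, 0 ≤ b p) →
      (∀ p, (a p - lam • (1 : Matrix (Fin n) (Fin n) ℝ)).PosDef ∧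
        (Lam • (1 : Matrix (Fin n) (Fin n) ℝ) - a p).PosDef) →
      ContDiffOn ℝ (⊤ : ℕ∞) h (Metric.ball 0 1) →
      ConvexOn ℝ (Metric.ball 0 1) h →
      (∀ x ∈ Metric.ball (0 : EuclideanSpace ℝ (Fin n)) 1,
        |h x| ≤ M ∧ ‖fderiv ℝ h x‖ ≤ M) →
      (∀ x ∈ Metric.ball (0 : EuclideanSpace ℝ (Fin n)) 1,
        (∑ i, ∑ j, a (gradient h x) i j * Hess n h x i j) +
          b (gradient h x) * (Hess n h x).det = 1) →
      (∀ x ∈ Metric.ball (0 : EuclideanSpace ℝ (Fin n)) (1 / 2),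
        |h x| ≤ C ∧ ‖fderiv ℝ h x‖ ≤ C ∧ ‖iteratedFDeriv ℝ 2 h x‖ ≤ C) ∧
      (∀ x ∈ Metric.ball (0 : EuclideanSpace ℝ (Fin n)) (1 / 2),
        ∀ y ∈ Metric.ball (0 : EuclideanSpace ℝ (Fin n)) (1 / 2),
        ‖iteratedFDeriv ℝ 2 h x - iteratedFDeriv ℝ 2 h y‖ ≤ C * ‖x - y‖ ^ α) := by
  obtain ⟨hα0, hα1⟩ := hα
  rcases Nat.eq_zero_or_pos n with rfl | hn
  · refine ⟨M, hM, ?_⟩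
    intro a b h _ _ _ _ _ _ _ _ _ hsm _ hb _
    have hsub : Metric.ball (0 : EuclideanSpace ℝ (Fin 0)) (1/2) ⊆ Metric.ball 0 1 :=
      Metric.ball_subset_ball (by norm_num)
    refine ⟨fun x hx => ⟨(hb x (hsub hx)).1, (hb x (hsub hx)).2, ?_⟩, fun x hx y hy => ?_⟩
    · refine ContinuousMultilinearMap.opNorm_le_bound hM.le fun w => ?_
      have : w 0 = 0 := Subsingleton.elim _ _
      rw [(iteratedFDeriv ℝ 2 h x).map_coord_zero 0 this, norm_zero]
      positivity
    · have : x = y := Subsingleton.elim _ _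
      rw [this, sub_self, norm_zero]
      positivity
  obtain ⟨K, hKd⟩ : ∃ K : ℝ, K = 1 / lam := ⟨_, rfl⟩
  have hK : 0 < K := by rw [hKd]; positivity
  obtain ⟨L, hLd⟩ : ∃ L : ℝ, L = n * (K * M') := ⟨_, rfl⟩
  have hL : 0 ≤ L := by rw [hLd]; positivity
  obtain ⟨C0, hC0, hH⟩ := holder0 n hn lam M' K α hlam hM' hK.le hα0 hα1
  obtain ⟨r0, hr0d⟩ : ∃ r0 : ℝ, r0 = min (1/4) (1 / (L + 1)) := ⟨_, rfl⟩
  have hr0 : 0 < r0 := by rw [hr0d]; positivity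
  have hr04 : r0 ≤ 1/4 := by rw [hr0d]; exact min_le_left _ _
  have hLr : L * r0 ≤ 1 := by
    have h1 : r0 ≤ 1 / (L + 1) := by rw [hr0d]; exact min_le_right _ _
    rw [le_div_iff₀ (by positivity)] at h1
    nlinarith
  obtain ⟨C1, hC1d⟩ : ∃ C1 : ℝ, C1 = C0 * (r0⁻¹)^α + 2 * K * (2 * r0⁻¹)^α := ⟨_, rfl⟩
  have hC1 : 0 ≤ C1 := by rw [hC1d]; positivity
  refine ⟨M + n^2 * K + n^2 * C1, by positivity, ?_⟩
  intro a b h hsymm hbc hac hbb _ hab _ hb0 hapd hsm hconv hbd heq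
  obtain ⟨g, hg, hgh⟩ := exists_global hsm
  have sub1 : Metric.ball (0 : EuclideanSpace ℝ (Fin n)) (7/8) ⊆ Metric.ball 0 1 :=
    Metric.ball_subset_ball (by norm_num)
  have sub2 : Metric.ball (0 : EuclideanSpace ℝ (Fin n)) (1/2) ⊆ Metric.ball 0 (7/8) :=
    Metric.ball_subset_ball (by norm_num)
  have hgc : ConvexOn ℝ (Metric.ball 0 (7/8)) g :=
    (hconv.subset sub1 (convex_ball _ _)).congr fun x hx => (hgh x hx).eq_of_nhds.symm
  have hpsd : ∀ x ∈ Metric.ball (0 : EuclideanSpace ℝ (Fin n)) (7/8), (Hm g x).PosSemidef :=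
    fun x hx => psd_of_convex hg hgc hx
  have hgrad : ∀ x ∈ Metric.ball (0 : EuclideanSpace ℝ (Fin n)) (7/8), gradient h x = gradient g x := by
    intro x hx
    rw [gradient, gradient, (hgh x hx).fderiv_eq]
  have hacoe : ∀ p, ∀ v : Fin n → ℝ, lam * (v ⬝ᵥ v) ≤ v ⬝ᵥ (a p *ᵥ v) := by
    intro p v
    have h1 := (hapd p).1.posSemidef.dotProduct_mulVec_nonneg v
    rw [Matrix.sub_mulVec, Matrix.smul_mulVec, Matrix.one_mulVec, dotProduct_sub, dotProduct_smul,
      star_trivial, smul_eq_mul] at h1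
    linarith
  have heqn : ∀ x ∈ Metric.ball (0 : EuclideanSpace ℝ (Fin n)) (7/8),
      (∑ i, ∑ j, a (gradient g x) i j * Hm g x i j) + b (gradient g x) * (Hm g x).det = 1 := by
    intro x hx
    have h1 := heq x (sub1 hx)
    have h2 : Hess n h x = Hm g x := Hess_eq hg (hgh x hx)
    rw [h2, hgrad x hx] at h1
    exact h1
  have hhb : ∀ x ∈ Metric.ball (0 : EuclideanSpace ℝ (Fin n)) (7/8), ∀ i j, |Hm g x i j| ≤ K := by
    intro x hx i j
    refine (psd_entry_le_trace (hpsd x hx) i j).trans ?_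
    have h1 := heqn x hx
    rw [trace_mul_symm (Hm_symm hg x)] at h1
    have h2 := trace_mul_ge (hacoe (gradient g x)) (hpsd x hx)
    have h3 := mul_nonneg (hb0 (gradient g x)) (hpsd x hx).det_nonneg
    rw [hKd, le_div_iff₀ hlam]
    linarith
  have hG : ContDiff ℝ 1 (gradient g) := (contDiff_gradient hg).of_le (by norm_cast)
  have S : Sol n lam M' K L 0 (7/8) g (fun x => a (gradient g x)) (fun x => b (gradient g x)) :=
    { hh := hg
      ha := fun i j => (hac i j).comp hG
      hb := hbc.comp hG
      asymm := fun x => hsymm _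
      acoe := fun x _ => hacoe _
      abd := fun x _ i j => (hab i j _).1
      b0 := fun x _ => hb0 _
      bbd := fun x _ => (le_abs_self _).trans (hbb _).1
      da := fun x hx k i j => by
        rw [hLd]; exact pd_comp_gradient hg (hac i j) (hhb x hx) (hab i j _).2 k
      db := fun x hx k => by
        rw [hLd]; exact pd_comp_gradient hg hbc (hhb x hx) (hbb _).2 k
      psd := hpsd
      hbd := hhb
      eqn := heqn }
  have hD2 : ∀ x ∈ Metric.ball (0 : EuclideanSpace ℝ (Fin n)) (1/2),
      iteratedFDeriv ℝ 2 h x = iteratedFDeriv ℝ 2 g x := fun x hx =>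
    (((hgh x (sub2 hx)).iteratedFDeriv ℝ 2).eq_of_nhds).symm
  have p1 : 0 ≤ (n:ℝ)^2 * K := by positivity
  have p2 : 0 ≤ (n:ℝ)^2 * C1 := by positivity
  refine ⟨fun x hx => ⟨?_, ?_, ?_⟩, fun x hx y hy => ?_⟩
  · have := (hbd x (sub1 (sub2 hx))).1; linarith
  · have := (hbd x (sub1 (sub2 hx))).2; linarith
  · rw [hD2 x hx]
    have := norm_D2_le hg hK.le (hhb x (sub2 hx))
    linarith
  · rw [hD2 x hx, hD2 y hy]
    have key : ∀ i j, |Hm g x i j - Hm g y i j| ≤ C1 * ‖x - y‖^α := by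
      intro i j
      have t1 : 0 ≤ C0 * (r0⁻¹)^α * ‖x - y‖^α := by positivity
      have t2 : 0 ≤ 2 * K * (2 * r0⁻¹)^α * ‖x - y‖^α := by positivity
      have t3 : C1 * ‖x - y‖^α = C0 * (r0⁻¹)^α * ‖x - y‖^α + 2 * K * (2 * r0⁻¹)^α * ‖x - y‖^α := by
        rw [hC1d]; ring
      rw [t3]
      rcases lt_or_ge (‖x - y‖) (r0 / 2) with hlt | hge
      · have hsub : Metric.ball y r0 ⊆ Metric.ball (0 : EuclideanSpace ℝ (Fin n)) (7/8) := by
          refine Metric.ball_subset_ball' ?_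
          have := Metric.mem_ball.1 hy
          linarith
        have S' := S.rescale hr0 hsub
        have hz : ‖r0⁻¹ • (x - y)‖ = r0⁻¹ * ‖x - y‖ := by
          rw [norm_smul, Real.norm_eq_abs, abs_of_pos (inv_pos.2 hr0)]
        have hz2 : ‖r0⁻¹ • (x - y)‖ < 1/2 := by
          rw [hz, inv_mul_lt_iff₀ hr0]; linarith
        have h1 := hH (L * r0) _ _ _ (by positivity) hLr S' _ hz2 i j
        rw [Hm_resc hg y hr0, Hm_resc hg y hr0, smul_smul, mul_inv_cancel₀ hr0.ne', one_smul, smul_zero,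
          add_zero, add_sub_cancel, hz, Real.mul_rpow (inv_pos.2 hr0).le (norm_nonneg _), ← mul_assoc] at h1
        linarith
      · have h1 := hhb x (sub2 hx) i j
        have h2 := hhb y (sub2 hy) i j
        have h3 : |Hm g x i j - Hm g y i j| ≤ 2 * K := by
          refine (abs_sub _ _).trans ?_
          linarith
        have h4 : 1 ≤ (2 * r0⁻¹)^α * ‖x - y‖^α := by
          rw [← Real.mul_rpow (by positivity) (norm_nonneg _)]
          refine Real.one_le_rpow ?_ hα0.le
          have : (2 * r0⁻¹) * (r0 / 2) = 1 := by field_simp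
          calc (1:ℝ) = (2 * r0⁻¹) * (r0 / 2) := this.symm
            _ ≤ _ := by gcongr
        have h5 : 2 * K ≤ 2 * K * (2 * r0⁻¹)^α * ‖x - y‖^α := by
          rw [mul_assoc]
          exact le_mul_of_one_le_right (by positivity) h4
        linarith
    have h1 := norm_D2_sub_le hg (by positivity) key
    have h2 : 0 ≤ ‖x - y‖^α := by positivity
    have h3 : (n:ℝ)^2 * (C1 * ‖x - y‖^α) ≤ (M + n^2 * K + n^2 * C1) * ‖x - y‖^α := by
      rw [← mul_assoc]
      refine mul_le_mul_of_nonneg_right ?_ h2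
      linarith
    exact h1.trans h3
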